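/- In the depth-2 Jones tower setup, with s the common cardinality of the orthogonal dual bases {uⱼ}, {vⱼ} ⊆ B for E_{M₁}: the centralizer C is isomorphic as a k-algebra to the s × s matrix algebra over k, C ≅ Mₛ(k), and the characteristic of k does not divide s (i.e., s·1_k ≠ 0; indeed λ⁻¹ = s·1_k). -/

import Mathlib

open scoped TensorProduct

/-- The depth-2 Jones tower setup: a tower `N ⊆ M ⊆ M₁ ⊆ R` (with `R` playing the
role of `M₂`) of unital `k`-algebras, with conditional expectations, Jones idempotents,
braid-like relations and depth-2 orthogonal dual bases, as in the paper. -/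
structure JonesTower (k : Type*) [Field k] (R : Type*) [Ring R] [Algebra k R] where
  N : Subalgebra k R
  M : Subalgebra k R
  M₁ : Subalgebra k R
  hNM : N ≤ M
  hMM₁ : M ≤ M₁
  lam : k
  hlam : lam ≠ 0
  E : R →ₗ[k] R
  EM : R →ₗ[k] R
  EM1 : R →ₗ[k] R
  hE_mem : ∀ m ∈ M, E m ∈ N
  hEM_mem : ∀ x ∈ M₁, EM x ∈ M
  hEM1_mem : ∀ x : R, EM1 x ∈ M₁
  hE_one : E 1 = 1
  hEM_one : EM 1 = 1
  hEM1_one : EM1 1 = 1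
  hE_bimod : ∀ n ∈ N, ∀ n' ∈ N, ∀ m ∈ M, E (n * m * n') = n * E m * n'
  hEM_bimod : ∀ m ∈ M, ∀ m' ∈ M, ∀ x ∈ M₁, EM (m * x * m') = m * EM x * m'
  hEM1_bimod : ∀ w ∈ M₁, ∀ w' ∈ M₁, ∀ x : R, EM1 (w * x * w') = w * EM1 x * w'
  n₀ : ℕ
  xb : Fin n₀ → R
  yb : Fin n₀ → R
  hxb : ∀ i, xb i ∈ M
  hyb : ∀ i, yb i ∈ M
  hE_dual₁ : ∀ m ∈ M, ∑ i, E (m * xb i) * yb i = m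
  hE_dual₂ : ∀ m ∈ M, ∑ i, xb i * E (yb i * m) = m
  hE_index : ∑ i, xb i * yb i = lam⁻¹ • (1 : R)
  hCMN : ∀ c ∈ M, (∀ n ∈ N, c * n = n * c) → ∃ μ : k, c = μ • (1 : R)
  hCM₁M : ∀ c ∈ M₁, (∀ m ∈ M, c * m = m * c) → ∃ μ : k, c = μ • (1 : R)
  hCM₂M₁ : ∀ c : R, (∀ w ∈ M₁, c * w = w * c) → ∃ μ : k, c = μ • (1 : R)
  e₁ : R
  e₂ : R
  he₁ : e₁ ∈ M₁
  he₁N : ∀ n ∈ N, e₁ * n = n * e₁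
  he₂M : ∀ m ∈ M, e₂ * m = m * e₂
  he₁me₁ : ∀ m ∈ M, e₁ * m * e₁ = E m * e₁
  he₂we₂ : ∀ w ∈ M₁, e₂ * w * e₂ = EM w * e₂
  hEMe₁ : EM e₁ = lam • (1 : R)
  hEM1e₂ : EM1 e₂ = lam • (1 : R)
  hspanM₁ : Subalgebra.toSubmodule M₁ =
    Submodule.span k {x : R | ∃ m ∈ M, ∃ m' ∈ M, x = m * e₁ * m'}
  hspanM₂ : (⊤ : Submodule k R) =
    Submodule.span k {x : R | ∃ w ∈ M₁, ∃ w' ∈ M₁, x = w * e₂ * w'}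
  hbraid₁ : e₁ * e₂ * e₁ = lam • e₁
  hbraid₂ : e₂ * e₁ * e₂ = lam • e₂
  r : ℕ
  zb : Fin r → R
  wb : Fin r → R
  hzbM₁ : ∀ i, zb i ∈ M₁
  hwbM₁ : ∀ i, wb i ∈ M₁
  hzbN : ∀ i, ∀ n ∈ N, zb i * n = n * zb i
  hwbN : ∀ i, ∀ n ∈ N, wb i * n = n * wb i
  hzw_orth : ∀ i j, EM (wb i * zb j) = if i = j then (1 : R) else 0
  hzw_dual₁ : ∀ x ∈ M₁, ∑ i, EM (x * zb i) * wb i = x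
  hzw_dual₂ : ∀ x ∈ M₁, ∑ i, zb i * EM (wb i * x) = x
  hzw_index : ∑ i, zb i * wb i = lam⁻¹ • (1 : R)
  s : ℕ
  ub : Fin s → R
  vb : Fin s → R
  hubM : ∀ i, ∀ m ∈ M, ub i * m = m * ub i
  hvbM : ∀ i, ∀ m ∈ M, vb i * m = m * vb i
  huv_orth : ∀ i j, EM1 (vb i * ub j) = if i = j then (1 : R) else 0
  huv_dual₁ : ∀ x : R, ∑ i, EM1 (x * ub i) * vb i = x
  huv_dual₂ : ∀ x : R, ∑ i, ub i * EM1 (vb i * x) = x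
  huv_index : ∑ i, ub i * vb i = lam⁻¹ • (1 : R)
  F : R →ₗ[k] k
  hF : ∀ c : R, (∀ n ∈ N, c * n = n * c) → algebraMap k R (F c) = EM (EM1 c)

variable {k : Type*} [Field k] {R : Type*} [Ring R] [Algebra k R]

/-- The second centralizer `A = C_{M₁}(N)`. -/
def JonesTower.A (T : JonesTower k R) : Subalgebra k R :=
  T.M₁ ⊓ Subalgebra.centralizer k (T.N : Set R)

/-- The second centralizer `B = C_{M₂}(M)`. -/
def JonesTower.B (T : JonesTower k R) : Subalgebra k R :=
  Subalgebra.centralizer k (T.M : Set R)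

/-- The big centralizer `C = C_{M₂}(N)`. -/
def JonesTower.C (T : JonesTower k R) : Subalgebra k R :=
  Subalgebra.centralizer k (T.N : Set R)

namespace Leg

open Matrix

variable {ι S : Type*} [CommRing S] {m n l : ℕ}

open Classical in
/-- Let the operator `X` act on the tensor legs selected by `f`. -/
noncomputable def leg (f : Fin m → Fin n) (X : Matrix (Fin m → ι) (Fin m → ι) S) :
    Matrix (Fin n → ι) (Fin n → ι) S :=
  Matrix.of fun s t => if ∀ q, q ∉ Set.range f → s q = t q then X (s ∘ f) (t ∘ f) else 0

open Classical in
theorem leg_apply (f : Fin m → Fin n) (X : Matrix (Fin m → ι) (Fin m → ι) S) (s t : Fin n → ι) :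
    leg f X s t = if ∀ q, q ∉ Set.range f → s q = t q then X (s ∘ f) (t ∘ f) else 0 := rfl

theorem leg_add (f : Fin m → Fin n) (X Y : Matrix (Fin m → ι) (Fin m → ι) S) :
    leg f (X + Y) = leg f X + leg f Y := by
  ext s t; simp only [leg_apply, Matrix.add_apply]; split_ifs <;> simp

theorem leg_sub (f : Fin m → Fin n) (X Y : Matrix (Fin m → ι) (Fin m → ι) S) :
    leg f (X - Y) = leg f X - leg f Y := by
  ext s t; simp only [leg_apply, Matrix.sub_apply]; split_ifs <;> simp

theorem leg_smul (f : Fin m → Fin n) (c : S) (X : Matrix (Fin m → ι) (Fin m → ι) S) :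
    leg f (c • X) = c • leg f X := by
  ext s t; simp only [leg_apply, Matrix.smul_apply]; split_ifs <;> simp

theorem leg_zero (f : Fin m → Fin n) : leg f (0 : Matrix (Fin m → ι) (Fin m → ι) S) = 0 := by
  ext s t; simp [leg_apply]

theorem leg_sum {κ : Type*} (f : Fin m → Fin n) (I : Finset κ)
    (X : κ → Matrix (Fin m → ι) (Fin m → ι) S) :
    leg f (∑ i ∈ I, X i) = ∑ i ∈ I, leg f (X i) := by
  classical
  induction I using Finset.induction_on with
  | empty => simp [leg_zero]
  | insert a I h ih => simp [Finset.sum_insert h, leg_add, ih]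

theorem leg_map {S' : Type*} [CommRing S'] (φ : S →+* S') (f : Fin m → Fin n)
    (X : Matrix (Fin m → ι) (Fin m → ι) S) : leg f (X.map φ) = (leg f X).map φ := by
  ext s t; simp only [leg_apply, Matrix.map_apply]; split_ifs <;> simp

theorem leg_one [DecidableEq ι] (f : Fin m → Fin n) :
    leg f (1 : Matrix (Fin m → ι) (Fin m → ι) S) = 1 := by
  ext s t
  simp only [leg_apply, Matrix.one_apply]
  by_cases h : s = t
  · subst h; simp
  · rw [if_neg h]
    by_cases h1 : ∀ q, q ∉ Set.range f → s q = t q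
    · rw [if_pos h1, if_neg]
      intro h2
      apply h
      ext q
      by_cases hq : q ∈ Set.range f
      · obtain ⟨p, rfl⟩ := hq
        exact congrFun h2 p
      · exact h1 q hq
    · rw [if_neg h1]

theorem leg_leg (g : Fin n → Fin l) (hg : Function.Injective g) (f : Fin m → Fin n)
    (X : Matrix (Fin m → ι) (Fin m → ι) S) : leg g (leg f X) = leg (g ∘ f) X := by
  ext s t
  simp only [leg_apply]
  by_cases h1 : ∀ q, q ∉ Set.range (g ∘ f) → s q = t q
  · rw [if_pos h1, if_pos, if_pos]
    · rfl
    · intro q hq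
      apply h1
      rintro ⟨p, hp⟩
      exact hq ⟨p, hg hp⟩
    · intro q hq
      apply h1
      rintro ⟨p, hp⟩
      exact hq ⟨f p, hp⟩
  · rw [if_neg h1]
    split_ifs with h2 h3
    · exfalso
      apply h1
      intro q hq
      by_cases hq' : q ∈ Set.range g
      · obtain ⟨p, rfl⟩ := hq'
        apply h3
        rintro ⟨x, rfl⟩
        exact hq ⟨x, rfl⟩
      · exact h2 q hq'
    · rfl
    · rfl

theorem inj0 : Function.Injective (fun _ : Fin 1 => (0 : Fin (n + 1))) :=
  fun _ _ _ => Subsingleton.elim _ _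

theorem extend_zero (a : Fin 1 → ι) (i : ι) (s : Fin n → ι) :
    Function.extend (fun _ : Fin 1 => (0 : Fin (n + 1))) a (Fin.cons i s : Fin (n + 1) → ι)
      = Fin.cons (a 0) s := by
  ext q
  refine Fin.cases ?_ (fun j => ?_) q
  · exact inj0.extend_apply a _ 0
  · rw [Function.extend_apply']
    · rfl
    · rintro ⟨_, h⟩; exact Fin.succ_ne_zero j h.symm

theorem extend_succ (a s : Fin n → ι) (i : ι) :
    Function.extend Fin.succ a (Fin.cons i s : Fin (n + 1) → ι) = Fin.cons i a := by
  ext q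
  refine Fin.cases ?_ (fun j => ?_) q
  · rw [Function.extend_apply']
    · rfl
    · rintro ⟨j, h⟩; exact Fin.succ_ne_zero j h
  · exact (Fin.succ_injective n).extend_apply a _ j

theorem cons_comp_succ (s : Fin n → ι) (i : ι) :
    (Fin.cons i s : Fin (n + 1) → ι) ∘ Fin.succ = s := rfl

variable [Fintype ι]

open Classical in
theorem sum_leg_index (f : Fin m → Fin n) (hf : Function.Injective f) (s : Fin n → ι)
    (G : (Fin n → ι) → S) :
    (∑ u, if ∀ q, q ∉ Set.range f → s q = u q then G u else 0)
      = ∑ a : Fin m → ι, G (Function.extend f a s) := by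
  rw [← Finset.sum_filter]
  refine Finset.sum_bij' (fun u _ => u ∘ f) (fun a _ => Function.extend f a s) ?_ ?_ ?_ ?_ ?_
  · simp
  · intro a _
    simp only [Finset.mem_filter, Finset.mem_univ, true_and]
    intro q hq
    rw [Function.extend_apply']
    simpa using hq
  · intro u hu
    simp only [Finset.mem_filter, Finset.mem_univ, true_and] at hu
    ext q
    by_cases hq : q ∈ Set.range f
    · obtain ⟨p, rfl⟩ := hq
      rw [hf.extend_apply]; rfl
    · rw [Function.extend_apply' _ _ _ (by simpa using hq)]
      exact hu q hq
  · intro a _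
    exact Function.extend_comp hf _ _
  · intro u hu
    simp only [Finset.mem_filter, Finset.mem_univ, true_and] at hu
    congr 1
    ext q
    by_cases hq : q ∈ Set.range f
    · obtain ⟨p, rfl⟩ := hq
      rw [hf.extend_apply]; rfl
    · rw [Function.extend_apply' _ _ _ (by simpa using hq)]
      exact (hu q hq).symm

theorem leg_mul_apply (f : Fin m → Fin n) (hf : Function.Injective f)
    (X : Matrix (Fin m → ι) (Fin m → ι) S) (Z : Matrix (Fin n → ι) (Fin n → ι) S)
    (s t : Fin n → ι) :
    (leg f X * Z) s t = ∑ a : Fin m → ι, X (s ∘ f) a * Z (Function.extend f a s) t := by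
  classical
  rw [Matrix.mul_apply]
  simp only [leg_apply, ite_mul, zero_mul]
  rw [sum_leg_index f hf]
  simp [Function.extend_comp hf]

theorem mul_leg_apply (f : Fin m → Fin n) (hf : Function.Injective f)
    (X : Matrix (Fin m → ι) (Fin m → ι) S) (Z : Matrix (Fin n → ι) (Fin n → ι) S)
    (s t : Fin n → ι) :
    (Z * leg f X) s t = ∑ a : Fin m → ι, Z s (Function.extend f a t) * X a (t ∘ f) := by
  classical
  rw [Matrix.mul_apply]
  have : ∀ u : Fin n → ι, (∀ q, q ∉ Set.range f → u q = t q) ↔ (∀ q, q ∉ Set.range f → t q = u q) :=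
    fun u => forall₂_congr fun _ _ => eq_comm
  simp only [leg_apply, mul_ite, mul_zero, this]
  rw [sum_leg_index f hf]
  simp [Function.extend_comp hf]

theorem leg_mul (f : Fin m → Fin n) (hf : Function.Injective f)
    (X Y : Matrix (Fin m → ι) (Fin m → ι) S) : leg f (X * Y) = leg f X * leg f Y := by
  classical
  ext s t
  rw [leg_mul_apply f hf, leg_apply]
  have key : ∀ a : Fin m → ι, (∀ q, q ∉ Set.range f → Function.extend f a s q = t q) ↔
      (∀ q, q ∉ Set.range f → s q = t q) := by
    intro a
    refine forall₂_congr fun q hq => ?_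
    rw [Function.extend_apply' _ _ _ (by simpa using hq)]
  simp only [leg_apply, key, Function.extend_comp hf]
  split_ifs <;> simp [Matrix.mul_apply]

theorem leg_comm {m' : ℕ} (f : Fin m → Fin n) (g : Fin m' → Fin n) (hf : Function.Injective f)
    (h : ∀ i j, f i ≠ g j) (X : Matrix (Fin m → ι) (Fin m → ι) S)
    (Y : Matrix (Fin m' → ι) (Fin m' → ι) S) : leg f X * leg g Y = leg g Y * leg f X := by
  classical
  ext s t
  rw [leg_mul_apply f hf, mul_leg_apply f hf]
  have hfg : ∀ i, f i ∉ Set.range g := fun i ⟨j, hj⟩ => h i j hj.symm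
  have hgf : ∀ j, g j ∉ Set.range f := fun j ⟨i, hi⟩ => h i j hi
  have e1 : ∀ a : Fin m → ι, ∀ s, Function.extend f a s ∘ g = s ∘ g := by
    intro a s; ext j
    exact Function.extend_apply' _ _ _ (by simpa using hgf j)
  rw [Finset.sum_eq_single (t ∘ f), Finset.sum_eq_single (s ∘ f)]
  · simp only [leg_apply, e1, mul_comm]
    congr 2
    apply propext
    constructor
    all_goals
      intro H q hq
      have := H q hq
      by_cases hq' : q ∈ Set.range f
      · obtain ⟨p, rfl⟩ := hq'
        simp [hf.extend_apply]
      · rwa [Function.extend_apply' _ _ _ (by simpa using hq')] at this ⊢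
  · intro a _ ha
    rw [leg_apply, if_neg, zero_mul]
    intro H
    apply ha
    ext i
    have := H (f i) (hfg i)
    rw [hf.extend_apply] at this
    exact this.symm
  · simp
  · intro a _ ha
    rw [leg_apply, if_neg, mul_zero]
    intro H
    apply ha
    ext i
    have := H (f i) (hfg i)
    rw [hf.extend_apply] at this
    exact this
  · simp

/-- Partial trace over the zeroth tensor leg. -/
def pt (X : Matrix (Fin (n + 1) → ι) (Fin (n + 1) → ι) S) : Matrix (Fin n → ι) (Fin n → ι) S :=
  Matrix.of fun s t => ∑ i, X (Fin.cons i s) (Fin.cons i t)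

theorem pt_apply (X : Matrix (Fin (n + 1) → ι) (Fin (n + 1) → ι) S) (s t : Fin n → ι) :
    pt X s t = ∑ i, X (Fin.cons i s) (Fin.cons i t) := rfl

theorem pt_add (X Y : Matrix (Fin (n + 1) → ι) (Fin (n + 1) → ι) S) :
    pt (X + Y) = pt X + pt Y := by
  ext; simp [pt_apply, Finset.sum_add_distrib]

theorem pt_sum {κ : Type*} (I : Finset κ)
    (X : κ → Matrix (Fin (n + 1) → ι) (Fin (n + 1) → ι) S) :
    pt (∑ i ∈ I, X i) = ∑ i ∈ I, pt (X i) := by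
  classical
  induction I using Finset.induction_on with
  | empty => ext; simp [pt_apply]
  | insert a I h ih => simp [Finset.sum_insert h, pt_add, ih]

theorem pt_cyclic (K : Matrix (Fin 1 → ι) (Fin 1 → ι) S)
    (X : Matrix (Fin (n + 1) → ι) (Fin (n + 1) → ι) S) :
    pt (leg (fun _ : Fin 1 => 0) K * X) = pt (X * leg (fun _ : Fin 1 => 0) K) := by
  ext s t
  simp only [pt_apply, leg_mul_apply _ inj0, mul_leg_apply _ inj0, extend_zero]
  have hc : ∀ (i : ι) (s : Fin n → ι),
      ((Fin.cons i s : Fin (n + 1) → ι) ∘ fun _ : Fin 1 => (0 : Fin (n + 1))) = fun _ => i := by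
    intros; ext; simp
  simp only [hc]
  have hs : ∀ G : (Fin 1 → ι) → S, ∑ a, G a = ∑ i, G (fun _ => i) := by
    intro G
    exact (Fintype.sum_equiv (Equiv.funUnique (Fin 1) ι).symm _ _ (fun i => rfl)).symm
  simp only [hs]
  rw [Finset.sum_comm]
  simp only [mul_comm]

theorem pt_leg_succ_mul (A : Matrix (Fin n → ι) (Fin n → ι) S)
    (X : Matrix (Fin (n + 1) → ι) (Fin (n + 1) → ι) S) :
    pt (leg Fin.succ A * X) = A * pt X := by
  ext s t
  simp only [pt_apply, leg_mul_apply _ (Fin.succ_injective n), extend_succ, cons_comp_succ,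
    Matrix.mul_apply, Finset.mul_sum]
  rw [Finset.sum_comm]

theorem pt_mul_leg_succ (A : Matrix (Fin n → ι) (Fin n → ι) S)
    (X : Matrix (Fin (n + 1) → ι) (Fin (n + 1) → ι) S) :
    pt (X * leg Fin.succ A) = pt X * A := by
  ext s t
  simp only [pt_apply, mul_leg_apply _ (Fin.succ_injective n), extend_succ, cons_comp_succ,
    Matrix.mul_apply, Finset.sum_mul]
  rw [Finset.sum_comm]

theorem pt_leg_cons (f : Fin m → Fin n) (g : Fin (m + 1) → Fin (n + 1))
    (hg : g = Fin.cons 0 (Fin.succ ∘ f))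
    (X : Matrix (Fin (m + 1) → ι) (Fin (m + 1) → ι) S) : pt (leg g X) = leg f (pt X) := by
  subst hg
  ext s t
  have hc : ∀ (i : ι) (s : Fin n → ι), (Fin.cons i s : Fin (n + 1) → ι) ∘
      (Fin.cons 0 (Fin.succ ∘ f) : Fin (m + 1) → Fin (n + 1)) = Fin.cons i (s ∘ f) := by
    intro i s; ext q
    refine Fin.cases ?_ (fun j => ?_) q <;> simp
  have hr : ∀ i, (∀ q, q ∉ Set.range (Fin.cons 0 (Fin.succ ∘ f) : Fin (m + 1) → Fin (n + 1)) →
      (Fin.cons i s : Fin (n + 1) → ι) q = (Fin.cons i t : Fin (n + 1) → ι) q) ↔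
      (∀ q, q ∉ Set.range f → s q = t q) := by
    intro i
    constructor
    · intro H q hq
      refine H q.succ ?_
      rintro ⟨p, hp⟩
      revert hp
      refine Fin.cases ?_ (fun j => ?_) p
      · intro h; exact Fin.succ_ne_zero q h.symm
      · intro h
        exact hq ⟨j, Fin.succ_injective n h⟩
    · intro H q
      refine Fin.cases ?_ (fun j => ?_) q
      · intro _; rfl
      · intro hj
        refine H j ?_
        rintro ⟨p, rfl⟩
        exact hj ⟨p.succ, rfl⟩
  simp only [pt_apply, leg_apply, hc]
  by_cases H : ∀ q, q ∉ Set.range f → s q = t q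
  · rw [if_pos H]
    exact Finset.sum_congr rfl fun i _ => if_pos ((hr i).2 H)
  · rw [if_neg H]
    exact Finset.sum_eq_zero fun i _ => if_neg fun h => H ((hr i).1 h)

theorem pt_leg_zero [DecidableEq ι] (K : Matrix (Fin 1 → ι) (Fin 1 → ι) S) :
    pt (leg (fun _ : Fin 1 => (0 : Fin (n + 1))) K) = K.trace • 1 := by
  ext s t
  simp only [pt_apply, leg_apply, Matrix.smul_apply, Matrix.one_apply, Matrix.trace,
    Matrix.diag_apply]
  have hr : ∀ i, (∀ q, q ∉ Set.range (fun _ : Fin 1 => (0 : Fin (n + 1))) →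
      (Fin.cons i s : Fin (n + 1) → ι) q = (Fin.cons i t : Fin (n + 1) → ι) q) ↔ s = t := by
    intro i
    constructor
    · intro H; ext q
      exact H q.succ (by rintro ⟨_, h⟩; exact Fin.succ_ne_zero q h.symm)
    · rintro rfl; simp
  have hc : ∀ (i : ι) (s : Fin n → ι),
      ((Fin.cons i s : Fin (n + 1) → ι) ∘ fun _ : Fin 1 => (0 : Fin (n + 1))) = fun _ => i := by
    intros; ext; simp
  have hs : ∀ G : (Fin 1 → ι) → S, ∑ a, G a = ∑ i, G (fun _ => i) := by
    intro G
    exact (Fintype.sum_equiv (Equiv.funUnique (Fin 1) ι).symm _ _ (fun i => rfl)).symm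
  simp only [hr, hc, hs]
  split_ifs <;> simp

theorem pt_zero_mul_succ [DecidableEq ι] (K : Matrix (Fin 1 → ι) (Fin 1 → ι) S)
    (A : Matrix (Fin n → ι) (Fin n → ι) S) :
    pt (leg (fun _ : Fin 1 => 0) K * leg Fin.succ A) = K.trace • A := by
  rw [pt_mul_leg_succ, pt_leg_zero, Matrix.smul_mul, Matrix.one_mul]

end Leg

namespace Leg

open Matrix

variable {ι S : Type*} [CommRing S] [Fintype ι]

theorem leg_leg_eq {m n l : ℕ} {f : Fin m → Fin n} {g : Fin n → Fin l} (h : Fin m → Fin l)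
    (hg : Function.Injective g) (hh : g ∘ f = h) (X : Matrix (Fin m → ι) (Fin m → ι) S) :
    leg g (leg f X) = leg h X := by
  rw [leg_leg g hg, hh]

/-- The failure of the pentagon equation. -/
noncomputable def defect (W : Matrix (Fin 2 → ι) (Fin 2 → ι) S) :
    Matrix (Fin 3 → ι) (Fin 3 → ι) S :=
  leg ![0, 1] W * leg ![0, 2] W * leg ![1, 2] W - leg ![1, 2] W * leg ![0, 1] W

/-- The derivative of `defect` at `W` in the direction `Z`. -/
noncomputable def dDefect (W Z : Matrix (Fin 2 → ι) (Fin 2 → ι) S) :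
    Matrix (Fin 3 → ι) (Fin 3 → ι) S :=
  leg ![0, 1] Z * leg ![0, 2] W * leg ![1, 2] W + leg ![0, 1] W * leg ![0, 2] Z * leg ![1, 2] W
    + leg ![0, 1] W * leg ![0, 2] W * leg ![1, 2] Z - leg ![1, 2] Z * leg ![0, 1] W
    - leg ![1, 2] W * leg ![0, 1] Z

/-- The linear constraint satisfied by the defect of the pentagon equation. -/
def IsCocycle (W : Matrix (Fin 2 → ι) (Fin 2 → ι) S) (D : Matrix (Fin 3 → ι) (Fin 3 → ι) S) :
    Prop :=
  (leg ![2, 3] W * leg ![0, 1, 2] D + leg ![0, 1] W * leg ![0, 2, 3] D * leg ![1, 2] W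
      + leg ![0, 1] W * leg ![0, 2] W * leg ![0, 3] W * leg ![1, 2, 3] D :
      Matrix (Fin 4 → ι) (Fin 4 → ι) S)
    = leg ![1, 2, 3] D * leg ![0, 1] W + leg ![1, 2] W * leg ![0, 1, 3] D * leg ![2, 3] W
      + leg ![0, 1, 2] D * leg ![0, 3] W * leg ![1, 3] W * leg ![2, 3] W

theorem leg_defect (W : Matrix (Fin 2 → ι) (Fin 2 → ι) S) {i j k : Fin 4}
    (h : Function.Injective ![i, j, k]) :
    leg ![i, j, k] (defect W)
      = leg ![i, j] W * leg ![i, k] W * leg ![j, k] W - leg ![j, k] W * leg ![i, j] W := by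
  have e1 : ![i, j, k] ∘ ![0, 1] = ![i, j] := by ext q; fin_cases q <;> rfl
  have e2 : ![i, j, k] ∘ ![0, 2] = ![i, k] := by ext q; fin_cases q <;> rfl
  have e3 : ![i, j, k] ∘ ![1, 2] = ![j, k] := by ext q; fin_cases q <;> rfl
  simp only [defect, leg_sub, leg_mul _ h, leg_leg _ h, e1, e2, e3]

theorem isCocycle_defect (W : Matrix (Fin 2 → ι) (Fin 2 → ι) S) : IsCocycle W (defect W) := by
  unfold IsCocycle
  rw [leg_defect W (by decide), leg_defect W (by decide), leg_defect W (by decide),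
    leg_defect W (by decide)]
  have c1 : (leg ![2, 3] W * leg ![0, 1] W : Matrix (Fin 4 → ι) (Fin 4 → ι) S)
      = leg ![0, 1] W * leg ![2, 3] W := leg_comm _ _ (by decide) (by decide) _ _
  have c2 : (leg ![0, 3] W * leg ![1, 2] W : Matrix (Fin 4 → ι) (Fin 4 → ι) S)
      = leg ![1, 2] W * leg ![0, 3] W := leg_comm _ _ (by decide) (by decide) _ _
  generalize (leg ![0, 1] W : Matrix (Fin 4 → ι) (Fin 4 → ι) S) = w01 at *
  generalize (leg ![0, 2] W : Matrix (Fin 4 → ι) (Fin 4 → ι) S) = w02 at *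
  generalize (leg ![0, 3] W : Matrix (Fin 4 → ι) (Fin 4 → ι) S) = w03 at *
  generalize (leg ![1, 2] W : Matrix (Fin 4 → ι) (Fin 4 → ι) S) = w12 at *
  generalize (leg ![1, 3] W : Matrix (Fin 4 → ι) (Fin 4 → ι) S) = w13 at *
  generalize (leg ![2, 3] W : Matrix (Fin 4 → ι) (Fin 4 → ι) S) = w23 at *
  have a1 : w23 * (w01 * w02 * w12) = w01 * w23 * w02 * w12 := by
    rw [← c1]; noncomm_ring
  have a2 : w12 * w13 * w23 * w01 = w12 * w13 * w01 * w23 := by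
    rw [mul_assoc _ w23, c1]; noncomm_ring
  have a3 : w01 * w02 * w03 * (w12 * w13 * w23) = w01 * w02 * w12 * w03 * w13 * w23 := by
    rw [mul_assoc (w01 * w02) w12, ← c2]; noncomm_ring
  have l : w23 * (w01 * w02 * w12 - w12 * w01) + w01 * (w02 * w03 * w23 - w23 * w02) * w12
      + w01 * w02 * w03 * (w12 * w13 * w23 - w23 * w12)
      = w23 * (w01 * w02 * w12) - w01 * w23 * w02 * w12 - w23 * w12 * w01
        + w01 * w02 * w03 * (w12 * w13 * w23) := by noncomm_ring
  have r : (w12 * w13 * w23 - w23 * w12) * w01 + w12 * (w01 * w03 * w13 - w13 * w01) * w23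
      + (w01 * w02 * w12 - w12 * w01) * w03 * w13 * w23
      = w12 * w13 * w23 * w01 - w12 * w13 * w01 * w23 - w23 * w12 * w01
        + w01 * w02 * w12 * w03 * w13 * w23 := by noncomm_ring
  rw [l, r, a1, a2, a3]
  noncomm_ring

end Leg

namespace Leg

open Matrix

theorem cocycle_reduction {E : Type*} [Ring E] {w01 w02 w03 w12 w13 w23 v01 v03 v12 v13 v23
    X012 X013 X023 X123 : E}
    (i01 : w01 * v01 = 1) (i03 : w03 * v03 = 1)
    (i12 : w12 * v12 = 1) (i13 : w13 * v13 = 1) (i23 : w23 * v23 = 1)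
    (j01 : v01 * w01 = 1) (j12 : v12 * w12 = 1) (j23 : v23 * w23 = 1)
    (c1 : w23 * w01 = w01 * w23)
    (p012 : w01 * w02 * w12 = w12 * w01) (p013 : w01 * w03 * w13 = w13 * w01)
    (p023 : w02 * w03 * w23 = w23 * w02) (p123 : w12 * w13 * w23 = w23 * w12)
    (h : w23 * (w12 * w01 * X012) + w01 * (w23 * w02 * X023) * w12
      + w01 * w02 * w03 * (w23 * w12 * X123)
      = w23 * w12 * X123 * w01 + w12 * (w13 * w01 * X013) * w23
        + w12 * w01 * X012 * w03 * w13 * w23) :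
    X012 + v12 * X023 * w12 + X123
      = v01 * X123 * w01 + v23 * X013 * w23 + v23 * v13 * v03 * X012 * w03 * w13 * w23 := by
  set U := w23 * w12 * w01 with hU
  have h2 : U = w01 * w23 * w02 * w12 := by
    rw [hU, mul_assoc, ← p012, ← c1]; noncomm_ring
  have h3 : U = w01 * w02 * w03 * (w23 * w12) := by
    rw [h2, mul_assoc w01, ← p023]; noncomm_ring
  have h5 : U = w12 * w13 * w01 * w23 := by
    rw [hU, ← p123, mul_assoc (w12 * w13), c1]; noncomm_ring
  have h6 : U = w12 * w01 * w03 * w13 * w23 := by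
    rw [h5, mul_assoc w12 w13, ← p013]; noncomm_ring
  have t2 : U * (v12 * X023 * w12) = w01 * (w23 * w02 * X023) * w12 := by
    rw [h2]
    calc _ = w01 * w23 * w02 * (w12 * v12) * X023 * w12 := by noncomm_ring
      _ = _ := by rw [i12]; noncomm_ring
  have t3 : U * X123 = w01 * w02 * w03 * (w23 * w12 * X123) := by rw [h3]; noncomm_ring
  have t4 : U * (v01 * X123 * w01) = w23 * w12 * X123 * w01 := by
    calc _ = w23 * w12 * (w01 * v01) * X123 * w01 := by rw [hU]; noncomm_ring
      _ = _ := by rw [i01]; noncomm_ring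
  have t5 : U * (v23 * X013 * w23) = w12 * (w13 * w01 * X013) * w23 := by
    rw [h5]
    calc _ = w12 * w13 * w01 * (w23 * v23) * X013 * w23 := by noncomm_ring
      _ = _ := by rw [i23]; noncomm_ring
  have t6 : U * (v23 * v13 * v03 * X012 * w03 * w13 * w23)
      = w12 * w01 * X012 * w03 * w13 * w23 := by
    rw [h6]
    calc _ = w12 * w01 * w03 * w13 * (w23 * v23) * v13 * v03 * X012 * w03 * w13 * w23 := by
          noncomm_ring
      _ = w12 * w01 * w03 * (w13 * v13) * v03 * X012 * w03 * w13 * w23 := by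
          rw [i23]; noncomm_ring
      _ = w12 * w01 * (w03 * v03) * X012 * w03 * w13 * w23 := by rw [i13]; noncomm_ring
      _ = _ := by rw [i03]; noncomm_ring
  have hUU : v01 * v12 * v23 * U = 1 := by
    calc _ = v01 * (v12 * (v23 * w23) * w12) * w01 := by rw [hU]; noncomm_ring
      _ = 1 := by rw [j23, mul_one, j12, mul_one, j01]
  have key : U * (X012 + v12 * X023 * w12 + X123)
      = U * (v01 * X123 * w01 + v23 * X013 * w23
        + v23 * v13 * v03 * X012 * w03 * w13 * w23) := by
    simp only [mul_add]
    rw [t2, t3, t4, t5, t6, ← h, hU]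
    noncomm_ring
  rw [← one_mul (X012 + v12 * X023 * w12 + X123), ← hUU, mul_assoc _ U, key, ← mul_assoc _ U, hUU,
    one_mul]

variable {ι S : Type*} [CommRing S] [Fintype ι] [DecidableEq ι]

/-- `D = w12 w01 X` transforms the cocycle condition into a conjugation identity for `X`. -/
theorem IsCocycle.reduced {W V : Matrix (Fin 2 → ι) (Fin 2 → ι) S} (hWV : W * V = 1)
    (hVW : V * W = 1) (hp : defect W = 0) {X : Matrix (Fin 3 → ι) (Fin 3 → ι) S}
    (h : IsCocycle W (leg ![1, 2] W * leg ![0, 1] W * X)) :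
    (leg ![0, 1, 2] X + leg ![1, 2] V * leg ![0, 2, 3] X * leg ![1, 2] W + leg ![1, 2, 3] X :
      Matrix (Fin 4 → ι) (Fin 4 → ι) S)
    = leg ![0, 1] V * leg ![1, 2, 3] X * leg ![0, 1] W
      + leg ![2, 3] V * leg ![0, 1, 3] X * leg ![2, 3] W
      + leg ![2, 3] V * leg ![1, 3] V * leg ![0, 3] V * leg ![0, 1, 2] X * leg ![0, 3] W
        * leg ![1, 3] W * leg ![2, 3] W := by
  have hpe : ∀ {i j k : Fin 4}, Function.Injective ![i, j, k] →
      leg ![i, j] W * leg ![i, k] W * leg ![j, k] W = leg ![j, k] W * leg ![i, j] W := by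
    intro i j k hi
    have := leg_defect W hi
    rw [hp, leg_zero] at this
    exact (sub_eq_zero.1 this.symm)
  have hw : ∀ {i j : Fin 4}, Function.Injective ![i, j] → leg ![i, j] W * leg ![i, j] V = 1 := by
    intro i j hi; rw [← leg_mul _ hi, hWV, leg_one]
  have hv : ∀ {i j : Fin 4}, Function.Injective ![i, j] → leg ![i, j] V * leg ![i, j] W = 1 := by
    intro i j hi; rw [← leg_mul _ hi, hVW, leg_one]
  have hX : ∀ {i j k : Fin 4}, Function.Injective ![i, j, k] →
      leg ![i, j, k] (leg ![1, 2] W * leg ![0, 1] W * X)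
        = leg ![j, k] W * leg ![i, j] W * leg ![i, j, k] X := by
    intro i j k hi
    have e1 : ![i, j, k] ∘ ![0, 1] = ![i, j] := by ext q; fin_cases q <;> rfl
    have e3 : ![i, j, k] ∘ ![1, 2] = ![j, k] := by ext q; fin_cases q <;> rfl
    simp only [leg_mul _ hi, leg_leg _ hi, e1, e3]
  unfold IsCocycle at h
  rw [hX (by decide), hX (by decide), hX (by decide), hX (by decide)] at h
  exact cocycle_reduction (hw (by decide)) (hw (by decide)) (hw (by decide)) (hw (by decide))
    (hw (by decide)) (hv (by decide)) (hv (by decide)) (hv (by decide))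
    (leg_comm _ _ (by decide) (by decide) _ _) (hpe (by decide)) (hpe (by decide))
    (hpe (by decide)) (hpe (by decide)) h

/-- The derivative of the defect in the direction `W * Y`. -/
theorem dDefect_mul {W V : Matrix (Fin 2 → ι) (Fin 2 → ι) S} (hWV : W * V = 1)
    (hp : defect W = 0) (Y : Matrix (Fin 2 → ι) (Fin 2 → ι) S) :
    dDefect W (W * Y) = leg ![1, 2] W * leg ![0, 1] W *
      (leg ![1, 2] Y - leg ![0, 1] V * leg ![1, 2] Y * leg ![0, 1] W
        + leg ![1, 2] V * leg ![0, 2] Y * leg ![1, 2] W - leg ![0, 1] Y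
        + leg ![1, 2] V * leg ![0, 2] V * leg ![0, 1] Y * leg ![0, 2] W * leg ![1, 2] W) := by
  have hw : ∀ {i j : Fin 3}, Function.Injective ![i, j] → leg ![i, j] W * leg ![i, j] V = 1 := by
    intro i j hi; rw [← leg_mul _ hi, hWV, leg_one]
  have p : (leg ![0, 1] W * leg ![0, 2] W * leg ![1, 2] W : Matrix (Fin 3 → ι) (Fin 3 → ι) S)
      = leg ![1, 2] W * leg ![0, 1] W :=
    sub_eq_zero.1 hp
  have i01 := hw (i := 0) (j := 1) (by decide)
  have i02 := hw (i := 0) (j := 2) (by decide)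
  have i12 := hw (i := 1) (j := 2) (by decide)
  simp only [dDefect, leg_mul _ (show Function.Injective ![(0 : Fin 3), 1] by decide),
    leg_mul _ (show Function.Injective ![(0 : Fin 3), 2] by decide),
    leg_mul _ (show Function.Injective ![(1 : Fin 3), 2] by decide)]
  generalize (leg ![0, 1] W : Matrix (Fin 3 → ι) (Fin 3 → ι) S) = w01 at *
  generalize (leg ![0, 2] W : Matrix (Fin 3 → ι) (Fin 3 → ι) S) = w02 at *
  generalize (leg ![1, 2] W : Matrix (Fin 3 → ι) (Fin 3 → ι) S) = w12 at *
  generalize (leg ![0, 1] V : Matrix (Fin 3 → ι) (Fin 3 → ι) S) = v01 at *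
  generalize (leg ![0, 2] V : Matrix (Fin 3 → ι) (Fin 3 → ι) S) = v02 at *
  generalize (leg ![1, 2] V : Matrix (Fin 3 → ι) (Fin 3 → ι) S) = v12 at *
  generalize (leg ![0, 1] Y : Matrix (Fin 3 → ι) (Fin 3 → ι) S) = y01 at *
  generalize (leg ![0, 2] Y : Matrix (Fin 3 → ι) (Fin 3 → ι) S) = y02 at *
  generalize (leg ![1, 2] Y : Matrix (Fin 3 → ι) (Fin 3 → ι) S) = y12 at *
  have a1 : w12 * w01 * (v01 * y12 * w01) = w12 * y12 * w01 := by
    calc _ = w12 * (w01 * v01) * y12 * w01 := by noncomm_ring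
      _ = _ := by rw [i01]; noncomm_ring
  have a2 : w12 * w01 * (v12 * y02 * w12) = w01 * (w02 * y02) * w12 := by
    rw [← p]
    calc _ = w01 * w02 * (w12 * v12) * y02 * w12 := by noncomm_ring
      _ = _ := by rw [i12]; noncomm_ring
  have a3 : w12 * w01 * (v12 * v02 * y01 * w02 * w12) = w01 * y01 * w02 * w12 := by
    rw [← p]
    calc _ = w01 * w02 * (w12 * v12) * v02 * y01 * w02 * w12 := by noncomm_ring
      _ = w01 * (w02 * v02) * y01 * w02 * w12 := by rw [i12]; noncomm_ring
      _ = _ := by rw [i02]; noncomm_ring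
  have a4 : w12 * w01 * y12 = w01 * w02 * (w12 * y12) := by rw [← p]; noncomm_ring
  simp only [mul_add, mul_sub]
  rw [a1, a2, a3, a4]
  noncomm_ring

end Leg

namespace Leg

open Matrix
open scoped TensorProduct

set_option linter.unusedSectionVars false

variable {ι K : Type*} [Field K] [Fintype ι] [DecidableEq ι]

/-- A one-leg operator placed at position `i`. -/
noncomputable abbrev at1 {S : Type*} [CommRing S] {n : ℕ} (i : Fin n)
    (X : Matrix (Fin 1 → ι) (Fin 1 → ι) S) :
    Matrix (Fin n → ι) (Fin n → ι) S := leg (fun _ : Fin 1 => i) X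

theorem at1_inj {n : ℕ} (i : Fin n) : Function.Injective (fun _ : Fin 1 => i) :=
  fun _ _ _ => Subsingleton.elim _ _

theorem at1_mul {n : ℕ} (i : Fin n) (X Y : Matrix (Fin 1 → ι) (Fin 1 → ι) K) :
    at1 i (X * Y) = at1 i X * at1 i Y := leg_mul _ (at1_inj i) _ _

theorem leg_succ_at1 {n : ℕ} (i : Fin n) (j : Fin (n + 1)) (h : i.succ = j)
    (X : Matrix (Fin 1 → ι) (Fin 1 → ι) K) : at1 j X = leg Fin.succ (at1 i X) := by
  subst h
  exact (leg_leg_eq (f := fun _ : Fin 1 => i) _ (Fin.succ_injective n) rfl X).symm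

theorem at1_succ_comm {n : ℕ} (k : Matrix (Fin 1 → ι) (Fin 1 → ι) K)
    (A : Matrix (Fin n → ι) (Fin n → ι) K) :
    at1 0 k * leg Fin.succ A = leg Fin.succ A * at1 0 k :=
  leg_comm _ _ (at1_inj _) (fun _ _ => (Fin.succ_ne_zero _).symm) _ _

theorem pt_at1_conj {n : ℕ} (k : Matrix (Fin 1 → ι) (Fin 1 → ι) K)
    (A B : Matrix (Fin n → ι) (Fin n → ι) K) (Z : Matrix (Fin (n + 1) → ι) (Fin (n + 1) → ι) K) :
    pt (at1 0 k * (leg Fin.succ A * Z * leg Fin.succ B)) = A * pt (at1 0 k * Z) * B := by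
  rw [← mul_assoc, ← mul_assoc, at1_succ_comm, pt_mul_leg_succ, mul_assoc, pt_leg_succ_mul]

/-- An invertible solution of the pentagon equation with a rank one idempotent `k` such that
`W` fixes the range of `k ⊗ 1` from both sides. -/
structure FixData {S : Type*} [CommRing S] (W V : Matrix (Fin 2 → ι) (Fin 2 → ι) S) where
  hWV : W * V = 1
  hVW : V * W = 1
  pent : defect W = 0
  k : Matrix (Fin 1 → ι) (Fin 1 → ι) S
  hk2 : k * k = k
  trk : k.trace = 1
  hWk : W * at1 0 k = at1 0 k
  hkW : at1 0 k * W = at1 0 k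

/-- The structural data (coming from a semisimple cosemisimple Hopf algebra) which make the
deformation complex of an invertible solution `W` of the pentagon equation exact. -/
structure ExactData (W V : Matrix (Fin 2 → ι) (Fin 2 → ι) K) extends FixData W V where
  κ : Type
  [fin : Fintype κ]
  B : κ → Matrix (Fin 1 → ι) (Fin 1 → ι) K
  L : κ → Matrix (Fin 1 → ι) (Fin 1 → ι) K
  L' : κ → Matrix (Fin 1 → ι) (Fin 1 → ι) K
  σ : Matrix (Fin 1 → ι) (Fin 1 → ι) K
  hW : W = ∑ i, at1 0 (B i) * at1 1 (L i)
  hV : V = ∑ i, at1 0 (B i) * at1 1 (L' i)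
  trσ : σ.trace ≠ 0
  twist : (∑ i, ∑ j, at1 0 (B i * σ * B j) * at1 1 (L' j * L i) :
    Matrix (Fin 2 → ι) (Fin 2 → ι) K) = at1 0 σ
  casimir : ∀ a, (∑ i, ∑ j, (B i * σ * B j).trace • ((L a * L' j) ⊗ₜ[K] L i))
    = ∑ i, ∑ j, (B i * σ * B j).trace • (L' j ⊗ₜ[K] (L i * L a))

attribute [instance] ExactData.fin

variable {W V : Matrix (Fin 2 → ι) (Fin 2 → ι) K} (H : ExactData W V)

namespace ExactData

theorem leg_W {n : ℕ} {i j : Fin n} (h : Function.Injective ![i, j]) :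
    leg ![i, j] W = ∑ a, at1 i (H.B a) * at1 j (H.L a) := by
  conv_lhs => rw [H.hW]
  simp only [leg_sum, leg_mul _ h, at1, leg_leg _ h]
  rfl

theorem leg_V {n : ℕ} {i j : Fin n} (h : Function.Injective ![i, j]) :
    leg ![i, j] V = ∑ a, at1 i (H.B a) * at1 j (H.L' a) := by
  conv_lhs => rw [H.hV]
  simp only [leg_sum, leg_mul _ h, at1, leg_leg _ h]
  rfl

theorem pt_twist (X : Matrix (Fin 3 → ι) (Fin 3 → ι) K) :
    pt (at1 0 H.σ * (leg ![0, 3] V * leg ![0, 1, 2] X * leg ![0, 3] W) :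
      Matrix (Fin 4 → ι) (Fin 4 → ι) K) = pt (at1 0 H.σ * leg ![0, 1, 2] X) := by
  have h03 : Function.Injective ![(0 : Fin 4), 3] := by decide
  have term : ∀ i j, pt (at1 0 H.σ * ((at1 0 (H.B j) * at1 3 (H.L' j)) * leg ![0, 1, 2] X *
      (at1 0 (H.B i) * at1 3 (H.L i))) : Matrix (Fin 4 → ι) (Fin 4 → ι) K)
      = pt (at1 0 (H.B i * H.σ * H.B j) * at1 3 (H.L' j * H.L i) * leg ![0, 1, 2] X) := by
    intro i j
    have c1 : (at1 0 (H.B i) * at1 3 (H.L i) : Matrix (Fin 4 → ι) (Fin 4 → ι) K)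
        = at1 3 (H.L i) * at1 0 (H.B i) := leg_comm _ _ (at1_inj _) (by decide) _ _
    have c2 : (at1 3 (H.L i) * leg ![0, 1, 2] X : Matrix (Fin 4 → ι) (Fin 4 → ι) K)
        = leg ![0, 1, 2] X * at1 3 (H.L i) := leg_comm _ _ (at1_inj _) (by decide) _ _
    rw [at1_mul, at1_mul, at1_mul, c1]
    calc _ = pt (at1 0 H.σ * at1 0 (H.B j) * at1 3 (H.L' j) * (leg ![0, 1, 2] X * at1 3 (H.L i))
            * at1 0 (H.B i)) := by congr 1; noncomm_ring
      _ = pt (at1 0 (H.B i) * (at1 0 H.σ * at1 0 (H.B j) * at1 3 (H.L' j) *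
            (leg ![0, 1, 2] X * at1 3 (H.L i)))) := (pt_cyclic _ _).symm
      _ = _ := by rw [← c2]; congr 1; noncomm_ring
  have tw := congrArg (leg ![(0 : Fin 4), 3]) H.twist
  simp only [leg_sum, leg_mul _ h03, at1, leg_leg _ h03] at tw
  have tw' : (∑ i, ∑ j, at1 0 (H.B i * H.σ * H.B j) * at1 3 (H.L' j * H.L i) :
    Matrix (Fin 4 → ι) (Fin 4 → ι) K) = at1 0 H.σ := tw
  have rhs : pt (at1 0 H.σ * leg ![0, 1, 2] X : Matrix (Fin 4 → ι) (Fin 4 → ι) K)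
      = ∑ i, ∑ j, pt (at1 0 (H.B i * H.σ * H.B j) * at1 3 (H.L' j * H.L i) *
        leg ![0, 1, 2] X) := by
    rw [← tw']; simp only [Finset.sum_mul, pt_sum]
  rw [rhs, H.leg_W h03, H.leg_V h03]
  simp only [Finset.sum_mul, Finset.mul_sum, pt_sum]
  simp only [term]

/-- The conditional expectation used in the first exactness step. -/
noncomputable def expect (X : Matrix (Fin 3 → ι) (Fin 3 → ι) K) :
    Matrix (Fin 3 → ι) (Fin 3 → ι) K :=
  pt (at1 0 H.σ * (leg ![0, 1] V * leg ![1, 2, 3] X * leg ![0, 1] W))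

theorem expect_eq (X : Matrix (Fin 3 → ι) (Fin 3 → ι) K) :
    H.expect X = ∑ i, ∑ j, (H.B i * H.σ * H.B j).trace •
      (at1 0 (H.L' j) * X * at1 0 (H.L i)) := by
  have h01 : Function.Injective ![(0 : Fin 4), 1] := by decide
  have term : ∀ i j, pt (at1 0 H.σ * ((at1 0 (H.B j) * at1 1 (H.L' j)) * leg ![1, 2, 3] X *
      (at1 0 (H.B i) * at1 1 (H.L i))) : Matrix (Fin 4 → ι) (Fin 4 → ι) K)
      = (H.B i * H.σ * H.B j).trace • (at1 0 (H.L' j) * X * at1 0 (H.L i)) := by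
    intro i j
    have s : ∀ Y : Matrix (Fin 1 → ι) (Fin 1 → ι) K,
        (at1 1 Y : Matrix (Fin 4 → ι) (Fin 4 → ι) K) = leg Fin.succ (at1 0 Y) := fun Y =>
      leg_succ_at1 0 1 rfl Y
    have sX : (leg ![1, 2, 3] X : Matrix (Fin 4 → ι) (Fin 4 → ι) K) = leg Fin.succ X := by
      congr 1; decide
    rw [← pt_zero_mul_succ, leg_mul _ (Fin.succ_injective _), leg_mul _ (Fin.succ_injective _),
      leg_mul _ (at1_inj _), leg_mul _ (at1_inj _), s, s, sX, at1_succ_comm (H.B i)]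
    calc _ = pt (at1 0 H.σ * at1 0 (H.B j) * leg Fin.succ (at1 0 (H.L' j)) *
            leg Fin.succ X * leg Fin.succ (at1 0 (H.L i)) * at1 0 (H.B i)) := by
          congr 1; noncomm_ring
      _ = _ := by rw [← pt_cyclic]; congr 1; noncomm_ring
  rw [expect, H.leg_W h01, H.leg_V h01]
  simp only [Finset.sum_mul, Finset.mul_sum, pt_sum]
  simp only [term]

theorem expect_comm (X : Matrix (Fin 3 → ι) (Fin 3 → ι) K) (a : H.κ) :
    at1 0 (H.L a) * H.expect X = H.expect X * at1 0 (H.L a) := by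
  rw [expect_eq]
  let f : Matrix (Fin 1 → ι) (Fin 1 → ι) K →ₗ[K] Matrix (Fin 3 → ι) (Fin 3 → ι) K :=
    { toFun := at1 0, map_add' := leg_add _, map_smul' := leg_smul _ }
  let φ : Matrix (Fin 1 → ι) (Fin 1 → ι) K ⊗[K] Matrix (Fin 1 → ι) (Fin 1 → ι) K →ₗ[K]
      Matrix (Fin 3 → ι) (Fin 3 → ι) K :=
    TensorProduct.lift (((LinearMap.mul K (Matrix (Fin 3 → ι) (Fin 3 → ι) K)).comp
      ((LinearMap.mulRight K X).comp f)).compl₂ f)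
  have hφ : ∀ p q, φ (p ⊗ₜ q) = at1 0 p * X * at1 0 q := fun p q => rfl
  have := congrArg φ (H.casimir a)
  simp only [map_sum, map_smul, hφ, at1, leg_mul _ (at1_inj (0 : Fin 3))] at this
  simp only [Finset.mul_sum, Finset.sum_mul, Matrix.mul_smul, Matrix.smul_mul, at1, ← mul_assoc]
  simpa only [← mul_assoc] using this

theorem expect_comm_W (X : Matrix (Fin 3 → ι) (Fin 3 → ι) K) :
    (leg ![0, 1] W * leg ![1, 2, 3] (H.expect X) : Matrix (Fin 4 → ι) (Fin 4 → ι) K)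
      = leg ![1, 2, 3] (H.expect X) * leg ![0, 1] W := by
  have sX : (leg ![1, 2, 3] (H.expect X) : Matrix (Fin 4 → ι) (Fin 4 → ι) K)
    = leg Fin.succ (H.expect X) := by
    congr 1; decide
  have s : ∀ Y : Matrix (Fin 1 → ι) (Fin 1 → ι) K,
      (at1 1 Y : Matrix (Fin 4 → ι) (Fin 4 → ι) K) = leg Fin.succ (at1 0 Y) := fun Y =>
    leg_succ_at1 0 1 rfl Y
  rw [sX, H.leg_W (by decide), Finset.sum_mul, Finset.mul_sum]
  refine Finset.sum_congr rfl fun a _ => ?_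
  rw [s, mul_assoc, ← leg_mul _ (Fin.succ_injective _), expect_comm,
    leg_mul _ (Fin.succ_injective _), ← mul_assoc, at1_succ_comm, mul_assoc]

end ExactData

end Leg

namespace Leg

open Matrix

set_option linter.unusedSectionVars false

variable {ι K : Type*} [Field K] [Fintype ι] [DecidableEq ι]
  {W V : Matrix (Fin 2 → ι) (Fin 2 → ι) K}

namespace FixData

theorem leg_W_mul_V (H : FixData W V) {n : ℕ} {i j : Fin n} (h : Function.Injective ![i, j]) :
    leg ![i, j] W * leg ![i, j] V = 1 := by rw [← leg_mul _ h, H.hWV, leg_one]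

theorem leg_V_mul_W (H : FixData W V) {n : ℕ} {i j : Fin n} (h : Function.Injective ![i, j]) :
    leg ![i, j] V * leg ![i, j] W = 1 := by rw [← leg_mul _ h, H.hVW, leg_one]

end FixData

namespace ExactData

theorem succ_leg2 {i j : Fin 3} (i' j' : Fin 4) (hi : i.succ = i') (hj : j.succ = j')
    (X : Matrix (Fin 2 → ι) (Fin 2 → ι) K) :
    leg ![i', j'] X = leg Fin.succ (leg ![i, j] X) := by
  subst hi hj
  refine (leg_leg_eq _ (Fin.succ_injective _) ?_ X).symm
  ext q; fin_cases q <;> rfl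

theorem eq_factor (H : ExactData W V) (D : Matrix (Fin 3 → ι) (Fin 3 → ι) K) :
    D = leg ![1, 2] W * leg ![0, 1] W * (leg ![0, 1] V * leg ![1, 2] V * D) := by
  have h12 := H.leg_W_mul_V (n := 3) (i := 1) (j := 2) (by decide)
  have h01 := H.leg_W_mul_V (n := 3) (i := 0) (j := 1) (by decide)
  calc D = leg ![1, 2] W * 1 * leg ![1, 2] V * D := by rw [mul_one, h12, one_mul]
    _ = _ := by rw [← h01]; noncomm_ring

theorem pt_at1_leg {m n : ℕ} (g : Fin (m + 1) → Fin (n + 1)) (f : Fin m → Fin n)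
    (hg : g = Fin.cons 0 (Fin.succ ∘ f)) (hi : Function.Injective g)
    (k : Matrix (Fin 1 → ι) (Fin 1 → ι) K)
    (X : Matrix (Fin (m + 1) → ι) (Fin (m + 1) → ι) K) :
    pt (at1 0 k * leg g X) = leg f (pt (at1 0 k * X)) := by
  rw [← pt_leg_cons f g hg, leg_mul _ hi, at1, at1,
    leg_leg_eq (f := fun _ : Fin 1 => (0 : Fin (m + 1))) (fun _ : Fin 1 => 0) hi]
  ext; simp [hg]

theorem exists_dDefect_add (H : ExactData W V) (D : Matrix (Fin 3 → ι) (Fin 3 → ι) K)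
    (hD : IsCocycle W D) :
    ∃ Z X, D - dDefect W Z = leg ![1, 2] W * leg ![0, 1] W * X ∧
      (leg ![0, 1] W * leg ![1, 2, 3] X : Matrix (Fin 4 → ι) (Fin 4 → ι) K)
        = leg ![1, 2, 3] X * leg ![0, 1] W := by
  set X := leg ![0, 1] V * leg ![1, 2] V * D with hX
  rw [H.eq_factor D, ← hX] at hD
  have red := hD.reduced H.hWV H.hVW H.pent
  set Y : Matrix (Fin 2 → ι) (Fin 2 → ι) K := pt (at1 0 H.σ * X) with hY
  have pull : ∀ (g : Fin 3 → Fin 4) (f : Fin 2 → Fin 3) (_ : g = Fin.cons 0 (Fin.succ ∘ f))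
      (_ : Function.Injective g), pt (at1 0 H.σ * leg g X) = leg f Y := fun g f hg hi =>
    pt_at1_leg g f hg hi H.σ X
  have red' := congrArg (fun T => pt (at1 0 H.σ * T)) red
  simp only [mul_add, pt_add] at red'
  rw [pull ![0, 1, 2] ![0, 1] (by decide) (by decide)] at red'
  have e1 : pt (at1 0 H.σ * (leg ![1, 2] V * leg ![0, 2, 3] X * leg ![1, 2] W) :
      Matrix (Fin 4 → ι) (Fin 4 → ι) K) = leg ![0, 1] V * leg ![1, 2] Y * leg ![0, 1] W := by
    rw [succ_leg2 (i := 0) (j := 1) 1 2 rfl rfl, succ_leg2 (i := 0) (j := 1) 1 2 rfl rfl,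
      pt_at1_conj, pull _ ![1, 2] (by decide) (by decide)]
  have e2 : pt (at1 0 H.σ * leg ![1, 2, 3] X : Matrix (Fin 4 → ι) (Fin 4 → ι) K)
      = H.σ.trace • X := by
    rw [← pt_zero_mul_succ]; congr 3; decide
  have e3 : pt (at1 0 H.σ * (leg ![2, 3] V * leg ![0, 1, 3] X * leg ![2, 3] W) :
      Matrix (Fin 4 → ι) (Fin 4 → ι) K) = leg ![1, 2] V * leg ![0, 2] Y * leg ![1, 2] W := by
    rw [succ_leg2 (i := 1) (j := 2) 2 3 rfl rfl, succ_leg2 (i := 1) (j := 2) 2 3 rfl rfl,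
      pt_at1_conj, pull _ ![0, 2] (by decide) (by decide)]
  have e4 : pt (at1 0 H.σ * (leg ![2, 3] V * leg ![1, 3] V * leg ![0, 3] V * leg ![0, 1, 2] X *
        leg ![0, 3] W * leg ![1, 3] W * leg ![2, 3] W) : Matrix (Fin 4 → ι) (Fin 4 → ι) K)
      = leg ![1, 2] V * leg ![0, 2] V * leg ![0, 1] Y * leg ![0, 2] W * leg ![1, 2] W := by
    have : (leg ![2, 3] V * leg ![1, 3] V * leg ![0, 3] V * leg ![0, 1, 2] X *
        leg ![0, 3] W * leg ![1, 3] W * leg ![2, 3] W : Matrix (Fin 4 → ι) (Fin 4 → ι) K)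
        = leg Fin.succ (leg ![1, 2] V) * (leg Fin.succ (leg ![0, 2] V) *
          (leg ![0, 3] V * leg ![0, 1, 2] X * leg ![0, 3] W) * leg Fin.succ (leg ![0, 2] W)) *
          leg Fin.succ (leg ![1, 2] W) := by
      rw [succ_leg2 (i := 1) (j := 2) 2 3 rfl rfl, succ_leg2 (i := 1) (j := 2) 2 3 rfl rfl,
        succ_leg2 (i := 0) (j := 2) 1 3 rfl rfl, succ_leg2 (i := 0) (j := 2) 1 3 rfl rfl]
      noncomm_ring
    rw [this, pt_at1_conj, pt_at1_conj, H.pt_twist, pull _ ![0, 1] (by decide) (by decide)]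
    noncomm_ring
  rw [e1, e2, e3, e4] at red'
  change _ = H.expect X + _ + _ at red'
  set t := H.σ.trace with ht
  have ht0 : t ≠ 0 := H.trσ
  refine ⟨W * (t⁻¹ • Y), t⁻¹ • (H.expect X - leg ![1, 2] Y), ?_, ?_⟩
  · rw [dDefect_mul H.hWV H.pent, H.eq_factor D, ← hX, ← mul_sub]
    congr 1
    simp only [leg_smul, Matrix.mul_smul, Matrix.smul_mul, ← smul_sub, ← smul_add]
    have : t • X = H.expect X + leg ![1, 2] V * leg ![0, 2] Y * leg ![1, 2] W
        + leg ![1, 2] V * leg ![0, 2] V * leg ![0, 1] Y * leg ![0, 2] W * leg ![1, 2] W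
        - leg ![0, 1] Y - leg ![0, 1] V * leg ![1, 2] Y * leg ![0, 1] W := by
      rw [← red']; abel
    have hx : X = t⁻¹ • (t • X) := by rw [smul_smul, inv_mul_cancel₀ ht0, one_smul]
    conv_lhs => rw [hx, this]
    rw [← smul_sub]
    congr 1
    abel
  · have c : (leg ![0, 1] W * leg ![2, 3] Y : Matrix (Fin 4 → ι) (Fin 4 → ι) K)
        = leg ![2, 3] Y * leg ![0, 1] W := leg_comm _ _ (by decide) (by decide) _ _
    have r : (leg ![1, 2, 3] (leg ![1, 2] Y) : Matrix (Fin 4 → ι) (Fin 4 → ι) K)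
        = leg ![2, 3] Y := leg_leg_eq _ (by decide) (by decide) Y
    simp only [leg_smul, leg_sub, Matrix.mul_smul, Matrix.smul_mul, mul_sub, sub_mul, r, c,
      H.expect_comm_W]

end ExactData

end Leg

namespace Leg

open Matrix

set_option linter.unusedSectionVars false

variable {ι K : Type*} [Field K] [Fintype ι] [DecidableEq ι]
  {W V : Matrix (Fin 2 → ι) (Fin 2 → ι) K}

theorem leg_at1 {n : ℕ} {j : Fin (n + 1)} (h : Function.Injective ![0, j])
    (k : Matrix (Fin 1 → ι) (Fin 1 → ι) K) :
    leg ![0, j] (at1 0 k) = at1 0 k :=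
  leg_leg_eq (f := fun _ : Fin 1 => (0 : Fin 2)) (fun _ : Fin 1 => 0) h rfl k

namespace FixData

theorem absorb (H : FixData W V) {n : ℕ} {j : Fin (n + 1)} (h : Function.Injective ![0, j]) :
    leg ![0, j] W * at1 0 H.k = at1 0 H.k ∧ at1 0 H.k * leg ![0, j] W = at1 0 H.k ∧
    leg ![0, j] V * at1 0 H.k = at1 0 H.k ∧ at1 0 H.k * leg ![0, j] V = at1 0 H.k := by
  have a := congrArg (leg ![0, j]) H.hWk
  have b := congrArg (leg ![0, j]) H.hkW
  rw [leg_mul _ h, leg_at1 h] at a b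
  refine ⟨a, b, ?_, ?_⟩
  · conv_lhs => rw [← a, ← mul_assoc, H.leg_V_mul_W h, one_mul]
  · conv_lhs => rw [← b, mul_assoc, H.leg_W_mul_V h, mul_one]

theorem pt_absorb (H : FixData W V) {n : ℕ} {P Q : Matrix (Fin (n + 1) → ι) (Fin (n + 1) → ι) K}
    (hP : at1 0 H.k * P = at1 0 H.k) (hQ : Q * at1 0 H.k = at1 0 H.k)
    (Z : Matrix (Fin (n + 1) → ι) (Fin (n + 1) → ι) K) :
    pt (at1 0 H.k * (P * Z * Q)) = pt (at1 0 H.k * Z) := by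
  have kk : (at1 0 H.k * at1 0 H.k : Matrix (Fin (n + 1) → ι) (Fin (n + 1) → ι) K)
    = at1 0 H.k := by rw [← at1_mul, H.hk2]
  calc _ = pt (at1 0 H.k * (at1 0 H.k * Z * Q)) := by
        rw [← mul_assoc, ← mul_assoc, hP, ← mul_assoc, ← mul_assoc, kk]
    _ = pt (at1 0 H.k * (at1 0 H.k * Z)) := by
        rw [pt_cyclic, mul_assoc, hQ, ← pt_cyclic]
    _ = _ := by rw [← mul_assoc, kk]

theorem pt_at1_succ (H : FixData W V) {n : ℕ} (X : Matrix (Fin n → ι) (Fin n → ι) K) :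
    pt (at1 0 H.k * leg Fin.succ X) = X := by
  rw [pt_zero_mul_succ, H.trk, one_smul]

theorem exists_fixed_defect (H : FixData W V) (y : Matrix (Fin 2 → ι) (Fin 2 → ι) K)
    (hy : (leg ![0, 1] y * leg ![1, 2] W + leg ![0, 1] W * leg ![0, 2] y * leg ![1, 2] W :
      Matrix (Fin 3 → ι) (Fin 3 → ι) K) = leg ![1, 2] W * leg ![0, 1] y) :
    ∃ η, y = W * at1 0 η - at1 0 η := by
  obtain ⟨z, rfl⟩ : ∃ z, y = W * z := ⟨V * y, by rw [← mul_assoc, H.hWV, one_mul]⟩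
  have h1 : (leg ![0, 2] V * leg ![0, 1] z + leg ![0, 2] z : Matrix (Fin 3 → ι) (Fin 3 → ι) K)
      = leg ![1, 2] W * leg ![0, 1] z * leg ![1, 2] V := by
    have p : (leg ![0, 1] W * leg ![0, 2] W * leg ![1, 2] W : Matrix (Fin 3 → ι) (Fin 3 → ι) K)
        = leg ![1, 2] W * leg ![0, 1] W := sub_eq_zero.1 H.pent
    have i12 := H.leg_W_mul_V (n := 3) (i := 1) (j := 2) (by decide)
    have j12 := H.leg_V_mul_W (n := 3) (i := 1) (j := 2) (by decide)
    have j01 := H.leg_V_mul_W (n := 3) (i := 0) (j := 1) (by decide)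
    have j02 := H.leg_V_mul_W (n := 3) (i := 0) (j := 2) (by decide)
    rw [leg_mul _ (by decide), leg_mul _ (by decide), ← mul_assoc (leg ![1, 2] W), ← p] at hy
    generalize (leg ![0, 1] W : Matrix (Fin 3 → ι) (Fin 3 → ι) K) = w01 at *
    generalize (leg ![0, 2] W : Matrix (Fin 3 → ι) (Fin 3 → ι) K) = w02 at *
    generalize (leg ![1, 2] W : Matrix (Fin 3 → ι) (Fin 3 → ι) K) = w12 at *
    generalize (leg ![0, 1] V : Matrix (Fin 3 → ι) (Fin 3 → ι) K) = v01 at *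
    generalize (leg ![0, 2] V : Matrix (Fin 3 → ι) (Fin 3 → ι) K) = v02 at *
    generalize (leg ![1, 2] V : Matrix (Fin 3 → ι) (Fin 3 → ι) K) = v12 at *
    generalize (leg ![0, 1] z : Matrix (Fin 3 → ι) (Fin 3 → ι) K) = z01 at *
    generalize (leg ![0, 2] z : Matrix (Fin 3 → ι) (Fin 3 → ι) K) = z02 at *
    calc _ = v02 * (v01 * w01) * z01 * (w12 * v12) + (v02 * ((v01 * w01) * w02)) * z02 *
          (w12 * v12) := by rw [i12, j01]; simp [j02]
      _ = v02 * v01 * (w01 * z01 * w12 + w01 * (w02 * z02) * w12) * v12 := by noncomm_ring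
      _ = v02 * (v01 * w01) * w02 * w12 * z01 * v12 := by rw [hy]; noncomm_ring
      _ = _ := by rw [j01, mul_one, j02, one_mul]
  refine ⟨pt (at1 0 H.k * leg ![1, 0] z), ?_⟩
  set η := pt (at1 0 H.k * leg ![1, 0] z) with hη
  have pull : pt (at1 0 H.k * leg ![1, 0] z : Matrix (Fin 3 → ι) (Fin 3 → ι) K) = at1 0 η := by
    rw [← leg_leg_eq (f := ![1, 0]) (g := ![(0 : Fin 3), 1]) ![1, 0] (by decide) (by decide),
      ExactData.pt_at1_leg ![0, 1] (fun _ => 0) (by decide) (by decide)]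
  have hτ : Function.Injective ![(1 : Fin 3), 0, 2] := by decide
  have h2 := congrArg (fun T => pt (at1 0 H.k * leg ![(1 : Fin 3), 0, 2] T)) h1
  simp only [leg_mul _ hτ, leg_add, mul_add, pt_add] at h2
  have a02 := H.absorb (n := 2) (j := 2) (by decide)
  have s : ∀ A : Matrix (Fin 2 → ι) (Fin 2 → ι) K,
      (leg ![1, 2] A : Matrix (Fin 3 → ι) (Fin 3 → ι) K) = leg Fin.succ A := by
    intro A; congr 1; decide
  rw [leg_leg_eq ![1, 2] hτ (by decide), leg_leg_eq ![1, 0] hτ (by decide),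
    leg_leg_eq ![1, 2] hτ (by decide), leg_leg_eq ![0, 2] hτ (by decide),
    leg_leg_eq ![0, 2] hτ (by decide), H.pt_absorb a02.2.1 a02.2.2.1, pull, s, s,
    ← mul_assoc, at1_succ_comm, mul_assoc, pt_leg_succ_mul, pull, H.pt_at1_succ] at h2
  rw [← eq_sub_iff_add_eq'] at h2
  rw [h2, mul_sub, ← mul_assoc, H.hWV, one_mul]

end FixData

namespace ExactData

theorem exists_eq_dDefect (H : ExactData W V) (X : Matrix (Fin 3 → ι) (Fin 3 → ι) K)
    (hD : IsCocycle W (leg ![1, 2] W * leg ![0, 1] W * X))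
    (hX : (leg ![0, 1] W * leg ![1, 2, 3] X : Matrix (Fin 4 → ι) (Fin 4 → ι) K)
        = leg ![1, 2, 3] X * leg ![0, 1] W) :
    ∃ Z, leg ![1, 2] W * leg ![0, 1] W * X = dDefect W Z := by
  have red := hD.reduced H.hWV H.hVW H.pent
  rw [mul_assoc (leg ![0, 1] V), ← hX, ← mul_assoc, H.leg_V_mul_W (by decide), one_mul,
    add_comm, add_assoc, add_right_inj] at red
  set Y : Matrix (Fin 2 → ι) (Fin 2 → ι) K := pt (at1 0 H.k * leg ![1, 0, 2] X) with hY
  have pull : ∀ (g h : Fin 3 → Fin 4) (f : Fin 2 → Fin 3) (_ : h ∘ ![1, 0, 2] = g)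
      (_ : h = Fin.cons 0 (Fin.succ ∘ f))
      (_ : Function.Injective h), pt (at1 0 H.k * leg g X) = leg f Y := by
    intro g h f hgh hf hi
    rw [← leg_leg_eq g hi hgh, pt_at1_leg h f hf hi]
  have hτ : Function.Injective ![(1 : Fin 4), 0, 2, 3] := by decide
  have red' := congrArg (fun T => pt (at1 0 H.k * leg ![(1 : Fin 4), 0, 2, 3] T)) red
  have l2 : ∀ (i j : Fin 4) (i' j' : Fin 4) (_ : ![(1 : Fin 4), 0, 2, 3] ∘ ![i, j] = ![i', j'])
      (A : Matrix (Fin 2 → ι) (Fin 2 → ι) K),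
      leg ![(1 : Fin 4), 0, 2, 3] (leg ![i, j] A) = leg ![i', j'] A := fun i j i' j' h A =>
    leg_leg_eq _ hτ h A
  have l3 : ∀ (i j l i' j' l' : Fin 4)
      (_ : ![(1 : Fin 4), 0, 2, 3] ∘ ![i, j, l] = ![i', j', l'])
      (A : Matrix (Fin 3 → ι) (Fin 3 → ι) K),
      leg ![(1 : Fin 4), 0, 2, 3] (leg ![i, j, l] A) = leg ![i', j', l'] A :=
    fun i j l i' j' l' h A => leg_leg_eq _ hτ h A
  simp only [leg_add, leg_mul _ hτ, mul_add, pt_add] at red'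
  rw [l3 0 1 2 1 0 2 (by decide), l3 0 2 3 1 2 3 (by decide), l3 0 1 3 1 0 3 (by decide),
    l2 1 2 0 2 (by decide), l2 1 2 0 2 (by decide), l2 2 3 2 3 (by decide),
    l2 2 3 2 3 (by decide), l2 1 3 0 3 (by decide), l2 1 3 0 3 (by decide),
    l2 0 3 1 3 (by decide), l2 0 3 1 3 (by decide),
    pull ![1, 0, 2] ![0, 1, 2] ![0, 1] (by decide) (by decide) (by decide)] at red'
  have a02 := H.absorb (n := 3) (j := 2) (by decide)
  have a03 := H.absorb (n := 3) (j := 3) (by decide)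
  have sX : (leg ![1, 2, 3] X : Matrix (Fin 4 → ι) (Fin 4 → ι) K) = leg Fin.succ X := by
    congr 1; decide
  rw [H.pt_absorb a02.2.2.2 a02.1, sX, H.pt_at1_succ] at red'
  have e3 : pt (at1 0 H.k * (leg ![2, 3] V * leg ![1, 0, 3] X * leg ![2, 3] W) :
      Matrix (Fin 4 → ι) (Fin 4 → ι) K) = leg ![1, 2] V * leg ![0, 2] Y * leg ![1, 2] W := by
    rw [succ_leg2 (i := 1) (j := 2) 2 3 rfl rfl, succ_leg2 (i := 1) (j := 2) 2 3 rfl rfl,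
      pt_at1_conj, pull _ ![0, 1, 3] ![0, 2] (by decide) (by decide) (by decide)]
  have e4 : pt (at1 0 H.k * (leg ![2, 3] V * leg ![0, 3] V * leg ![1, 3] V * leg ![1, 0, 2] X *
        leg ![1, 3] W * leg ![0, 3] W * leg ![2, 3] W) : Matrix (Fin 4 → ι) (Fin 4 → ι) K)
      = leg ![1, 2] V * leg ![0, 2] V * leg ![0, 1] Y * leg ![0, 2] W * leg ![1, 2] W := by
    have : (leg ![2, 3] V * leg ![0, 3] V * leg ![1, 3] V * leg ![1, 0, 2] X *
        leg ![1, 3] W * leg ![0, 3] W * leg ![2, 3] W : Matrix (Fin 4 → ι) (Fin 4 → ι) K)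
        = leg Fin.succ (leg ![1, 2] V) * (leg ![0, 3] V * (leg Fin.succ (leg ![0, 2] V) *
          leg ![1, 0, 2] X * leg Fin.succ (leg ![0, 2] W)) * leg ![0, 3] W) *
          leg Fin.succ (leg ![1, 2] W) := by
      rw [succ_leg2 (i := 1) (j := 2) 2 3 rfl rfl, succ_leg2 (i := 1) (j := 2) 2 3 rfl rfl,
        succ_leg2 (i := 0) (j := 2) 1 3 rfl rfl, succ_leg2 (i := 0) (j := 2) 1 3 rfl rfl]
      noncomm_ring
    rw [this, pt_at1_conj, H.pt_absorb a03.2.2.2 a03.1, pt_at1_conj,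
      pull _ ![0, 1, 2] ![0, 1] (by decide) (by decide) (by decide)]
    noncomm_ring
  rw [e3, e4] at red'
  have hY12 : (leg ![1, 2] Y : Matrix (Fin 3 → ι) (Fin 3 → ι) K) =
      leg ![0, 1] V * leg ![1, 2] Y * leg ![0, 1] W := by
    have hρ : Function.Injective ![(1 : Fin 4), 2, 0, 3] := by decide
    have h1 := congrArg (fun T => pt (at1 0 H.k * leg ![(1 : Fin 4), 2, 0, 3] T)) hX
    simp only [leg_mul _ hρ] at h1
    rw [leg_leg_eq ![1, 2] hρ (by decide), leg_leg_eq ![2, 0, 3] hρ (by decide),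
      succ_leg2 (i := 0) (j := 1) 1 2 rfl rfl, ← mul_assoc, at1_succ_comm, mul_assoc,
      pt_leg_succ_mul, ← mul_assoc, pt_mul_leg_succ,
      pull _ ![0, 2, 3] ![1, 2] (by decide) (by decide) (by decide)] at h1
    rw [mul_assoc, ← h1, ← mul_assoc, H.leg_V_mul_W (by decide), one_mul]
  refine ⟨W * Y, ?_⟩
  rw [dDefect_mul H.hWV H.pent, ← hY12]
  congr 1
  have : X = leg ![1, 2] V * leg ![0, 2] Y * leg ![1, 2] W +
      leg ![1, 2] V * leg ![0, 2] V * leg ![0, 1] Y * leg ![0, 2] W * leg ![1, 2] W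
      - leg ![0, 1] Y := by
    rw [← red']; abel
  conv_lhs => rw [this]
  abel

end ExactData

end Leg

namespace Leg

open Matrix Finset

set_option linter.unusedSectionVars false

theorem sum_rot {ι κ μ M : Type*} [Fintype ι] [Fintype κ] [Fintype μ] [AddCommMonoid M]
    (f : ι → κ → μ → M) :
    ∑ a, ∑ b, ∑ c, f a b c = ∑ b, ∑ c, ∑ a, f a b c := by
  rw [sum_comm]
  exact sum_congr rfl fun b _ => sum_comm

/-- An invertible solution of the pentagon equation on the free module `ι → S`, written as a matrix
of blocks `u i j`, together with vectors and covectors fixed by it. -/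
structure PreSys (ι S : Type*) [Fintype ι] [DecidableEq ι] [CommRing S] where
  u : ι → ι → Matrix ι ι S
  U : ι → ι → Matrix ι ι S
  huU : ∀ i j, ∑ k, u i k * U k j = if i = j then 1 else 0
  hUu : ∀ i j, ∑ k, U i k * u k j = if i = j then 1 else 0
  pent : ∀ i j a c, ∑ k, ∑ x, u i k a x • (u k j * u x c) = ∑ x, u i j x c • u a x
  β : ι → S
  α : ι → S
  φ : ι → S
  ε : ι → S
  hβ : ∀ i, ∑ j, β j • u i j = β i • (1 : Matrix ι ι S)
  hφ : ∀ j, ∑ i, φ i • u i j = φ j • (1 : Matrix ι ι S)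
  hα : ∀ i j a, ∑ b, u i j a b * α b = if i = j then α a else 0
  hε : ∀ i j b, ∑ a, ε a * u i j a b = if i = j then ε b else 0
  hεβ : ∑ i, ε i * β i = 1

namespace PreSys

variable {ι S : Type*} [Fintype ι] [DecidableEq ι] [CommRing S] (T : PreSys ι S)

/-- Left multiplication by a basis vector. -/
def l (j : ι) : Matrix ι ι S := ∑ i, T.ε i • T.u i j

/-- Left multiplication by the antipode of a basis vector. -/
def s (j : ι) : Matrix ι ι S := ∑ i, T.ε i • T.U i j

/-- `u i j` applied to the unit. -/
def h (i j a : ι) : S := ∑ b, T.u i j a b * T.β b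

theorem u_mul_l (i j c : ι) : T.u i j * T.l c = ∑ x, T.u i j x c • T.l x := by
  calc T.u i j * T.l c = ∑ x, T.ε x • (T.u i j * T.u x c) := by simp [l, mul_sum]
    _ = ∑ k, ∑ x, ∑ a, (T.ε a * T.u i k a x) • (T.u k j * T.u x c) := by
      simp [← sum_smul, T.hε, ite_smul]
    _ = ∑ a, T.ε a • ∑ k, ∑ x, T.u i k a x • (T.u k j * T.u x c) := by
      rw [← sum_rot]; simp [smul_sum, smul_smul]
    _ = ∑ x, T.u i j x c • T.l x := by
      simp_rw [T.pent, smul_sum]; rw [sum_comm]; simp [l, smul_sum, smul_smul, mul_comm]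

theorem l_mul_l (j c : ι) : T.l j * T.l c = ∑ x, T.l j x c • T.l x := by
  conv_lhs => rw [l]
  simp_rw [sum_mul, smul_mul_assoc, u_mul_l, smul_sum]
  rw [sum_comm]
  refine sum_congr rfl fun x _ => ?_
  conv_rhs => rw [l]
  simp [Matrix.sum_apply, sum_smul, smul_smul]

theorem mul_l (a j c : ι) :
    ∑ k, ∑ x, T.l k a x • (T.u k j * T.u x c) = ∑ x, T.l j x c • T.u a x := by
  calc _ = ∑ k, ∑ x, ∑ i, (T.ε i * T.u i k a x) • (T.u k j * T.u x c) := by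
        simp [l, Matrix.sum_apply, sum_smul]
    _ = ∑ i, T.ε i • ∑ k, ∑ x, T.u i k a x • (T.u k j * T.u x c) := by
      rw [← sum_rot]; simp [smul_sum, smul_smul]
    _ = _ := by
      simp_rw [T.pent, smul_sum]; rw [sum_comm]
      simp [l, Matrix.sum_apply, sum_smul, smul_smul]

theorem sum_h_u (i j a : ι) : ∑ k, T.h i k a • T.u k j = ∑ x, T.h i j x • T.u a x := by
  calc _ = ∑ k, ∑ x, T.u i k a x • (T.u k j * ∑ c, T.β c • T.u x c) := by
        simp [T.hβ, h, sum_smul, smul_smul]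
    _ = ∑ k, ∑ x, ∑ c, T.β c • (T.u i k a x • (T.u k j * T.u x c)) := by
        simp [mul_sum, smul_sum, smul_smul, mul_comm]
    _ = ∑ c, T.β c • ∑ k, ∑ x, (T.u i k a x • (T.u k j * T.u x c)) := by
        rw [← sum_rot]; simp [smul_sum]
    _ = _ := by
      simp_rw [T.pent, smul_sum]; rw [sum_comm]
      simp [h, sum_smul, smul_smul, mul_comm]

theorem l_β : ∑ c, T.β c • T.l c = 1 := by
  simp_rw [l, smul_sum]
  rw [sum_comm]
  calc _ = ∑ i, T.ε i • ∑ c, T.β c • T.u i c := by simp [smul_sum, smul_smul, mul_comm]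
    _ = 1 := by simp_rw [T.hβ, smul_smul, ← sum_smul, T.hεβ, one_smul]

theorem u_eq (i j : ι) : T.u i j = ∑ m, T.h i j m • T.l m := by
  calc T.u i j = T.u i j * ∑ c, T.β c • T.l c := by rw [l_β, mul_one]
    _ = ∑ c, ∑ m, (T.u i j m c * T.β c) • T.l m := by
      simp [mul_sum, u_mul_l, smul_sum, smul_smul, mul_comm]
    _ = _ := by rw [sum_comm]; simp [h, sum_smul]

theorem ε_h (i j : ι) : ∑ a, T.ε a * T.h i j a = if i = j then 1 else 0 := by
  simp_rw [h, mul_sum]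
  rw [sum_comm]
  simp_rw [← mul_assoc, ← sum_mul, T.hε]
  split <;> simp [T.hεβ]

theorem s_mul_u (a : ι) : ∑ d, T.s d * T.u d a = T.ε a • (1 : Matrix ι ι S) := by
  simp_rw [s, sum_mul]
  rw [sum_comm]
  simp_rw [smul_mul_assoc, ← smul_sum, T.hUu]
  simp

theorem l_mul_U (a : ι) : ∑ d, T.l d * T.U d a = T.ε a • (1 : Matrix ι ι S) := by
  simp_rw [l, sum_mul]
  rw [sum_comm]
  simp_rw [smul_mul_assoc, ← smul_sum, T.huU]
  simp

theorem sum_h_U (r t q : ι) : ∑ p, T.h r t p • T.U q p = ∑ k, T.h r k q • T.U k t := by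
  calc _ = ∑ p, ∑ m, T.h r m p • (T.U q p * ∑ k, T.u m k * T.U k t) := by
        simp [T.huU, smul_ite]
    _ = ∑ p, ∑ m, ∑ k, (T.U q p * (T.h r m p • T.u m k)) * T.U k t := by
        simp [mul_sum, smul_sum, mul_assoc]
    _ = ∑ p, ∑ k, (T.U q p * ∑ x, T.h r k x • T.u p x) * T.U k t := by
        refine sum_congr rfl fun p _ => ?_
        rw [sum_comm]
        simp_rw [← sum_h_u, mul_sum, sum_mul]
    _ = ∑ k, ∑ x, ∑ p, (T.h r k x • (T.U q p * T.u p x)) * T.U k t := by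
        rw [← sum_rot]; simp [mul_sum, sum_mul]
    _ = _ := by simp_rw [← sum_mul, ← smul_sum, T.hUu]; simp

theorem U_eq (i j : ι) : T.U i j = ∑ m, T.h i j m • T.s m := by
  symm
  calc _ = ∑ q, T.ε q • ∑ m, T.h i j m • T.U q m := by
        simp_rw [s, smul_sum]; rw [sum_comm]; simp_rw [smul_smul, mul_comm]
    _ = ∑ k, ∑ q, (T.ε q * T.h i k q) • T.U k j := by
        simp_rw [sum_h_U, smul_sum]; rw [sum_comm]; simp_rw [smul_smul]
    _ = _ := by simp_rw [← sum_smul, ε_h]; simp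

theorem sum_u_U_apply (i q x d : ι) :
    ∑ j, ∑ c, T.u i j x c * T.U j q c d = if i = q ∧ x = d then 1 else 0 := by
  have := congrFun (congrFun (T.huU i q) x) d
  simp only [Matrix.sum_apply, Matrix.mul_apply] at this
  rw [this]
  by_cases h : i = q <;> by_cases h' : x = d <;> simp [h, h', Matrix.one_apply]

theorem U_mul_l (t q d : ι) : T.U t q * T.l d = ∑ c, T.U t q c d • T.l c := by
  have key : ∀ j c, ∑ i, T.U t i * ∑ x, T.u i j x c • T.l x = if t = j then T.l c else 0 := by
    intro j c
    simp_rw [← u_mul_l, ← mul_assoc, ← sum_mul, T.hUu]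
    simp
  symm
  calc _ = ∑ j, ∑ c, T.U j q c d • ∑ i, T.U t i * ∑ x, T.u i j x c • T.l x := by
        simp_rw [key]; simp
    _ = ∑ j, ∑ c, ∑ i, T.U t i * ∑ x, (T.u i j x c * T.U j q c d) • T.l x := by
        simp [smul_sum, smul_smul, mul_sum, mul_comm]
    _ = ∑ i, ∑ j, ∑ c, T.U t i * ∑ x, (T.u i j x c * T.U j q c d) • T.l x := by
        rw [sum_rot, sum_rot]
    _ = ∑ i, T.U t i * ∑ x, (∑ j, ∑ c, T.u i j x c * T.U j q c d) • T.l x := by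
        refine sum_congr rfl fun i _ => ?_
        simp_rw [← mul_sum]
        congr 1
        rw [← sum_rot]
        simp_rw [← sum_smul]
    _ = _ := by
        simp_rw [sum_u_U_apply, ite_and]
        simp [apply_ite, ite_smul]

theorem ε_vecMul_l (j c : ι) : ∑ a, T.ε a * T.l j a c = T.ε j * T.ε c := by
  simp_rw [l, Matrix.sum_apply, mul_sum]
  rw [sum_comm]
  have : ∀ i, ∑ a, T.ε a * (T.ε i • T.u i j) a c = T.ε i * ∑ a, T.ε a * T.u i j a c := by
    intro i; rw [mul_sum]; exact sum_congr rfl fun a _ => by simp; ring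
  simp_rw [this, T.hε]
  simp

theorem sum_l_U_U (t c j : ι) :
    ∑ y, (∑ x, T.l y t x • T.U x c) * T.U y j = ∑ a, T.l j a c • T.U t a := by
  have key : ∀ y x, ∑ a, T.U t a * ∑ k, ∑ z, T.l k a z • (T.u k y * T.u z x)
      = T.l y t x • (1 : Matrix ι ι S) := by
    intro y x
    simp_rw [mul_l, mul_sum]
    rw [sum_comm]
    simp_rw [mul_smul_comm, ← smul_sum, T.hUu]
    simp
  have inner : ∀ y, ∑ x, T.l y t x • T.U x c = ∑ a, T.U t a * ∑ k, T.l k a c • T.u k y := by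
    intro y
    calc _ = ∑ x, (T.l y t x • (1 : Matrix ι ι S)) * T.U x c := by simp
      _ = ∑ x, ∑ a, T.U t a * ∑ k, ∑ z, T.l k a z • (T.u k y * (T.u z x * T.U x c)) := by
        simp_rw [← key, sum_mul, mul_assoc, sum_mul, smul_mul_assoc, mul_assoc]
      _ = ∑ a, T.U t a * ∑ k, ∑ z, T.l k a z • (T.u k y * ∑ x, T.u z x * T.U x c) := by
        rw [sum_comm]
        refine sum_congr rfl fun a _ => ?_
        rw [← mul_sum, sum_rot]
        simp_rw [← smul_sum, ← mul_sum]
      _ = _ := by simp_rw [T.huU]; simp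
  simp_rw [inner, sum_mul]
  rw [sum_comm]
  refine sum_congr rfl fun a _ => ?_
  trans T.U t a * ∑ k, T.l k a c • ∑ y, T.u k y * T.U y j
  · simp_rw [mul_assoc, ← mul_sum, sum_mul]
    rw [sum_comm]
    simp_rw [smul_mul_assoc, ← smul_sum]
  · simp_rw [T.huU]; simp

theorem s_mul_s (j c : ι) : T.s c * T.s j = ∑ a, T.l j a c • T.s a := by
  calc T.s c * T.s j = ∑ y, ∑ x, (T.ε y * T.ε x) • (T.U x c * T.U y j) := by
        simp_rw [s, sum_mul, mul_sum]
        rw [sum_comm]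
        simp [smul_smul]
    _ = ∑ y, ∑ x, ∑ t, T.ε t • ((T.l y t x • T.U x c) * T.U y j) := by
        simp_rw [← ε_vecMul_l, sum_smul, smul_mul_assoc, smul_smul]
    _ = ∑ t, T.ε t • ∑ y, (∑ x, T.l y t x • T.U x c) * T.U y j := by
        rw [← sum_rot]; simp_rw [sum_mul, smul_sum]
    _ = _ := by
        simp_rw [sum_l_U_U, smul_sum]
        rw [sum_comm]
        simp_rw [s, smul_sum, smul_smul, mul_comm]

end PreSys
end Leg

namespace Leg

open Matrix Finset

set_option linter.unusedSectionVars false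

namespace PreSys

variable {ι S : Type*} [Fintype ι] [DecidableEq ι] [CommRing S] (T : PreSys ι S)

/-- The system acting on the dual space. -/
def dual : PreSys ι S where
  u i j := of fun a b => T.u b a j i
  U i j := of fun a b => T.U b a j i
  huU i j := by
    ext a b
    have := congrFun (congrFun (T.hUu b a) j) i
    simp only [Matrix.sum_apply, Matrix.mul_apply] at this
    simp only [Matrix.sum_apply, Matrix.mul_apply, of_apply]
    rw [sum_comm]
    simp_rw [mul_comm (T.u _ _ _ _)]
    rw [this]
    by_cases h : i = j <;> by_cases h' : a = b <;> simp [h, h', eq_comm, Matrix.one_apply]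
  hUu i j := by
    ext a b
    have := congrFun (congrFun (T.huU b a) j) i
    simp only [Matrix.sum_apply, Matrix.mul_apply] at this
    simp only [Matrix.sum_apply, Matrix.mul_apply, of_apply]
    rw [sum_comm]
    simp_rw [mul_comm (T.U _ _ _ _)]
    rw [this]
    by_cases h : i = j <;> by_cases h' : a = b <;> simp [h, h', eq_comm, Matrix.one_apply]
  pent i j a c := by
    ext b d
    have := congrFun (congrFun (T.pent d b c a) j) i
    simp only [Matrix.sum_apply, Matrix.smul_apply, Matrix.mul_apply, smul_eq_mul] at this
    simp only [Matrix.sum_apply, Matrix.smul_apply, Matrix.mul_apply, of_apply, smul_eq_mul]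
    simp_rw [mul_comm (T.u c _ _ _)]
    rw [← this]
    simp_rw [mul_sum]
    rw [sum_rot, sum_comm]
    refine sum_congr rfl fun x _ => ?_
    refine sum_congr rfl fun y _ => sum_congr rfl fun z _ => ?_
    ring
  β := T.ε
  α := T.φ
  φ := T.α
  ε := T.β
  hβ i := by
    ext a b
    have := T.hε b a i
    simp only [Matrix.sum_apply, Matrix.smul_apply, of_apply, smul_eq_mul, this, Matrix.one_apply,
      mul_ite, mul_one, mul_zero, eq_comm]
  hφ j := by
    ext a b
    have := T.hα b a j
    simp only [Matrix.sum_apply, Matrix.smul_apply, of_apply, smul_eq_mul, mul_comm (T.α _), this,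
      Matrix.one_apply, ite_mul, one_mul, zero_mul, eq_comm]
  hα i j a := by
    have := congrFun (congrFun (T.hφ a) j) i
    simp only [Matrix.sum_apply, Matrix.smul_apply, smul_eq_mul, Matrix.one_apply, mul_ite,
      mul_one, mul_zero] at this
    simp only [of_apply, mul_comm _ (T.φ _), this, eq_comm]
  hε i j b := by
    have := congrFun (congrFun (T.hβ b) j) i
    simp only [Matrix.sum_apply, Matrix.smul_apply, smul_eq_mul, Matrix.one_apply, mul_ite,
      mul_one, mul_zero] at this
    simp only [of_apply, this, eq_comm]
  hεβ := by rw [← T.hεβ]; exact sum_congr rfl fun i _ => mul_comm _ _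

theorem dual_l (j a b : ι) : T.dual.l j a b = T.h b a j := by
  simp [l, h, dual, Matrix.sum_apply, mul_comm]

theorem dual_dual : T.dual.dual = T := rfl

/-- The bilinear form `φ (a b)`. -/
def G : Matrix ι ι S := of fun a b => ∑ k, T.φ k * T.l a k b

/-- The value of `φ` at `α`. -/
def p : S := ∑ i, T.φ i * T.α i

/-- The coefficients of `∑ α j U k j β`. -/
def Y : Matrix ι ι S := of fun k m => ∑ j, T.α j * ∑ b, T.U k j m b * T.β b

/-- The matrix of the antipode. -/
def A : Matrix ι ι S := of fun m b => ∑ c, T.s b m c * T.β c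

theorem dual_p : T.dual.p = T.p := by simp [p, dual, mul_comm]

theorem dual_A : T.dual.A = T.Aᵀ := by
  ext m b
  simp only [A, s, dual, Matrix.sum_apply, of_apply, Matrix.transpose_apply, Matrix.smul_apply,
    smul_eq_mul, sum_mul]
  rw [sum_comm]
  refine sum_congr rfl fun x _ => sum_congr rfl fun y _ => ?_
  ring

/-- `β` is a right unit. -/
def RightUnit : Prop := ∀ j a, ∑ b, T.l j a b * T.β b = if a = j then 1 else 0

theorem RightUnit.dual {T : PreSys ι S} (hT : T.RightUnit) : T.dual.RightUnit := by
  intro j a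
  simp_rw [dual_l]
  have := hT a j
  simp_rw [eq_comm (a := a)]
  rw [← this]
  simp only [l, h, PreSys.dual, Matrix.sum_apply, Matrix.smul_apply, smul_eq_mul, sum_mul]
  rw [sum_comm]
  refine sum_congr rfl fun x _ => sum_congr rfl fun y _ => ?_
  ring

theorem sum_G_u_u (j c : ι) :
    ∑ k, ∑ x, T.G k x • (T.u k j * T.u x c) = T.G j c • (1 : Matrix ι ι S) := by
  calc _ = ∑ k, ∑ x, ∑ a, (T.φ a * T.l k a x) • (T.u k j * T.u x c) := by
        simp [G, sum_smul]
    _ = ∑ a, T.φ a • ∑ k, ∑ x, T.l k a x • (T.u k j * T.u x c) := by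
        rw [← sum_rot]; simp [smul_sum, smul_smul]
    _ = _ := by
        simp_rw [mul_l, smul_sum]
        rw [sum_comm]
        simp_rw [smul_comm (T.φ _), ← smul_sum, hφ, smul_smul, ← sum_smul]
        simp [G, mul_comm]

theorem sum_G_u (a b : ι) : ∑ d, T.G d b • T.u d a = ∑ e, T.G a e • T.U e b := by
  calc _ = ∑ d, ∑ x, T.G d x • (T.u d a * ∑ e, T.u x e * T.U e b) := by
        simp [T.huU, smul_ite]
    _ = ∑ d, ∑ x, ∑ e, (T.G d x • (T.u d a * T.u x e)) * T.U e b := by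
        simp [mul_sum, smul_sum, mul_assoc]
    _ = ∑ e, (∑ d, ∑ x, T.G d x • (T.u d a * T.u x e)) * T.U e b := by
        rw [← sum_rot]; simp [sum_mul]
    _ = _ := by simp [sum_G_u_u]

theorem l_α (d a : ι) : ∑ b, T.l d a b * T.α b = T.ε d * T.α a := by
  simp_rw [l, Matrix.sum_apply, sum_mul]
  rw [sum_comm]
  have : ∀ i, ∑ b, (T.ε i • T.u i d) a b * T.α b = T.ε i * ∑ b, T.u i d a b * T.α b := by
    intro i; rw [mul_sum]; exact sum_congr rfl fun a _ => by simp; ring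
  simp_rw [this, T.hα]
  simp

theorem G_α (d : ι) : ∑ b, T.G d b * T.α b = T.p * T.ε d := by
  calc _ = ∑ k, T.φ k * ∑ b, T.l d k b * T.α b := by
        simp_rw [G, of_apply, sum_mul, mul_sum]; rw [sum_comm]; simp_rw [mul_assoc]
    _ = _ := by simp_rw [l_α, p, sum_mul]; exact sum_congr rfl fun a _ => by ring

theorem p_smul_l (a : ι) : T.p • T.l a = ∑ k, T.G a k • ∑ j, T.α j • T.U k j := by
  calc _ = ∑ d, (∑ b, T.G d b * T.α b) • T.u d a := by
        simp_rw [G_α, l, smul_sum, smul_smul]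
    _ = ∑ b, T.α b • ∑ d, T.G d b • T.u d a := by
        simp_rw [smul_sum, smul_smul, sum_smul]; rw [sum_comm]; simp_rw [mul_comm]
    _ = _ := by
        simp_rw [sum_G_u, smul_sum, smul_smul]; rw [sum_comm]; simp_rw [mul_comm]

theorem G_mul_Y (hT : T.RightUnit) : T.G * T.Y = T.p • (1 : Matrix ι ι S) := by
  ext a m
  calc (T.G * T.Y) a m = ∑ b, (∑ k, T.G a k • ∑ j, T.α j • T.U k j) m b * T.β b := by
        simp only [Matrix.mul_apply, Y, of_apply, Matrix.sum_apply, Matrix.smul_apply, smul_eq_mul,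
          mul_sum, sum_mul]
        rw [sum_rot, sum_rot]
        refine sum_congr rfl fun x _ => sum_congr rfl fun y _ => sum_congr rfl fun z _ => ?_
        ring
    _ = _ := by
        simp_rw [← p_smul_l, Matrix.smul_apply, smul_eq_mul, mul_assoc, ← mul_sum, hT a m]
        simp [Matrix.one_apply, eq_comm]

theorem G_assoc (j c d : ι) : ∑ x, T.l j x c * T.G x d = ∑ y, T.G j y * T.l c y d := by
  have := congrArg (fun M : Matrix ι ι S => ∑ k, T.φ k * M k d) (T.l_mul_l j c)
  simp only [Matrix.mul_apply, Matrix.sum_apply, Matrix.smul_apply, smul_eq_mul, mul_sum] at this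
  simp only [G, of_apply, mul_sum, sum_mul]
  rw [sum_comm]
  conv_rhs => rw [sum_comm]
  simp_rw [mul_left_comm (T.l _ _ _), ← this, mul_assoc]

theorem Y_eq : T.Y = T.dual.Gᵀ * T.Aᵀ := by
  ext k m
  simp only [Y, U_eq, Matrix.mul_apply, Matrix.transpose_apply, G, A, of_apply, dual_l,
    Matrix.sum_apply, Matrix.smul_apply, smul_eq_mul, sum_mul, mul_sum]
  rw [sum_rot, sum_comm]
  refine sum_congr rfl fun x _ => sum_congr rfl fun y _ => sum_congr rfl fun z _ => ?_
  simp only [dual]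
  ring

end PreSys
end Leg

namespace Leg

open Matrix Finset

set_option linter.unusedSectionVars false

theorem sum_swap_pairs {ι M : Type*} [Fintype ι] [AddCommMonoid M] (f : ι → ι → ι → ι → M) :
    ∑ a, ∑ b, ∑ c, ∑ d, f a b c d = ∑ c, ∑ d, ∑ a, ∑ b, f a b c d := by
  simp_rw [sum_rot (f _)]
  rw [sum_rot]

namespace PreSys

variable {ι K : Type*} [Fintype ι] [DecidableEq ι] [Field K] (T : PreSys ι K)

/-- Unitality of `β` together with nonvanishing of the pairings of the fixed vectors. -/
structure Regular : Prop where
  unit : T.RightUnit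
  p_ne : T.p ≠ 0
  εα_ne : ∑ i, T.ε i * T.α i ≠ 0
  φβ_ne : ∑ i, T.φ i * T.β i ≠ 0

variable {T}

namespace Regular

theorem dual (H : T.Regular) : T.dual.Regular where
  unit := H.unit.dual
  p_ne := by rw [dual_p]; exact H.p_ne
  εα_ne := by
    have := H.φβ_ne
    simpa only [PreSys.dual, mul_comm] using this
  φβ_ne := by
    have := H.εα_ne
    simpa only [PreSys.dual, mul_comm] using this

theorem Y_mul_G (H : T.Regular) : T.Y * T.G = T.p • (1 : Matrix ι ι K) := by
  have h := T.G_mul_Y H.unit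
  have : T.G * (T.p⁻¹ • T.Y) = 1 := by
    rw [mul_smul_comm, h, smul_smul, inv_mul_cancel₀ H.p_ne, one_smul]
  rw [mul_eq_one_comm, smul_mul_assoc] at this
  rw [← this, smul_smul, mul_inv_cancel₀ H.p_ne, one_smul]

theorem G_cancel (H : T.Regular) {X Z : Matrix ι ι K} (h : X * T.G = Z * T.G) : X = Z := by
  have := congrArg (fun M => T.p⁻¹ • (M * T.Y)) h
  simpa [mul_assoc, T.G_mul_Y H.unit, smul_smul, inv_mul_cancel₀ H.p_ne] using this

/-- `α` is a right integral. -/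
theorem α_l (H : T.Regular) (x c : ι) : ∑ a, T.α a * T.l a x c = T.α x * T.ε c := by
  set r : ι → K := T.p⁻¹ • (T.ε ᵥ* T.Y) with hr
  have hrG : r ᵥ* T.G = T.ε := by
    rw [hr, smul_vecMul, vecMul_vecMul, H.Y_mul_G]
    simp [vecMul_smul, smul_smul, inv_mul_cancel₀ H.p_ne]
  have hM : ∀ x c, ∑ j, r j * T.l j x c = r x * T.ε c := by
    suffices (of fun c x => ∑ j, r j * T.l j x c) = of fun c x => r x * T.ε c by
      intro x c; exact congrFun (congrFun this c) x
    apply H.G_cancel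
    ext c d
    have h1 := fun j => congrArg (r j * ·) (T.G_assoc j c d)
    have h2 := Finset.sum_congr rfl fun j (_ : j ∈ univ) => h1 j
    simp only [Matrix.mul_apply, of_apply, sum_mul, mul_assoc]
    rw [sum_comm]
    simp_rw [← mul_sum, h2]
    simp_rw [mul_sum]
    rw [sum_comm]
    simp_rw [← mul_assoc, ← sum_mul]
    have h3 : ∀ y, ∑ j, r j * T.G j y = T.ε y := fun y => congrFun hrG y
    simp_rw [h3, T.ε_vecMul_l, mul_comm _ (T.ε c), mul_assoc, ← mul_sum, h3]
  have hα : ∀ x, r x * (∑ i, T.ε i * T.α i) = (∑ i, r i * T.ε i) * T.α x := by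
    intro x
    calc _ = ∑ c, (∑ j, r j * T.l j x c) * T.α c := by
          simp_rw [hM, mul_sum, mul_assoc]
      _ = ∑ j, r j * ∑ c, T.l j x c * T.α c := by
          simp_rw [sum_mul, mul_sum]; rw [sum_comm]; simp_rw [mul_assoc]
      _ = _ := by simp_rw [T.l_α, sum_mul, mul_assoc]
  have hne : ∑ i, r i * T.ε i ≠ 0 := by
    intro h0
    have hr0 : r = 0 := by
      ext x
      have := hα x
      rw [h0, zero_mul] at this
      exact (mul_eq_zero.mp this).resolve_right H.εα_ne
    have := T.hεβ
    rw [← hrG, hr0] at this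
    simp at this
  apply mul_left_cancel₀ hne
  calc _ = ∑ a, r a * (∑ i, T.ε i * T.α i) * T.l a x c := by
        simp_rw [hα, mul_sum (f := fun a => T.α a * T.l a x c), mul_assoc]
    _ = (∑ i, T.ε i * T.α i) * ∑ a, r a * T.l a x c := by
        rw [mul_sum]
        exact sum_congr rfl fun a _ => by ring
    _ = _ := by rw [hM, ← mul_assoc, mul_comm _ (r x), hα, mul_assoc]

theorem α_G (H : T.Regular) (c : ι) : ∑ a, T.α a * T.G a c = T.p * T.ε c := by
  calc _ = ∑ k, T.φ k * ∑ a, T.α a * T.l a k c := by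
        simp_rw [G, of_apply, mul_sum]; rw [sum_comm]; simp_rw [mul_left_comm]
    _ = _ := by simp_rw [H.α_l, p, sum_mul, mul_assoc]

theorem φ_h (H : T.Regular) (c x : ι) : ∑ a, T.φ a * T.h c x a = T.φ x * T.β c := by
  have := H.dual.α_l x c
  simp_rw [dual_l] at this
  exact this

theorem p_smul_A (H : T.Regular) : T.p • T.A = T.dual.G * T.G := by
  ext m b
  have hs : T.p • T.s b = ∑ d, T.G d b • ∑ a, T.α a • T.u d a := by
    calc _ = ∑ e, (∑ a, T.α a * T.G a e) • T.U e b := by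
          simp_rw [H.α_G, s, smul_sum, smul_smul]
      _ = ∑ a, T.α a • ∑ e, T.G a e • T.U e b := by
          simp_rw [smul_sum, sum_smul, smul_smul]; rw [sum_comm]
      _ = _ := by
          simp_rw [← T.sum_G_u, smul_sum, smul_smul]; rw [sum_comm]; simp_rw [mul_comm]
  calc _ = ∑ c, (T.p • T.s b) m c * T.β c := by
        simp [A, mul_sum, mul_assoc]
    _ = ∑ d, ∑ a, T.G d b * (T.α a * ∑ c, T.u d a m c * T.β c) := by
        simp_rw [hs, Matrix.sum_apply, Matrix.smul_apply, Matrix.sum_apply, Matrix.smul_apply,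
          sum_mul, smul_eq_mul, mul_sum, sum_mul]
        rw [sum_rot]
        simp_rw [mul_assoc]
    _ = _ := by
        simp_rw [Matrix.mul_apply, G, of_apply, dual_l, h, PreSys.dual]
        refine sum_congr rfl fun d _ => ?_
        rw [sum_mul]
        exact sum_congr rfl fun a _ => by ring

theorem p_smul_At (H : T.Regular) : T.p • T.Aᵀ = T.G * T.dual.G := by
  have := H.dual.p_smul_A
  rwa [dual_p, dual_A, dual_dual] at this

end Regular

theorem s_eq (T : PreSys ι K) (q : ι) : T.s q = ∑ m, T.A m q • T.l m := by
  have h1 : ∀ d, T.s q * T.l d = ∑ c, T.s q c d • T.l c := by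
    intro d
    simp_rw [s, sum_mul, smul_mul_assoc, U_mul_l, smul_sum]
    rw [sum_comm]
    simp [Matrix.sum_apply, sum_smul, smul_smul]
  calc T.s q = T.s q * ∑ d, T.β d • T.l d := by rw [T.l_β, mul_one]
    _ = ∑ d, T.β d • ∑ c, T.s q c d • T.l c := by simp_rw [mul_sum, mul_smul_comm, h1]
    _ = _ := by
      simp_rw [smul_sum, A, of_apply, sum_smul, smul_smul]; rw [sum_comm]; simp_rw [mul_comm]

/-- Coassociativity in coordinates. -/
theorem sum_h_h (T : PreSys ι K) (a k d n : ι) :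
    ∑ x, T.h a k x * T.h d x n = ∑ m, T.h a m d * T.h m k n := by
  have := congrArg (fun M : Matrix ι ι K => ∑ b, M n b * T.β b) (T.sum_h_u a k d)
  simp only [Matrix.sum_apply, Matrix.smul_apply, smul_eq_mul, sum_mul, mul_assoc] at this
  rw [sum_comm] at this
  conv_rhs at this => rw [sum_comm]
  simp_rw [← mul_sum] at this
  exact this.symm

theorem RightUnit.ε_h {T : PreSys ι K} (hT : T.RightUnit) (k n : ι) :
    ∑ m, T.ε m * T.h m k n = if n = k then 1 else 0 := by
  rw [← hT k n]
  simp_rw [h, l, Matrix.sum_apply, sum_mul, mul_sum]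
  rw [sum_comm]
  simp [mul_assoc]

theorem dual_G_apply (T : PreSys ι K) (b a : ι) : T.dual.G b a = ∑ k, T.α k * T.h a k b := by
  simp_rw [G, of_apply, dual_l, PreSys.dual]

theorem φ_u (T : PreSys ι K) (k j w : ι) : ∑ a, T.φ a * T.u k j a w = ∑ m, T.h k j m * T.G m w := by
  simp_rw [u_eq, Matrix.sum_apply, Matrix.smul_apply, G, of_apply, mul_sum]
  rw [sum_comm]
  simp only [smul_eq_mul, mul_left_comm]

namespace Regular
theorem sum_l_l (H : T.Regular) (j c : ι) :
    ∑ k, ∑ x, (∑ m, T.h k j m * ∑ w, T.G m w * T.h x c w) • (T.l k * T.l x)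
      = T.G j c • (1 : Matrix ι ι K) := by
  have h1 : ∀ k x, ∑ m, T.h k j m * ∑ w, T.G m w * T.h x c w
      = ∑ b, ∑ d, T.φ b * (T.u k j * T.u x c) b d * T.β d := by
    intro k x
    symm
    calc _ = ∑ b, ∑ y, T.φ b * T.u k j b y * T.h x c y := by
          refine sum_congr rfl fun b _ => ?_
          simp_rw [Matrix.mul_apply, h, mul_sum, sum_mul]
          rw [sum_comm]
          simp_rw [mul_assoc]
      _ = _ := by
          rw [sum_comm]
          simp_rw [← sum_mul, φ_u, mul_sum, sum_mul]
          rw [sum_comm]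
          simp_rw [mul_assoc]
  have h2 : ∀ a, ∑ k, ∑ x, T.l k a x * (∑ m, T.h k j m * ∑ w, T.G m w * T.h x c w)
      = T.G j c * T.β a := by
    intro a
    have := congrArg (fun M : Matrix ι ι K => ∑ b, ∑ d, T.φ b * M b d * T.β d) (T.mul_l a j c)
    calc _ = ∑ b, ∑ d, T.φ b * (∑ k, ∑ x, T.l k a x • (T.u k j * T.u x c)) b d * T.β d := by
          simp_rw [h1, Matrix.sum_apply, Matrix.smul_apply, smul_eq_mul, mul_sum, sum_mul]
          rw [sum_swap_pairs]
          refine sum_congr rfl fun b _ => sum_congr rfl fun b _ => sum_congr rfl fun b _ =>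
            sum_congr rfl fun b _ => ?_
          ring
      _ = ∑ x, T.l j x c * ∑ b, T.φ b * T.h a x b := by
          rw [this]
          simp_rw [h, Matrix.sum_apply, Matrix.smul_apply, smul_eq_mul, mul_sum, sum_mul]
          rw [← sum_rot]
          refine sum_congr rfl fun b _ => sum_congr rfl fun b _ => sum_congr rfl fun b _ => ?_
          ring
      _ = _ := by
          simp_rw [H.φ_h, G, of_apply, sum_mul]
          exact sum_congr rfl fun b _ => by ring
  calc _ = ∑ k, ∑ x, ∑ a, (T.l k a x * (∑ m, T.h k j m * ∑ w, T.G m w * T.h x c w)) • T.l a := by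
        simp_rw [l_mul_l, smul_sum, smul_smul, mul_comm]
    _ = ∑ a, (T.G j c * T.β a) • T.l a := by
        rw [← sum_rot]; simp_rw [← h2, sum_smul]
    _ = _ := by simp_rw [← smul_smul, ← smul_sum, T.l_β]

theorem A_mul_Gt_mul_G (H : T.Regular) : T.A * T.dual.Gᵀ * T.G = T.p • (1 : Matrix ι ι K) := by
  have hX : ∀ w, ∑ k, T.α k • ∑ a, (∑ m, T.h a k m * T.G m w) • T.s a = T.p • T.l w := by
    intro w
    set Γ : ι → Matrix ι ι K := fun n => ∑ x, (∑ q, T.G n q * T.h x w q) • T.l x with hΓ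
    have h1 : ∀ m, ∑ d, T.l d * ∑ n, T.h d m n • Γ n = T.G m w • (1 : Matrix ι ι K) := by
      intro m
      rw [← H.sum_l_l]
      refine sum_congr rfl fun d _ => ?_
      simp_rw [hΓ, smul_sum, smul_smul, sum_smul, mul_sum, mul_smul_comm]
      rw [sum_comm]
    have h2 : ∀ k, ∑ a, (∑ m, T.h a k m * T.G m w) • T.s a = Γ k := by
      intro k
      calc _ = ∑ a, ∑ m, T.h a k m • (T.s a * (T.G m w • (1 : Matrix ι ι K))) := by
            simp_rw [sum_smul, mul_smul_comm, mul_one, smul_smul]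
        _ = ∑ a, ∑ m, ∑ d, ∑ n, (T.h a k m * T.h d m n) • (T.s a * (T.l d * Γ n)) := by
            simp_rw [← h1, mul_sum, smul_sum, mul_smul_comm, smul_smul]
        _ = ∑ a, ∑ d, ∑ n, (∑ m, T.h a k m * T.h d m n) • (T.s a * (T.l d * Γ n)) := by
            refine sum_congr rfl fun a _ => ?_
            rw [sum_rot]
            simp_rw [sum_smul]
        _ = ∑ a, ∑ m, ∑ d, ∑ n, (T.h a m d * T.h m k n) • (T.s a * (T.l d * Γ n)) := by
            refine sum_congr rfl fun a _ => ?_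
            simp_rw [sum_h_h, sum_smul]
            rw [← sum_rot]
        _ = ∑ a, ∑ m, (T.s a * T.u a m) * ∑ n, T.h m k n • Γ n := by
            simp_rw [u_eq, mul_sum, sum_mul, mul_smul_comm, smul_mul_assoc, smul_smul, mul_assoc]
            refine sum_congr rfl fun a _ => sum_congr rfl fun m _ => ?_
            rw [sum_comm]
            simp_rw [mul_comm]
        _ = ∑ m, T.ε m • ∑ n, T.h m k n • Γ n := by
            rw [sum_comm]
            simp_rw [← sum_mul, s_mul_u, smul_mul_assoc, one_mul]
        _ = ∑ n, (∑ m, T.ε m * T.h m k n) • Γ n := by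
            simp_rw [smul_sum, smul_smul, sum_smul]
            rw [sum_comm]
        _ = _ := by simp_rw [H.unit.ε_h]; simp
    simp_rw [h2]
    calc _ = ∑ x, (∑ q, (∑ k, T.α k * T.G k q) * T.h x w q) • T.l x := by
          simp_rw [hΓ, smul_sum, smul_smul, mul_sum, sum_mul, sum_smul]
          rw [sum_rot]
          simp_rw [mul_assoc]
      _ = _ := by
          simp_rw [H.α_G, mul_assoc, ← mul_sum, T.ε_h, ← smul_smul, ← smul_sum]
          simp
  ext m w
  have := congrArg (fun M : Matrix ι ι K => ∑ c, M m c * T.β c) (hX w)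
  simp only [Matrix.smul_apply, smul_eq_mul, mul_assoc, ← mul_sum, H.unit w m] at this
  rw [Matrix.smul_apply, Matrix.one_apply, smul_eq_mul, ← this]
  calc _ = ∑ k, ∑ a, ∑ b, T.A m a * (T.α k * T.h a k b) * T.G b w := by
        simp_rw [Matrix.mul_apply, Matrix.transpose_apply, sum_mul]
        simp_rw [dual_G_apply, mul_sum, sum_mul]
        conv_rhs => rw [sum_rot, sum_comm]
    _ = ∑ k, T.α k * ∑ a, (∑ b, T.h a k b * T.G b w) * T.A m a := by
        simp_rw [mul_sum, sum_mul, mul_sum]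
        refine sum_congr rfl fun b _ => sum_congr rfl fun b _ => sum_congr rfl fun b _ => ?_
        ring
    _ = _ := by
        simp only [A, of_apply, Matrix.sum_apply, Matrix.smul_apply, smul_eq_mul, sum_mul, mul_sum]
        conv_rhs => rw [sum_rot]
        refine sum_congr rfl fun b _ => sum_congr rfl fun b _ => sum_congr rfl fun b _ =>
          sum_congr rfl fun b _ => ?_
        ring

end Regular
end PreSys
end Leg

namespace Leg

open Matrix Finset

set_option linter.unusedSectionVars false

namespace PreSys

variable {ι K : Type*} [Fintype ι] [DecidableEq ι] [Field K] {T : PreSys ι K}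

/-- The square of the antipode. -/
def sig (T : PreSys ι K) : Matrix ι ι K := T.A * T.A

theorem dual_sig (T : PreSys ι K) : T.dual.sig = T.sigᵀ := by
  rw [sig, sig, dual_A, transpose_mul]

theorem sum_U_Y (T : PreSys ι K) (d m : ι) :
    ∑ a, (fun k => ∑ j, T.α j • T.U k j) d m a * T.β a = T.Y d m := by
  simp only [Y, of_apply, Matrix.sum_apply, Matrix.smul_apply, smul_eq_mul, sum_mul, mul_sum,
    mul_assoc]
  rw [sum_comm]

namespace Regular

theorem p_smul_sig (H : T.Regular) : T.p • T.sig = T.Yᵀ * T.G := by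
  rw [sig, ← mul_smul_comm, H.p_smul_A, Y_eq, transpose_mul, transpose_transpose,
    transpose_transpose, mul_assoc]

theorem sig_mul_sig (H : T.Regular) : T.sig * T.sig = 1 := by
  have h1 : T.p • T.A = T.dual.Gᵀ * T.Gᵀ := by
    rw [← transpose_mul, ← H.p_smul_At, transpose_smul, transpose_transpose]
  have h2 : T.Gᵀ * (T.A * T.dual.G) = T.p • (1 : Matrix ι ι K) := by
    have := congrArg transpose H.Y_mul_G
    simpa [Y_eq, transpose_mul, mul_assoc] using this
  have h3 : (T.p * T.p) • (T.sig * T.sig) = (T.p * T.p) • (1 : Matrix ι ι K) := by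
    calc _ = (T.A * (T.dual.Gᵀ * T.Gᵀ)) * (T.A * (T.dual.G * T.G)) := by
          rw [← h1, ← H.p_smul_A]
          simp [sig, smul_smul]
      _ = T.A * T.dual.Gᵀ * (T.Gᵀ * (T.A * T.dual.G)) * T.G := by simp only [mul_assoc]
      _ = _ := by rw [h2, mul_smul_comm, smul_mul_assoc, mul_one, H.A_mul_Gt_mul_G, smul_smul]
  exact smul_right_injective _ (mul_ne_zero H.p_ne H.p_ne) h3

theorem p_mul_trace_sig (H : T.Regular) :
    T.p * T.sig.trace = (∑ i, T.ε i * T.α i) * ∑ i, T.φ i * T.β i := by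
  have h1 : ∑ k, T.l k * (fun k => ∑ j, T.α j • T.U k j) k =
      (∑ i, T.ε i * T.α i) • (1 : Matrix ι ι K) := by
    simp_rw [mul_sum, mul_smul_comm]
    rw [sum_comm]
    simp_rw [← smul_sum, l_mul_U, smul_smul, ← sum_smul, mul_comm]
  have h3 := T.sum_U_Y
  generalize (fun k => ∑ j, T.α j • T.U k j) = y at h1 h3
  generalize ∑ i, T.ε i * T.α i = E at h1 ⊢
  have h2 := congrArg (fun M : Matrix ι ι K => ∑ x, ∑ y, T.φ x * M x y * T.β y) h1
  rw [← smul_eq_mul, ← trace_smul, H.p_smul_sig]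
  calc _ = ∑ k, ∑ m, T.G k m * T.Y k m := by
        simp_rw [trace, Matrix.diag, Matrix.mul_apply, transpose_apply, mul_comm (T.Y _ _)]
        rw [sum_comm]
    _ = ∑ k, ∑ m, ∑ x, ∑ z, T.φ x * (T.l k x m * y k m z) * T.β z := by
        simp_rw [← h3, G, of_apply, sum_mul_sum, mul_assoc]
    _ = ∑ x, ∑ z, T.φ x * (∑ k, T.l k * y k) x z * T.β z := by
        simp_rw [Matrix.sum_apply, Matrix.mul_apply, mul_sum, sum_mul]
        rw [sum_swap_pairs]
    _ = _ := by
        refine h2.trans ?_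
        simp [Matrix.one_apply, mul_sum, mul_assoc, mul_left_comm]

theorem sum_U_smul_Y (H : T.Regular) (t s : ι) :
    ∑ b, T.Y b s • T.U t b = ∑ a, T.Y t a • T.u s a := by
  have h1 : T.p • ∑ b, T.Y b s • T.U t b = T.p • ∑ a, T.Y t a • T.u s a := by
    calc _ = ∑ b, T.Y b s • ∑ e, (T.Y * T.G) t e • T.U e b := by
          simp_rw [H.Y_mul_G, Matrix.smul_apply, Matrix.one_apply, smul_eq_mul, mul_ite, ite_smul]
          simp [smul_sum, smul_smul, mul_comm]
      _ = ∑ b, ∑ a, (T.Y b s * T.Y t a) • ∑ e, T.G a e • T.U e b := by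
          simp_rw [Matrix.mul_apply, sum_smul, smul_sum, smul_smul]
          refine sum_congr rfl fun b _ => ?_
          rw [sum_comm]
          simp_rw [mul_assoc]
      _ = ∑ a, T.Y t a • ∑ d, (T.G * T.Y) d s • T.u d a := by
          simp_rw [← sum_G_u, Matrix.mul_apply, sum_smul, smul_sum, smul_smul]
          rw [sum_comm]
          refine sum_congr rfl fun b _ => ?_
          rw [sum_comm]
          refine sum_congr rfl fun b _ => sum_congr rfl fun b _ => ?_
          congr 1
          ring
      _ = _ := by
          simp_rw [T.G_mul_Y H.unit, Matrix.smul_apply, Matrix.one_apply, smul_eq_mul, mul_ite,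
            ite_smul]
          simp [smul_sum, smul_smul, mul_comm]
  exact smul_right_injective _ H.p_ne h1

theorem sum_u_Y_u (H : T.Regular) (d p : ι) :
    ∑ a, ∑ q, T.Y a q • (T.u d a * T.u p q) = T.Y d p • (1 : Matrix ι ι K) := by
  calc _ = ∑ a, T.u d a * ∑ q, T.Y a q • T.u p q := by simp_rw [mul_sum, mul_smul_comm]
    _ = ∑ b, T.Y b p • ∑ a, T.u d a * T.U a b := by
        simp_rw [← H.sum_U_smul_Y, mul_sum, mul_smul_comm, smul_sum]
        rw [sum_comm]
    _ = _ := by simp_rw [T.huU]; simp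

theorem twist (H : T.Regular) (p s : ι) :
    ∑ q, ∑ r, T.sig q r • (T.U r s * T.u p q) = T.sig p s • (1 : Matrix ι ι K) := by
  have h1 : T.p • ∑ q, ∑ r, T.sig q r • (T.U r s * T.u p q)
      = T.p • (T.sig p s • (1 : Matrix ι ι K)) := by
    calc _ = ∑ q, ∑ r, (T.p • T.sig) q r • (T.U r s * T.u p q) := by
          simp_rw [smul_sum, smul_smul, Matrix.smul_apply, smul_eq_mul]
      _ = ∑ q, ∑ a, (T.Y a q • ∑ r, T.G a r • T.U r s) * T.u p q := by
          simp_rw [H.p_smul_sig, Matrix.mul_apply, transpose_apply, sum_smul, smul_sum, sum_mul,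
            smul_smul, smul_mul_assoc]
          refine sum_congr rfl fun b _ => ?_
          rw [sum_comm]
      _ = ∑ d, T.G d s • ∑ a, ∑ q, T.Y a q • (T.u d a * T.u p q) := by
          simp_rw [← sum_G_u, smul_sum, sum_mul, smul_smul, smul_mul_assoc]
          rw [sum_rot, sum_rot]
          refine sum_congr rfl fun b _ => ?_
          rw [sum_comm]
          simp_rw [mul_comm]
      _ = _ := by
          simp_rw [H.sum_u_Y_u, smul_smul, ← sum_smul, ← smul_eq_mul (T.p), ← Matrix.smul_apply,
            H.p_smul_sig, Matrix.mul_apply, transpose_apply, mul_comm]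
  exact smul_right_injective _ H.p_ne h1

end Regular
end PreSys
end Leg

namespace Leg

open Matrix Finset
open scoped TensorProduct

set_option linter.unusedSectionVars false

theorem sum_rot4 {ι M : Type*} [Fintype ι] [AddCommMonoid M] (f : ι → ι → ι → ι → M) :
    ∑ a, ∑ b, ∑ c, ∑ d, f a b c d = ∑ b, ∑ c, ∑ d, ∑ a, f a b c d := by
  rw [sum_comm]
  exact sum_congr rfl fun b _ => sum_rot _

namespace PreSys

variable {ι K : Type*} [Fintype ι] [DecidableEq ι] [Field K] {T : PreSys ι K}

theorem φ_s_h (T : PreSys ι K) (n : ι) :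
    ∑ x, ∑ i, (∑ a, T.φ a * T.s x a i) * T.h x n i = T.ε n * ∑ i, T.φ i * T.β i := by
  have := congrArg (fun M : Matrix ι ι K => ∑ a, ∑ b, T.φ a * M a b * T.β b) (T.s_mul_u n)
  calc _ = ∑ a, ∑ b, T.φ a * (∑ d, T.s d * T.u d n) a b * T.β b := by
        simp_rw [h, Matrix.sum_apply, Matrix.mul_apply, sum_mul_sum, mul_sum, sum_mul]
        rw [sum_swap_pairs]
        refine sum_congr rfl fun b _ => sum_congr rfl fun b _ => sum_congr rfl fun b _ =>
          sum_congr rfl fun b _ => ?_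
        ring
    _ = _ := by
        refine this.trans ?_
        simp [Matrix.one_apply, mul_sum, mul_assoc, mul_left_comm]

theorem sum_A_G_h (T : PreSys ι K) (n : ι) :
    ∑ x, ∑ y, T.A y x * ∑ i, T.G y i * T.h x n i = T.ε n * ∑ i, T.φ i * T.β i := by
  rw [← φ_s_h]
  refine sum_congr rfl fun x _ => ?_
  simp_rw [s_eq, G, of_apply, Matrix.sum_apply, Matrix.smul_apply, smul_eq_mul, mul_sum, sum_mul,
    mul_sum]
  conv_rhs => rw [sum_comm, sum_rot, sum_comm]
  refine sum_congr rfl fun b _ => sum_congr rfl fun b _ => sum_congr rfl fun b _ => ?_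
  ring

namespace Regular

theorem sum_sig_h (H : T.Regular) (m : ι) :
    T.p * ∑ i, ∑ j, T.sig j i * T.h i j m = (∑ i, T.φ i * T.β i) * T.α m := by
  have hs : (T.p * T.p) • T.sig = (T.p) • (T.dual.G * T.Aᵀ * T.G) := by
    calc _ = (T.p • T.A) * (T.p • T.A) := by simp [sig, smul_smul]
      _ = T.dual.G * (T.G * T.dual.G) * T.G := by rw [H.p_smul_A]; simp only [mul_assoc]
      _ = _ := by rw [← H.p_smul_At]; simp
  have hs' : T.p • T.sig = T.dual.G * T.Aᵀ * T.G := by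
    rw [← smul_smul] at hs
    exact smul_right_injective _ H.p_ne hs
  calc _ = ∑ i, ∑ j, (T.p • T.sig) j i * T.h i j m := by
        simp_rw [mul_sum, Matrix.smul_apply, smul_eq_mul, mul_assoc]
    _ = ∑ n, T.dual.G m n * ∑ x, ∑ y, T.A y x * ∑ i, T.G y i * T.h x n i := by
        calc _ = ∑ i, ∑ y, ∑ x, ∑ k, (T.α k * T.A y x * T.G y i) *
                ∑ j, T.h x k j * T.h i j m := by
              simp_rw [hs', Matrix.mul_apply, dual_G_apply, transpose_apply, mul_sum, sum_mul]
              refine sum_congr rfl fun i _ => ?_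
              rw [sum_rot4]
              refine sum_congr rfl fun b _ => sum_congr rfl fun b _ => sum_congr rfl fun b _ =>
                sum_congr rfl fun b _ => ?_
              ring
          _ = _ := by
              simp_rw [sum_h_h, dual_G_apply, mul_sum, sum_mul]
              simp_rw [← sum_rot4 (fun n y x k => T.α k * T.A y x * T.G y _ * (_ * T.h n _ _))]
              rw [sum_comm]
              refine sum_congr rfl fun n _ => ?_
              rw [sum_rot, sum_comm]
              refine sum_congr rfl fun b _ => sum_congr rfl fun b _ => sum_congr rfl fun b _ =>
                sum_congr rfl fun b _ => ?_
              ring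
    _ = ∑ k, T.α k * ∑ n, T.ε n * T.h n k m * ∑ i, T.φ i * T.β i := by
        simp_rw [sum_A_G_h, dual_G_apply, sum_mul, mul_sum]
        rw [sum_comm]
        refine sum_congr rfl fun b _ => sum_congr rfl fun b _ => sum_congr rfl fun b _ => ?_
        ring
    _ = _ := by
        simp_rw [← sum_mul, H.unit.ε_h]
        simp [mul_comm]

/-- The Casimir element attached to the square of the antipode. -/
def cas (T : PreSys ι K) : Matrix ι ι K ⊗[K] Matrix ι ι K :=
  ∑ p, ∑ q, ∑ r, T.sig q r • (T.U r p ⊗ₜ[K] T.u p q)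

theorem p_smul_cas (H : T.Regular) :
    T.p • cas T = (∑ i, T.φ i * T.β i) • ∑ m, T.s m ⊗ₜ[K] ∑ k, T.α k • T.u m k := by
  calc _ = T.p • ∑ q, ∑ r, ∑ m, T.sig q r • (T.s m ⊗ₜ[K] ∑ p, T.h r p m • T.u p q) := by
        rw [cas, sum_rot]
        simp_rw [U_eq, TensorProduct.sum_tmul, TensorProduct.tmul_sum, TensorProduct.smul_tmul,
          smul_sum]
        refine sum_congr rfl fun q _ => sum_congr rfl fun r _ => ?_
        rw [sum_comm]
    _ = ∑ m, ∑ k, (T.p * ∑ r, ∑ q, T.sig q r * T.h r q k) • (T.s m ⊗ₜ[K] T.u m k) := by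
        simp_rw [T.sum_h_u, TensorProduct.tmul_sum, TensorProduct.tmul_smul, smul_sum, smul_smul,
          mul_sum, sum_smul]
        rw [sum_swap_pairs]
        refine sum_congr rfl fun q _ => sum_congr rfl fun r _ => ?_
        rw [sum_comm]
    _ = _ := by
        simp_rw [H.sum_sig_h, TensorProduct.tmul_sum, TensorProduct.tmul_smul, smul_sum, smul_smul]

theorem smul_cas (H : T.Regular) (c : ι) :
    ∑ x, (T.s x ⊗ₜ[K] (1 : Matrix ι ι K)) * cas T * ((1 : Matrix ι ι K) ⊗ₜ[K] T.u x c)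
      = T.ε c • cas T := by
  have h1 : ∀ a, T.ε c • ∑ k, T.α k • T.u a k
      = ∑ k, ∑ x, T.l k a x • ((∑ j, T.α j • T.u k j) * T.u x c) := by
    intro a
    calc _ = ∑ j, T.α j • ∑ x, T.l j x c • T.u a x := by
          simp_rw [smul_sum, smul_smul]
          rw [sum_comm]
          simp_rw [← sum_smul, H.α_l, mul_comm]
      _ = _ := by
          simp_rw [← T.mul_l, sum_mul, smul_sum, smul_mul_assoc]
          rw [sum_rot]
          refine sum_congr rfl fun _ _ => sum_congr rfl fun _ _ => sum_congr rfl fun _ _ => ?_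
          rw [smul_comm]
  refine smul_right_injective _ H.p_ne ?_
  simp only
  calc _ = ∑ x, (T.s x ⊗ₜ[K] (1 : Matrix ι ι K)) * (T.p • cas T) *
        ((1 : Matrix ι ι K) ⊗ₜ[K] T.u x c) := by
        simp_rw [smul_sum, mul_smul_comm, smul_mul_assoc]
    _ = (∑ i, T.φ i * T.β i) • ∑ m, T.s m ⊗ₜ[K] (T.ε c • ∑ k, T.α k • T.u m k) := by
        simp_rw [h1, H.p_smul_cas, mul_smul_comm, smul_mul_assoc, ← smul_sum, mul_sum, sum_mul,
          Algebra.TensorProduct.tmul_mul_tmul, one_mul, mul_one, s_mul_s, TensorProduct.tmul_sum,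
          TensorProduct.sum_tmul, TensorProduct.tmul_smul, ← TensorProduct.smul_tmul']
        congr 1
        simp_rw [sum_mul]
        conv_rhs => rw [sum_rot, sum_comm]
    _ = _ := by
        rw [smul_comm T.p, H.p_smul_cas, smul_comm (T.ε c), smul_sum (r := T.ε c)]
        simp_rw [← TensorProduct.tmul_smul]

theorem u_tmul_cas (H : T.Regular) (b a : ι) :
    (T.u b a ⊗ₜ[K] (1 : Matrix ι ι K)) * cas T
      = cas T * ((1 : Matrix ι ι K) ⊗ₜ[K] T.u b a) := by
  have h1 : ∀ d, ∑ k, (T.U d k ⊗ₜ[K] (1 : Matrix ι ι K)) * cas T *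
      ((1 : Matrix ι ι K) ⊗ₜ[K] T.u k a) = if d = a then cas T else 0 := by
    intro d
    calc _ = ∑ k, ∑ x, (T.s x ⊗ₜ[K] (1 : Matrix ι ι K)) * cas T *
          ((1 : Matrix ι ι K) ⊗ₜ[K] (T.h d k x • T.u k a)) := by
          simp_rw [U_eq, TensorProduct.sum_tmul, sum_mul, ← TensorProduct.smul_tmul',
            TensorProduct.tmul_smul, mul_smul_comm, smul_mul_assoc]
      _ = ∑ x, ∑ c, T.h d a c • ((T.s x ⊗ₜ[K] (1 : Matrix ι ι K)) * cas T *
          ((1 : Matrix ι ι K) ⊗ₜ[K] T.u x c)) := by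
          rw [sum_comm]
          simp_rw [← mul_sum, ← TensorProduct.tmul_sum, sum_h_u, TensorProduct.tmul_sum, mul_sum,
            TensorProduct.tmul_smul, mul_smul_comm]
      _ = _ := by
          rw [sum_comm]
          simp_rw [← smul_sum, H.smul_cas, smul_smul, ← sum_smul, mul_comm (T.h _ _ _), T.ε_h]
          simp
  calc _ = ∑ d, (T.u b d ⊗ₜ[K] (1 : Matrix ι ι K)) * if d = a then cas T else 0 := by simp
    _ = ∑ k, ((∑ d, T.u b d * T.U d k) ⊗ₜ[K] (1 : Matrix ι ι K)) * cas T *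
          ((1 : Matrix ι ι K) ⊗ₜ[K] T.u k a) := by
        simp_rw [← h1, mul_sum, TensorProduct.sum_tmul, sum_mul]
        rw [sum_comm]
        simp_rw [← mul_assoc, Algebra.TensorProduct.tmul_mul_tmul, one_mul]
    _ = _ := by
        simp_rw [T.huU]
        rw [sum_eq_single b]
        · simp [← Algebra.TensorProduct.one_def]
        · intro k _ hk
          simp [hk.symm]
        · simp

end Regular
end PreSys
end Leg

namespace Leg

open Matrix Finset

set_option linter.unusedSectionVars false

namespace PreSys

variable {ι K : Type*} [Fintype ι] [DecidableEq ι] [Field K] {T : PreSys ι K}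

/-- The matrix of traces of the blocks. -/
def tr (T : PreSys ι K) : Matrix ι ι K := of fun i j => (T.u i j).trace

theorem sum_u_mul_u_apply (T : PreSys ι K) (i j a b c d : ι) :
    ∑ k, T.u i k a c * T.u k j b d = ∑ x, ∑ y, T.u i j x y * (T.u a x * T.U y c) b d := by
  have key : ∑ k, T.u i k a c • T.u k j = ∑ x, ∑ y, T.u i j x y • (T.u a x * T.U y c) := by
    calc _ = ∑ k, ∑ x, T.u i k a x • (T.u k j * ∑ y, T.u x y * T.U y c) := by
          simp_rw [T.huU]; simp
      _ = ∑ y, (∑ k, ∑ x, T.u i k a x • (T.u k j * T.u x y)) * T.U y c := by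
          simp_rw [sum_mul, mul_sum, smul_sum, smul_mul_assoc, mul_assoc]
          rw [← sum_rot]
      _ = _ := by
          simp_rw [T.pent, sum_mul, smul_mul_assoc]
          rw [sum_comm]
  have := congrFun (congrFun key b) d
  simpa [Matrix.sum_apply] using this

theorem tr_mul_tr (T : PreSys ι K) : T.tr * T.tr = (Fintype.card ι : K) • T.tr := by
  ext i j
  calc _ = ∑ a, ∑ b, ∑ k, T.u i k a a * T.u k j b b := by
        simp_rw [Matrix.mul_apply, tr, of_apply, trace, Matrix.diag, sum_mul_sum]
        rw [sum_rot]
    _ = ∑ x, ∑ y, T.u i j x y * (∑ a, T.U y a * T.u a x).trace := by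
        simp_rw [sum_u_mul_u_apply]
        rw [sum_swap_pairs]
        simp_rw [trace_sum, trace_mul_comm (T.U _ _), mul_sum, trace, Matrix.diag, mul_sum]
    _ = _ := by
        have h : ∀ x y : ι, (if y = x then (1 : Matrix ι ι K) else 0).trace
            = if y = x then (Fintype.card ι : K) else 0 := by
          intro x y; split_ifs <;> simp
        simp_rw [T.hUu, h]
        simp [tr, trace, Matrix.diag, mul_comm, mul_sum]

namespace Regular

theorem sig_t_mul_G (H : T.Regular) : T.sigᵀ * T.G = T.Gᵀ := by
  refine smul_right_injective _ H.p_ne ?_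
  have := congrArg transpose H.p_smul_sig
  simp only [transpose_smul, transpose_mul, transpose_transpose] at this
  simp only
  rw [← smul_mul_assoc, this, mul_assoc, H.Y_mul_G, mul_smul_comm, mul_one]

theorem sum_sig_l_mul_sig (H : T.Regular) (a : ι) :
    (∑ c, T.sig c a • T.l c) * T.sig = T.sig * T.l a := by
  have h1 : (∑ c, T.sig c a • T.l c)ᵀ * T.G = of fun c d => ∑ y, T.G c y * T.l d y a := by
    ext c d
    simp_rw [Matrix.mul_apply, transpose_apply, Matrix.sum_apply, Matrix.smul_apply, of_apply,
      smul_eq_mul, sum_mul, mul_assoc]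
    rw [sum_comm]
    simp_rw [← mul_sum, G_assoc, mul_sum]
    rw [sum_comm]
    simp_rw [← mul_assoc, ← sum_mul]
    have h2 : ∀ y, ∑ x, T.sig x a * T.G x y = T.G y a := fun y =>
      congrFun (congrFun H.sig_t_mul_G a) y
    simp_rw [h2, ← G_assoc, mul_comm]
  apply transpose_injective
  apply H.G_cancel
  rw [transpose_mul, transpose_mul, mul_assoc, mul_assoc, H.sig_t_mul_G, h1]
  ext b d
  simp_rw [Matrix.mul_apply, transpose_apply, of_apply, mul_sum]
  rw [sum_comm]
  simp_rw [← mul_assoc, ← sum_mul]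
  have h2 : ∀ y, ∑ x, T.sig x b * T.G x y = T.G y b := fun y =>
    congrFun (congrFun H.sig_t_mul_G b) y
  simp_rw [h2, mul_comm (T.l a _ _), ← G_assoc, mul_comm]

theorem sum_sig_trace_l (H : T.Regular) (a : ι) :
    ∑ c, T.sig c a * (T.l c).trace = (T.l a).trace := by
  calc _ = (∑ c, T.sig c a • T.l c).trace := by simp [trace_sum, trace_smul]
    _ = ((∑ c, T.sig c a • T.l c) * T.sig * T.sig).trace := by
        rw [mul_assoc, H.sig_mul_sig, mul_one]
    _ = _ := by rw [H.sum_sig_l_mul_sig, trace_mul_cycle, H.sig_mul_sig, one_mul]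

theorem commute_sum_l (H : T.Regular) (v : ι → K) (hv : ∀ a, ∑ b, T.sig a b * v b = v a) :
    (∑ a, v a • T.l a) * T.sig = T.sig * ∑ a, v a • T.l a := by
  calc _ = (∑ a, v a • ∑ c, T.sig c a • T.l c) * T.sig := by
        simp_rw [smul_sum]
        rw [sum_comm]
        simp_rw [smul_smul, ← sum_smul, mul_comm (v _), hv]
    _ = _ := by simp_rw [sum_mul, smul_mul_assoc, H.sum_sig_l_mul_sig, mul_sum, mul_smul_comm]

theorem tr_mul_sig (H : T.Regular) : T.tr * T.sig = T.sig * T.tr := by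
  have h1 : T.trᵀ = ∑ m, (T.l m).trace • T.dual.l m := by
    ext j i
    simp_rw [transpose_apply, tr, of_apply, u_eq, trace_sum, trace_smul, Matrix.sum_apply,
      Matrix.smul_apply, dual_l, smul_eq_mul, mul_comm]
  have h2 := H.dual.commute_sum_l (fun m => (T.l m).trace) (by
    intro a
    simp_rw [dual_sig, transpose_apply]
    exact H.sum_sig_trace_l a)
  rw [← h1, dual_sig, ← transpose_mul, ← transpose_mul] at h2
  exact (transpose_injective h2).symm

theorem trace_tr_mul_sig (H : T.Regular) : (T.tr * T.sig).trace = T.sig.trace := by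
  refine mul_left_cancel₀ H.p_ne ?_
  rw [H.p_mul_trace_sig]
  calc _ = T.p * ∑ i, ∑ j, ∑ m, T.sig j i * T.h i j m * (T.l m).trace := by
        rw [trace]
        simp_rw [Matrix.diag, Matrix.mul_apply, tr, of_apply, u_eq, trace_sum, trace_smul,
          smul_eq_mul, sum_mul]
        refine congrArg _ (sum_congr rfl fun _ _ => sum_congr rfl fun _ _ => sum_congr rfl
          fun _ _ => ?_)
        ring
    _ = ∑ m, (T.p * ∑ i, ∑ j, T.sig j i * T.h i j m) * (T.l m).trace := by
        simp_rw [mul_sum, sum_mul]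
        rw [← sum_rot]
        simp_rw [mul_assoc]
    _ = (∑ i, T.φ i * T.β i) * ∑ x, ∑ m, T.α m * T.l m x x := by
        simp_rw [H.sum_sig_h, mul_assoc, ← mul_sum, trace, Matrix.diag, mul_sum]
        rw [sum_comm]
    _ = _ := by
        simp_rw [H.α_l]
        rw [mul_comm]
        simp_rw [mul_comm]

theorem sig_mulVec_β (H : T.Regular) : T.sig *ᵥ T.β = T.β := by
  have h1 : T.G *ᵥ T.β = T.φ := by
    ext a
    simp_rw [mulVec, dotProduct, G, of_apply, sum_mul]
    rw [sum_comm]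
    simp_rw [mul_assoc, ← mul_sum, H.unit _ _]
    simp
  have h2 : T.Gᵀ *ᵥ T.β = T.φ := by
    ext b
    have h3 : ∀ k, ∑ a, T.β a * T.l a k b = if k = b then 1 else 0 := by
      intro k
      have := congrFun (congrFun T.l_β k) b
      simpa [Matrix.sum_apply, Matrix.one_apply] using this
    simp_rw [mulVec, dotProduct, transpose_apply, G, of_apply, sum_mul]
    rw [sum_comm]
    simp_rw [mul_assoc, mul_comm _ (T.β _), ← mul_sum, h3]
    simp
  have h3 : T.p • (T.sig *ᵥ T.β) = T.p • T.β := by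
    rw [← smul_mulVec, H.p_smul_sig, ← mulVec_mulVec, h1, ← h2, mulVec_mulVec, ← transpose_mul,
      T.G_mul_Y H.unit, transpose_smul, transpose_one, smul_mulVec, one_mulVec]
  exact smul_right_injective _ H.p_ne h3

end Regular

theorem _root_.Leg.trace_of_isIdempotentElem {e : Matrix ι ι K} (he : IsIdempotentElem e) :
    ∃ d : ℕ, d ≤ Fintype.card ι ∧ e.trace = d ∧ (d = 0 → e = 0) := by
  have h : IsIdempotentElem (toLin' e) := by
    rw [IsIdempotentElem, Module.End.mul_eq_comp, ← toLin'_mul, he.eq]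
  refine ⟨Module.finrank K (LinearMap.range (toLin' e)), ?_, ?_, ?_⟩
  · simpa using Submodule.finrank_le (LinearMap.range (toLin' e))
  · rw [← trace_toLin'_eq, ((LinearMap.isProj_range_iff_isIdempotentElem _).mpr h).trace]
  · intro h0
    rw [Submodule.finrank_eq_zero, LinearMap.range_eq_bot] at h0
    exact toLin'.map_eq_zero_iff.mp h0

/-- The trace formula in characteristic zero. -/
theorem Regular.mul_eq_card_mul_of_charZero [CharZero K] (H : T.Regular) :
    (∑ i, T.ε i * T.α i) * ∑ i, T.φ i * T.β i = Fintype.card ι * T.p := by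
  have hβ : T.β ≠ 0 := by
    intro h
    have := T.hεβ
    simp [h] at this
  have hn : (Fintype.card ι : K) ≠ 0 := by
    rw [Nat.cast_ne_zero]
    intro h
    rw [Fintype.card_eq_zero_iff] at h
    exact hβ (Subsingleton.elim _ _)
  set n := Fintype.card ι with hn'
  have h2 : (2 : K) ≠ 0 := two_ne_zero
  set f : Matrix ι ι K := (2 : K)⁻¹ • (1 + T.sig) with hf
  set e : Matrix ι ι K := (n : K)⁻¹ • T.tr with he
  have hff : f * f = f := by
    rw [hf, smul_mul_smul_comm, add_mul, mul_add, mul_add, H.sig_mul_sig]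
    simp only [one_mul, mul_one]
    have : (1 : Matrix ι ι K) + T.sig + (T.sig + 1) = (2 : K) • (1 + T.sig) := by
      rw [two_smul]; abel
    rw [this, smul_smul]
    congr 1
    field_simp
  have hee : e * e = e := by
    rw [he, smul_mul_smul_comm, tr_mul_tr, ← hn', smul_smul]
    congr 1
    field_simp
  have hef : e * f = f * e := by
    rw [he, hf, smul_mul_smul_comm, smul_mul_smul_comm, mul_add, add_mul, mul_one, one_mul,
      H.tr_mul_sig, mul_comm (2 : K)⁻¹]
  have hefe : IsIdempotentElem (e * f) := by
    rw [IsIdempotentElem, mul_assoc, ← mul_assoc f, ← hef, mul_assoc e f f, hff, ← mul_assoc, hee]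
  have hsig : T.sig = (2 : K) • f - 1 := by
    rw [hf, smul_smul, mul_inv_cancel₀ h2, one_smul]; abel
  obtain ⟨d, hdn, hd, hd0⟩ := trace_of_isIdempotentElem (e := f) hff
  obtain ⟨a, -, ha, -⟩ := trace_of_isIdempotentElem (e := e) hee
  obtain ⟨b, -, hb, -⟩ := trace_of_isIdempotentElem hefe
  have h3 : T.sig.trace = 2 * d - n := by
    rw [hsig, trace_sub, trace_smul, hd, trace_one, smul_eq_mul]
  have h4 : T.sig.trace = n * (2 * b - a) := by
    rw [← hb, ← ha, ← smul_eq_mul 2, ← trace_smul, ← trace_sub, ← smul_eq_mul (n : K),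
      ← trace_smul]
    have : (n : K) • ((2 : K) • (e * f) - e) = T.tr * T.sig := by
      have hne : T.tr = (n : K) • e := by rw [he, smul_smul, mul_inv_cancel₀ hn, one_smul]
      clear_value e f
      rw [hsig, hne, mul_sub, mul_one, smul_mul_assoc, mul_smul_comm, smul_sub]
    rw [this, H.trace_tr_mul_sig]
  have h5 : T.sig.trace ≠ 0 := by
    intro h
    have := H.p_mul_trace_sig
    rw [h, mul_zero] at this
    exact mul_ne_zero H.εα_ne H.φβ_ne this.symm
  have hd1 : d ≠ 0 := by
    intro h
    have h6 := H.sig_mulVec_β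
    rw [hsig, hd0 h, smul_zero, zero_sub, neg_mulVec, one_mulVec] at h6
    apply hβ
    ext i
    have := congrFun h6 i
    simp only [Pi.neg_apply] at this
    have h7 : (2 : K) * T.β i = 0 := by linear_combination -this
    exact (mul_eq_zero.mp h7).resolve_left h2
  have h6 : (2 * d - n : ℤ) = n * (2 * b - a) := by
    have := h3.symm.trans h4
    exact_mod_cast this
  have h7 : (2 * d - n : ℤ) ≠ 0 := by
    intro h
    apply h5
    rw [h3]
    exact_mod_cast h
  have h8 : (2 * d - n : ℤ) = n := by
    generalize (2 * b - a : ℤ) = c at h6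
    have hn0 : (0 : ℤ) < n := by
      have : n ≠ 0 := by exact_mod_cast hn
      omega
    have hdn' : (d : ℤ) ≤ n := by exact_mod_cast hdn
    have hd' : (0 : ℤ) < d := by omega
    have hc1 : c ≤ 1 := by nlinarith
    have hc2 : -1 < c := by nlinarith
    have hc0 : c ≠ 0 := by rintro rfl; apply h7; rw [h6, mul_zero]
    have : c = 1 := by omega
    rw [h6, this, mul_one]
  have h9 : T.sig.trace = n := by
    rw [h3]; exact_mod_cast h8
  rw [← H.p_mul_trace_sig, h9, mul_comm]

end PreSys
end Leg

namespace Leg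

open Matrix

set_option linter.unusedSectionVars false

variable {ι S : Type*} [Fintype ι] [DecidableEq ι] [CommRing S]

theorem sum_fin_one (F : (Fin 1 → ι) → S) : ∑ a, F a = ∑ x, F ![x] := by
  refine (Fintype.sum_equiv (Equiv.funUnique (Fin 1) ι).symm _ _ fun x => ?_).symm
  congr 1; ext q; fin_cases q; rfl

theorem sum_fin_two (F : (Fin 2 → ι) → S) : ∑ a, F a = ∑ x, ∑ y, F ![x, y] := by
  rw [← Fintype.sum_prod_type', ← (finTwoArrowEquiv ι).symm.sum_comp]
  rfl

theorem vec_eta_two (s : Fin 2 → ι) : s = ![s 0, s 1] := by ext q; fin_cases q <;> rfl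

theorem vec_eta_three (s : Fin 3 → ι) : s = ![s 0, s 1, s 2] := by ext q; fin_cases q <;> rfl

theorem extend_eq {m n : ℕ} {f : Fin m → Fin n} (hf : Function.Injective f) (a : Fin m → ι)
    (s t : Fin n → ι) (h1 : t ∘ f = a) (h2 : ∀ q, q ∉ Set.range f → t q = s q) :
    Function.extend f a s = t := by
  ext q
  by_cases h : q ∈ Set.range f
  · obtain ⟨p, rfl⟩ := h
    rw [hf.extend_apply, ← h1]; rfl
  · rw [Function.extend_apply' _ _ _ h, h2 q h]

theorem leg01_mul (W : Matrix (Fin 2 → ι) (Fin 2 → ι) S) (Z : Matrix (Fin 3 → ι) (Fin 3 → ι) S)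
    (i a b : ι) (t : Fin 3 → ι) :
    (leg ![0, 1] W * Z : Matrix (Fin 3 → ι) (Fin 3 → ι) S)
      ![i, a, b] t = ∑ x, ∑ y, W ![i, a] ![x, y] * Z ![x, y, b] t := by
  rw [leg_mul_apply _ (by decide), sum_fin_two]
  refine Finset.sum_congr rfl fun x _ => Finset.sum_congr rfl fun y _ => ?_
  rw [extend_eq (by decide) _ _ ![x, y, b] (by ext q; fin_cases q <;> rfl)
    (by intro q; fin_cases q <;> simp)]
  congr 2; ext q; fin_cases q <;> rfl

theorem leg02_mul (W : Matrix (Fin 2 → ι) (Fin 2 → ι) S) (Z : Matrix (Fin 3 → ι) (Fin 3 → ι) S)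
    (i a b : ι) (t : Fin 3 → ι) :
    (leg ![0, 2] W * Z : Matrix (Fin 3 → ι) (Fin 3 → ι) S)
      ![i, a, b] t = ∑ x, ∑ y, W ![i, b] ![x, y] * Z ![x, a, y] t := by
  rw [leg_mul_apply _ (by decide), sum_fin_two]
  refine Finset.sum_congr rfl fun x _ => Finset.sum_congr rfl fun y _ => ?_
  rw [extend_eq (by decide) _ _ ![x, a, y] (by ext q; fin_cases q <;> rfl)
    (by intro q; fin_cases q <;> simp)]
  congr 2; ext q; fin_cases q <;> rfl

theorem leg12_mul (W : Matrix (Fin 2 → ι) (Fin 2 → ι) S) (Z : Matrix (Fin 3 → ι) (Fin 3 → ι) S)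
    (i a b : ι) (t : Fin 3 → ι) :
    (leg ![1, 2] W * Z : Matrix (Fin 3 → ι) (Fin 3 → ι) S)
      ![i, a, b] t = ∑ x, ∑ y, W ![a, b] ![x, y] * Z ![i, x, y] t := by
  rw [leg_mul_apply _ (by decide), sum_fin_two]
  refine Finset.sum_congr rfl fun x _ => Finset.sum_congr rfl fun y _ => ?_
  rw [extend_eq (by decide) _ _ ![i, x, y] (by ext q; fin_cases q <;> rfl)
    (by intro q; fin_cases q <;> simp)]
  congr 2; ext q; fin_cases q <;> rfl

theorem leg01_vec (W : Matrix (Fin 2 → ι) (Fin 2 → ι) S) (i a b j c d : ι) :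
    leg ![0, 1] W ![i, a, b] ![j, c, d] = if b = d then W ![i, a] ![j, c] else 0 := by
  rw [leg_apply]
  have h1 : (∀ q : Fin 3, q ∉ Set.range ![(0 : Fin 3), 1] → ![i, a, b] q = ![j, c, d] q) ↔ b = d := by
    simp [Fin.forall_fin_succ]
  simp only [h1]
  congr 2 <;> ext q <;> fin_cases q <;> rfl

theorem leg12_vec (W : Matrix (Fin 2 → ι) (Fin 2 → ι) S) (i a b j c d : ι) :
    leg ![1, 2] W ![i, a, b] ![j, c, d] = if i = j then W ![a, b] ![c, d] else 0 := by
  rw [leg_apply]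
  have h1 : (∀ q : Fin 3, q ∉ Set.range ![(1 : Fin 3), 2] → ![i, a, b] q = ![j, c, d] q) ↔ i = j := by
    simp [Fin.forall_fin_succ]
  simp only [h1]
  congr 2 <;> ext q <;> fin_cases q <;> rfl

theorem at1_zero_mul (X : Matrix (Fin 1 → ι) (Fin 1 → ι) S) (Z : Matrix (Fin 2 → ι) (Fin 2 → ι) S)
    (i a : ι) (t : Fin 2 → ι) :
    (at1 0 X * Z : Matrix (Fin 2 → ι) (Fin 2 → ι) S) ![i, a] t = ∑ x, X ![i] ![x] * Z ![x, a] t := by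
  rw [at1, leg_mul_apply _ inj0, sum_fin_one]
  refine Finset.sum_congr rfl fun x _ => ?_
  rw [extend_eq inj0 _ _ ![x, a] (by ext q; fin_cases q; rfl)
    (by intro q; fin_cases q <;> simp)]
  congr 2; ext q; fin_cases q; rfl

theorem mul_at1_zero (X : Matrix (Fin 1 → ι) (Fin 1 → ι) S) (Z : Matrix (Fin 2 → ι) (Fin 2 → ι) S)
    (i a : ι) (t : Fin 2 → ι) :
    (Z * at1 0 X : Matrix (Fin 2 → ι) (Fin 2 → ι) S) t ![i, a] = ∑ x, Z t ![x, a] * X ![x] ![i] := by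
  rw [at1, mul_leg_apply _ inj0, sum_fin_one]
  refine Finset.sum_congr rfl fun x _ => ?_
  rw [extend_eq inj0 _ _ ![x, a] (by ext q; fin_cases q; rfl)
    (by intro q; fin_cases q <;> simp)]
  congr 2; ext q; fin_cases q; rfl

theorem at1_zero_vec (X : Matrix (Fin 1 → ι) (Fin 1 → ι) S) (i a j b : ι) :
    (at1 0 X : Matrix (Fin 2 → ι) (Fin 2 → ι) S) ![i, a] ![j, b]
      = if a = b then X ![i] ![j] else 0 := by
  rw [at1, leg_apply]
  have h1 : (∀ q : Fin 2, q ∉ Set.range (fun _ : Fin 1 => (0 : Fin 2)) → ![i, a] q = ![j, b] q)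
      ↔ a = b := by
    simp [Fin.forall_fin_succ]
  simp only [h1]
  congr 2 <;> ext q <;> fin_cases q <;> rfl

theorem at1_one_vec (X : Matrix (Fin 1 → ι) (Fin 1 → ι) S) (i a j b : ι) :
    (at1 1 X : Matrix (Fin 2 → ι) (Fin 2 → ι) S) ![i, a] ![j, b]
      = if i = j then X ![a] ![b] else 0 := by
  rw [at1, leg_apply]
  have h1 : (∀ q : Fin 2, q ∉ Set.range (fun _ : Fin 1 => (1 : Fin 2)) → ![i, a] q = ![j, b] q)
      ↔ i = j := by
    simp [Fin.forall_fin_succ]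
  simp only [h1]
  congr 2 <;> ext q <;> fin_cases q <;> rfl

theorem ext_two {X Y : Matrix (Fin 2 → ι) (Fin 2 → ι) S}
    (h : ∀ i a j b, X ![i, a] ![j, b] = Y ![i, a] ![j, b]) : X = Y := by
  ext s t; rw [vec_eta_two s, vec_eta_two t, h]

theorem ext_three {X Y : Matrix (Fin 3 → ι) (Fin 3 → ι) S}
    (h : ∀ i a c j b d, X ![i, a, c] ![j, b, d] = Y ![i, a, c] ![j, b, d]) : X = Y := by
  ext s t; rw [vec_eta_three s, vec_eta_three t, h]

/-- The blocks of a matrix acting on two legs. -/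
def blk (W : Matrix (Fin 2 → ι) (Fin 2 → ι) S) (i j : ι) : Matrix ι ι S :=
  of fun a b => W ![i, a] ![j, b]

/-- The matrix acting on two legs with given blocks. -/
def ofBlk (u : ι → ι → Matrix ι ι S) : Matrix (Fin 2 → ι) (Fin 2 → ι) S :=
  of fun s t => u (s 0) (t 0) (s 1) (t 1)

theorem mul_eq_one_iff_blk (W V : Matrix (Fin 2 → ι) (Fin 2 → ι) S) :
    W * V = 1 ↔ ∀ i j, ∑ k, blk W i k * blk V k j = if i = j then 1 else 0 := by
  have e : ∀ i a j b, (W * V) ![i, a] ![j, b] = (∑ k, blk W i k * blk V k j) a b := by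
    intro i a j b
    simp [Matrix.mul_apply, Matrix.sum_apply, sum_fin_two, blk]
  have e1 : ∀ i a j b, (1 : Matrix (Fin 2 → ι) (Fin 2 → ι) S) ![i, a] ![j, b]
      = (if i = j then (1 : Matrix ι ι S) else 0) a b := by
    intro i a j b
    by_cases h : i = j <;> simp [Matrix.one_apply, h]
  constructor
  · intro h i j
    ext a b
    rw [← e, h, e1]
  · intro h
    refine ext_two fun i a j b => ?_
    rw [e, h, e1]

theorem defect_eq_zero_iff_blk (W : Matrix (Fin 2 → ι) (Fin 2 → ι) S) :
    defect W = 0 ↔ ∀ i j a c, ∑ k, ∑ x, blk W i k a x • (blk W k j * blk W x c)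
      = ∑ x, blk W i j x c • blk W a x := by
  have e1 : ∀ i a b j c d, (leg ![0, 1] W * leg ![0, 2] W * leg ![1, 2] W :
      Matrix (Fin 3 → ι) (Fin 3 → ι) S) ![i, a, b] ![j, c, d]
      = (∑ k, ∑ x, blk W i k a x • (blk W k j * blk W x c)) b d := by
    intro i a b j c d
    rw [mul_assoc, leg01_mul]
    simp_rw [leg02_mul, leg12_vec]
    simp [Matrix.sum_apply, blk, Matrix.mul_apply]
  have e2 : ∀ i a b j c d, (leg ![1, 2] W * leg ![0, 1] W :
      Matrix (Fin 3 → ι) (Fin 3 → ι) S) ![i, a, b] ![j, c, d]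
      = (∑ x, blk W i j x c • blk W a x) b d := by
    intro i a b j c d
    rw [leg12_mul]
    simp_rw [leg01_vec]
    simp [Matrix.sum_apply, blk, mul_comm]
  rw [defect, sub_eq_zero]
  constructor
  · intro h i j a c
    ext b d
    rw [← e1, h, e2]
  · intro h
    refine ext_three fun i a b j c d => ?_
    rw [e1, e2, h]

end Leg

namespace Leg

open Matrix
open scoped TensorProduct

set_option linter.unusedSectionVars false

section

variable {ι S : Type*} [Fintype ι] [DecidableEq ι] [CommRing S]

/-- Matrices acting on a single leg. -/
def on1 : Matrix ι ι S ≃ₐ[S] Matrix (Fin 1 → ι) (Fin 1 → ι) S :=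
  reindexAlgEquiv S S (Equiv.funUnique (Fin 1) ι).symm

theorem on1_vec (X : Matrix ι ι S) (i j : ι) : on1 X ![i] ![j] = X i j := rfl

theorem trace_on1 (X : Matrix ι ι S) : (on1 X).trace = X.trace := by
  rw [trace, sum_fin_one]; rfl

theorem at1_mul_at1_vec (X Y : Matrix ι ι S) (i a j b : ι) :
    (at1 0 (on1 X) * at1 1 (on1 Y) : Matrix (Fin 2 → ι) (Fin 2 → ι) S) ![i, a] ![j, b]
      = X i j * Y a b := by
  rw [at1_zero_mul]
  simp [at1_one_vec, on1_vec]

/-- A vector fixed by `W` on the first leg. -/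
def FixR (W : Matrix (Fin 2 → ι) (Fin 2 → ι) S) (β : ι → S) : Prop :=
  ∀ i a b, ∑ k, W ![i, a] ![k, b] * β k = if a = b then β i else 0

/-- A covector fixed by `W` on the first leg. -/
def FixL (W : Matrix (Fin 2 → ι) (Fin 2 → ι) S) (φ : ι → S) : Prop :=
  ∀ j a b, ∑ i, φ i * W ![i, a] ![j, b] = if a = b then φ j else 0

/-- The rank one projection on a fixed vector. -/
def fixData {W V : Matrix (Fin 2 → ι) (Fin 2 → ι) S} (hWV : W * V = 1) (hVW : V * W = 1)
    (pent : defect W = 0) {β φ : ι → S} (hβ : FixR W β) (hφ : FixL W φ) (c : S)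
    (hc : c * ∑ i, φ i * β i = 1) : FixData W V where
  hWV := hWV
  hVW := hVW
  pent := pent
  k := on1 (c • vecMulVec β φ)
  hk2 := by
    rw [← map_mul, smul_mul_smul_comm, vecMulVec_mul_vecMulVec, dotProduct]
    congr 1
    ext i j
    simp only [Matrix.smul_apply, vecMulVec_apply, smul_eq_mul, Pi.smul_apply]
    linear_combination (c * β i * φ j) * hc
  trk := by
    rw [trace_on1, trace_smul, trace_vecMulVec, dotProduct, smul_eq_mul, ← hc]
    simp_rw [mul_comm]
  hWk := by
    refine ext_two fun i a j b => ?_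
    rw [mul_at1_zero, at1_zero_vec]
    simp only [on1_vec, Matrix.smul_apply, vecMulVec_apply, smul_eq_mul]
    have := hβ i a b
    calc _ = (∑ k, W ![i, a] ![k, b] * β k) * (c * φ j) := by
          rw [Finset.sum_mul]; exact Finset.sum_congr rfl fun _ _ => by ring
      _ = _ := by rw [this]; split_ifs <;> ring
  hkW := by
    refine ext_two fun i a j b => ?_
    rw [at1_zero_mul, at1_zero_vec]
    simp only [on1_vec, Matrix.smul_apply, vecMulVec_apply, smul_eq_mul]
    have := hφ j a b
    calc _ = (c * β i) * (∑ k, φ k * W ![k, a] ![j, b]) := by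
          rw [Finset.mul_sum]; exact Finset.sum_congr rfl fun _ _ => by ring
      _ = _ := by rw [this]; split_ifs <;> ring

namespace PreSys

/-- The invertible solution of the pentagon equation. -/
def W (T : PreSys ι S) : Matrix (Fin 2 → ι) (Fin 2 → ι) S := ofBlk T.u

/-- The inverse of the solution of the pentagon equation. -/
def V (T : PreSys ι S) : Matrix (Fin 2 → ι) (Fin 2 → ι) S := ofBlk T.U

variable (T : PreSys ι S)

theorem W_mul_V : T.W * T.V = 1 := (mul_eq_one_iff_blk _ _).2 T.huU

theorem V_mul_W : T.V * T.W = 1 := (mul_eq_one_iff_blk _ _).2 T.hUu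

theorem defect_W : defect T.W = 0 := (defect_eq_zero_iff_blk _).2 T.pent

theorem fixR_β : FixR T.W T.β := by
  intro i a b
  have := congrFun (congrFun (T.hβ i) a) b
  simp only [Matrix.sum_apply, Matrix.smul_apply, smul_eq_mul, Matrix.one_apply, mul_ite,
    mul_one, mul_zero] at this
  rw [← this]
  exact Finset.sum_congr rfl fun _ _ => mul_comm _ _

theorem fixL_φ : FixL T.W T.φ := by
  intro i a b
  have := congrFun (congrFun (T.hφ i) a) b
  simp only [Matrix.sum_apply, Matrix.smul_apply, smul_eq_mul, Matrix.one_apply, mul_ite,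
    mul_one, mul_zero] at this
  rw [← this]
  rfl

end PreSys

end

variable {ι : Type} {K : Type*} [Fintype ι] [DecidableEq ι] [Field K] {T : PreSys ι K}

theorem single_mul_mul_single' (X : Matrix ι ι K) (p q r s : ι) :
    single p q 1 * X * single r s 1 = single p s (X q r) := by
  simp

/-- The exactness data of a regular system. -/
noncomputable def PreSys.Regular.exactData (H : T.Regular) : ExactData T.W T.V where
  toFixData := fixData T.W_mul_V T.V_mul_W T.defect_W T.fixR_β T.fixL_φ _
    (inv_mul_cancel₀ H.φβ_ne)
  κ := ι × ι
  B x := on1 (single x.1 x.2 1)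
  L x := on1 (T.u x.1 x.2)
  L' x := on1 (T.U x.1 x.2)
  σ := on1 T.sig
  hW := by
    refine ext_two fun i a j b => ?_
    simp_rw [Matrix.sum_apply, at1_mul_at1_vec, Fintype.sum_prod_type, single_apply]
    simp [ite_and, PreSys.W, ofBlk]
  hV := by
    refine ext_two fun i a j b => ?_
    simp_rw [Matrix.sum_apply, at1_mul_at1_vec, Fintype.sum_prod_type, single_apply]
    simp [ite_and, PreSys.V, ofBlk]
  trσ := by
    rw [trace_on1]
    intro h
    have := H.p_mul_trace_sig
    rw [h, mul_zero] at this
    exact mul_ne_zero H.εα_ne H.φβ_ne this.symm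
  twist := by
    refine ext_two fun p a s b => ?_
    rw [at1_zero_vec]
    simp_rw [Matrix.sum_apply, ← map_mul, at1_mul_at1_vec, Fintype.sum_prod_type,
      single_mul_mul_single', single_apply, on1_vec]
    have := congrFun (congrFun (H.twist p s) a) b
    simp only [Matrix.sum_apply, Matrix.smul_apply, smul_eq_mul, Matrix.one_apply, mul_ite,
      mul_one, mul_zero] at this
    rw [← this]
    simp [ite_and]
  casimir := by
    rintro ⟨b, a⟩
    have key := congrArg (Algebra.TensorProduct.map (on1 (ι := ι) (S := K)).toAlgHom
      (on1 (ι := ι) (S := K)).toAlgHom) (H.u_tmul_cas b a)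
    simp only [PreSys.Regular.cas, Finset.mul_sum, Finset.sum_mul, map_sum, mul_smul_comm,
      smul_mul_assoc, map_smul, Algebra.TensorProduct.tmul_mul_tmul, one_mul, mul_one,
      Algebra.TensorProduct.map_tmul] at key
    have tr : ∀ p q r s : ι, (on1 (single p q 1) * on1 T.sig * on1 (single r s 1)).trace
        = if p = s then T.sig q r else 0 := by
      intro p q r s
      rw [← map_mul, ← map_mul, single_mul_mul_single', trace_on1]
      split_ifs with h
      · rw [h, trace_single_eq_same]
      · exact trace_single_eq_of_ne _ _ _ h
    simp_rw [Fintype.sum_prod_type, tr, ← map_mul]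
    simpa [ite_smul] using key

end Leg

namespace Leg

open Matrix

set_option linter.unusedSectionVars false

/-- `O` behaves like a complete discrete valuation ring with uniformiser `p` and residue map
`π`. -/
structure IsLift {O K : Type*} [CommRing O] [Field K] (p : O) (π : O →+* K) : Prop where
  ne_zero : p ≠ 0
  ker : ∀ x, π x = 0 → p ∣ x
  map_p : π p = 0
  surj : Function.Surjective π
  unit : ∀ x, π x ≠ 0 → IsUnit x
  complete : ∀ a : ℕ → O, (∀ n, p ^ (n + 1) ∣ a (n + 1) - a n) → ∃ L, ∀ n, p ^ (n + 1) ∣ L - a n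
  sep : ∀ x, (∀ n : ℕ, p ^ (n + 1) ∣ x) → x = 0

section expansion

variable {ι S : Type*} [Fintype ι] [DecidableEq ι] [CommRing S]

theorem defect_sub_smul (W Z : Matrix (Fin 2 → ι) (Fin 2 → ι) S) (c : S) :
    ∃ T, defect (W - c • Z) = defect W - c • dDefect W Z + (c * c) • T := by
  refine ⟨leg ![0, 1] Z * leg ![0, 2] Z * leg ![1, 2] W + leg ![0, 1] Z * leg ![0, 2] W *
    leg ![1, 2] Z + leg ![0, 1] W * leg ![0, 2] Z * leg ![1, 2] Z - leg ![1, 2] Z * leg ![0, 1] Z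
    - c • (leg ![0, 1] Z * leg ![0, 2] Z * leg ![1, 2] Z), ?_⟩
  simp only [defect, dDefect, leg_sub, leg_smul, mul_sub, sub_mul, smul_mul_assoc, mul_smul_comm,
    mul_assoc]
  module

theorem IsCocycle.of_smul [IsDomain S] {W : Matrix (Fin 2 → ι) (Fin 2 → ι) S}
    {D : Matrix (Fin 3 → ι) (Fin 3 → ι) S} {c : S} (hc : c ≠ 0) (h : IsCocycle W (c • D)) :
    IsCocycle W D := by
  unfold IsCocycle at h ⊢
  simp only [leg_smul, smul_mul_assoc, mul_smul_comm, ← smul_add] at h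
  exact smul_right_injective _ hc h

variable {S' : Type*} [CommRing S'] (π : S →+* S')

theorem map_smul_ringHom {κ : Type*} (c : S) (X : Matrix κ κ S) :
    (c • X).map π = π c • X.map π := by
  ext; simp

theorem defect_map (W : Matrix (Fin 2 → ι) (Fin 2 → ι) S) :
    (defect W).map π = defect (W.map π) := by
  simp only [defect, leg_map, Matrix.map_mul, Matrix.map_sub π (map_sub π)]

theorem dDefect_map (W Z : Matrix (Fin 2 → ι) (Fin 2 → ι) S) :
    (dDefect W Z).map π = dDefect (W.map π) (Z.map π) := by
  simp only [dDefect, leg_map, Matrix.map_mul, Matrix.map_sub π (map_sub π),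
    Matrix.map_add π (map_add π)]

theorem IsCocycle.map {W : Matrix (Fin 2 → ι) (Fin 2 → ι) S}
    {D : Matrix (Fin 3 → ι) (Fin 3 → ι) S} (h : IsCocycle W D) :
    IsCocycle (W.map π) (D.map π) := by
  have := congrArg (fun X => X.map π) h
  simp only [Matrix.map_mul, Matrix.map_add π (map_add π), ← leg_map] at this
  exact this

end expansion

namespace IsLift

variable {O K : Type*} [CommRing O] [IsDomain O] [Field K] {p : O} {π : O →+* K}
  (h : IsLift p π)

theorem exists_map_eq (h : IsLift p π) {κ : Type*} (X : Matrix κ κ K) :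
    ∃ Y : Matrix κ κ O, Y.map π = X := by
  choose f hf using h.surj
  exact ⟨X.map f, by ext; simp [hf]⟩

theorem exists_smul_eq (h : IsLift p π) {κ : Type*} (X : Matrix κ κ O) (hX : X.map π = 0) :
    ∃ Y, X = p • Y := by
  have : ∀ i j, ∃ y, X i j = p * y := fun i j => h.ker _ (by
    simpa using congrFun (congrFun hX i) j)
  choose Y hY using this
  exact ⟨of Y, by ext i j; simp [hY]⟩

theorem eq_zero_of_smul (h : IsLift p π) {κ : Type*} (X : Matrix κ κ O)
    (hX : ∀ n : ℕ, ∃ Y, X = p ^ (n + 1) • Y) : X = 0 := by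
  ext i j
  refine h.sep _ fun n => ?_
  obtain ⟨Y, hY⟩ := hX n
  exact ⟨Y i j, by rw [hY]; simp⟩

theorem exists_limit (h : IsLift p π) {κ : Type*} (P : ℕ → Matrix κ κ O → Prop)
    (X₀ : Matrix κ κ O) (h0 : P 0 X₀)
    (step : ∀ n X, P n X → ∃ Z, P (n + 1) (X - p ^ (n + 1) • Z)) :
    ∃ L, ∀ n, ∃ X Z, P n X ∧ L = X - p ^ (n + 1) • Z := by
  choose! f hf using step
  let a : ℕ → Matrix κ κ O := fun n => Nat.rec X₀ (fun n X => X - p ^ (n + 1) • f n X) n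
  have ha : ∀ n, P n (a n) := by
    intro n
    induction n with
    | zero => exact h0
    | succ n ih => exact hf n _ ih
  have hs : ∀ n, a (n + 1) = a n - p ^ (n + 1) • f n (a n) := fun n => rfl
  have : ∀ i j, ∃ L, ∀ n, ∃ z, L - a n i j = p ^ (n + 1) * z := fun i j =>
    h.complete (fun n => a n i j) fun n => ⟨-f n (a n) i j, by simp [hs]⟩
  choose L hL using this
  choose z hz using hL
  refine ⟨of L, fun n => ⟨a n, of fun i j => -z i j n, ha n, ?_⟩⟩
  ext i j
  have := hz i j n
  simp only [of_apply, Matrix.sub_apply, Matrix.smul_apply, smul_eq_mul]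
  linear_combination this

end IsLift

end Leg

namespace Leg

open Matrix

set_option linter.unusedSectionVars false

namespace IsLift

variable {O K : Type*} [CommRing O] [IsDomain O] [Field K] {p : O} {π : O →+* K}

theorem map_pow_smul (h : IsLift p π) {κ : Type*} (n : ℕ) (X : Matrix κ κ O) :
    (p ^ (n + 1) • X).map π = 0 := by
  rw [map_smul_ringHom, map_pow, h.map_p, zero_pow n.succ_ne_zero, zero_smul]

theorem map_sub_pow_smul (h : IsLift p π) {κ : Type*} (n : ℕ) (X Z : Matrix κ κ O) :
    (X - p ^ (n + 1) • Z).map π = X.map π := by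
  rw [Matrix.map_sub π (map_sub π), h.map_pow_smul, sub_zero]

variable {ι : Type*} [Fintype ι] [DecidableEq ι]

theorem pentagon_step (h : IsLift p π) {W₀ V₀ : Matrix (Fin 2 → ι) (Fin 2 → ι) K}
    (H : ExactData W₀ V₀) (n : ℕ) (W : Matrix (Fin 2 → ι) (Fin 2 → ι) O) (hW : W.map π = W₀)
    (D : Matrix (Fin 3 → ι) (Fin 3 → ι) O) (hD : defect W = p ^ (n + 1) • D) :
    ∃ Z D', defect (W - p ^ (n + 1) • Z) = p ^ (n + 2) • D' := by
  have hc : p ^ (n + 1) ≠ 0 := pow_ne_zero _ h.ne_zero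
  have cocycle : ∀ (W : Matrix (Fin 2 → ι) (Fin 2 → ι) O) (_ : W.map π = W₀)
      (D : Matrix (Fin 3 → ι) (Fin 3 → ι) O) (_ : defect W = p ^ (n + 1) • D),
      IsCocycle W₀ (D.map π) := by
    intro W hW D hD
    rw [← hW]
    refine IsCocycle.map π (IsCocycle.of_smul hc ?_)
    rw [← hD]
    exact isCocycle_defect W
  have improve : ∀ (W : Matrix (Fin 2 → ι) (Fin 2 → ι) O) (_ : W.map π = W₀)
      (D : Matrix (Fin 3 → ι) (Fin 3 → ι) O) (_ : defect W = p ^ (n + 1) • D)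
      (Z : Matrix (Fin 2 → ι) (Fin 2 → ι) K),
      ∃ Y D', defect (W - p ^ (n + 1) • Y) = p ^ (n + 1) • D'
        ∧ D'.map π = D.map π - dDefect W₀ Z := by
    intro W hW D hD Z
    obtain ⟨Y, rfl⟩ := h.exists_map_eq Z
    obtain ⟨T, hT⟩ := defect_sub_smul W Y (p ^ (n + 1))
    refine ⟨Y, D - dDefect W Y + p ^ (n + 1) • T, ?_, ?_⟩
    · rw [hT, hD, smul_add, smul_sub, smul_smul]
    · rw [Matrix.map_add π (map_add π), h.map_pow_smul, add_zero, Matrix.map_sub π (map_sub π),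
        dDefect_map, hW]
  obtain ⟨Z, X, hZ, hX⟩ := H.exists_dDefect_add _ (cocycle W hW D hD)
  obtain ⟨Y, D₁, hD₁, hD₁'⟩ := improve W hW D hD Z
  have hW₁ := (h.map_sub_pow_smul n W Y).trans hW
  have hc₁ := cocycle _ hW₁ D₁ hD₁
  rw [hD₁', hZ] at hc₁
  obtain ⟨Z', hZ'⟩ := H.exists_eq_dDefect X hc₁ hX
  obtain ⟨Y', D₂, hD₂, hD₂'⟩ := improve _ hW₁ D₁ hD₁ Z'
  rw [hD₁', hZ, hZ', sub_self] at hD₂'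
  obtain ⟨D₃, rfl⟩ := h.exists_smul_eq _ hD₂'
  refine ⟨Y + Y', D₃, ?_⟩
  rw [smul_add, ← sub_sub, hD₂, smul_smul, ← pow_succ]

theorem exists_pentagon (h : IsLift p π) {W₀ V₀ : Matrix (Fin 2 → ι) (Fin 2 → ι) K}
    (H : ExactData W₀ V₀) :
    ∃ W : Matrix (Fin 2 → ι) (Fin 2 → ι) O, W.map π = W₀ ∧ defect W = 0 := by
  obtain ⟨W, hW⟩ := h.exists_map_eq W₀
  obtain ⟨L, hL⟩ := h.exists_limit
    (fun n W => W.map π = W₀ ∧ ∃ D, defect W = p ^ (n + 1) • D) W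
    ⟨hW, by
      have : (defect W).map π = 0 := by rw [defect_map, hW, H.pent]
      simpa using h.exists_smul_eq _ this⟩
    (by
      rintro n W ⟨hW, D, hD⟩
      obtain ⟨Z, D', hD'⟩ := h.pentagon_step H n W hW D hD
      exact ⟨Z, (h.map_sub_pow_smul n W Z).trans hW, D', hD'⟩)
  refine ⟨L, ?_, ?_⟩
  · obtain ⟨X, Z, ⟨hX, -⟩, rfl⟩ := hL 0
    exact (h.map_sub_pow_smul 0 X Z).trans hX
  · refine h.eq_zero_of_smul _ fun n => ?_
    obtain ⟨X, Z, ⟨-, D, hD⟩, rfl⟩ := hL n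
    obtain ⟨T, hT⟩ := defect_sub_smul X Z (p ^ (n + 1))
    exact ⟨D - dDefect X Z + p ^ (n + 1) • T, by rw [hT, hD, smul_add, smul_sub, smul_smul]⟩

theorem exists_inverse (h : IsLift p π) {κ : Type*} [Fintype κ] [DecidableEq κ]
    (X : Matrix κ κ O) (Y : Matrix κ κ K) (hXY : X.map π * Y = 1) :
    ∃ Z, X * Z = 1 ∧ Z * X = 1 ∧ Z.map π = Y := by
  have hdet : IsUnit X.det := by
    refine h.unit _ fun h0 => ?_
    rw [RingHom.map_det, RingHom.mapMatrix_apply] at h0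
    have := congrArg det hXY
    rw [det_mul, h0, zero_mul, det_one] at this
    exact zero_ne_one this
  refine ⟨X⁻¹, X.mul_nonsing_inv hdet, X.nonsing_inv_mul hdet, ?_⟩
  have : X⁻¹.map π * X.map π = 1 := by
    rw [← Matrix.map_mul, X.nonsing_inv_mul hdet, Matrix.map_one π (map_zero π) (map_one π)]
  calc X⁻¹.map π = X⁻¹.map π * (X.map π * Y) := by rw [hXY, mul_one]
    _ = Y := by rw [← mul_assoc, this, one_mul]

theorem exists_fixed (h : IsLift p π) {W₀ V₀ : Matrix (Fin 2 → ι) (Fin 2 → ι) K}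
    (H : FixData W₀ V₀) {W : Matrix (Fin 2 → ι) (Fin 2 → ι) O} (hW : W.map π = W₀)
    (pent : defect W = 0) :
    ∃ e : Matrix (Fin 1 → ι) (Fin 1 → ι) O, e.map π = H.k ∧ W * at1 0 e = at1 0 e := by
  obtain ⟨e, he⟩ := h.exists_map_eq H.k
  have key : ∀ e : Matrix (Fin 1 → ι) (Fin 1 → ι) O,
      (leg ![0, 1] (W * at1 0 e - at1 0 e) * leg ![1, 2] W
        + leg ![0, 1] W * leg ![0, 2] (W * at1 0 e - at1 0 e) * leg ![1, 2] W :
      Matrix (Fin 3 → ι) (Fin 3 → ι) O) = leg ![1, 2] W * leg ![0, 1] (W * at1 0 e - at1 0 e) := by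
    intro e
    have e1 : (leg ![0, 1] (at1 0 e) : Matrix (Fin 3 → ι) (Fin 3 → ι) O) = at1 0 e := by
      rw [at1, leg_leg _ (by decide)]; congr 1
    have e2 : (leg ![0, 2] (at1 0 e) : Matrix (Fin 3 → ι) (Fin 3 → ι) O) = at1 0 e := by
      rw [at1, leg_leg _ (by decide)]; congr 1
    have p' : (leg ![0, 1] W * leg ![0, 2] W * leg ![1, 2] W : Matrix (Fin 3 → ι) (Fin 3 → ι) O)
        = leg ![1, 2] W * leg ![0, 1] W := sub_eq_zero.1 pent
    have cm : (at1 0 e * leg ![1, 2] W : Matrix (Fin 3 → ι) (Fin 3 → ι) O)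
        = leg ![1, 2] W * at1 0 e := leg_comm _ _ inj0 (by decide) _ _
    simp only [leg_sub, leg_mul _ (show Function.Injective ![(0 : Fin 3), 1] by decide),
      leg_mul _ (show Function.Injective ![(0 : Fin 3), 2] by decide), e1, e2]
    generalize (leg ![0, 1] W : Matrix (Fin 3 → ι) (Fin 3 → ι) O) = w01 at *
    generalize (leg ![0, 2] W : Matrix (Fin 3 → ι) (Fin 3 → ι) O) = w02 at *
    generalize (leg ![1, 2] W : Matrix (Fin 3 → ι) (Fin 3 → ι) O) = w12 at *
    generalize (at1 0 e : Matrix (Fin 3 → ι) (Fin 3 → ι) O) = E at *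
    calc _ = w01 * w02 * (E * w12) - E * w12 := by noncomm_ring
      _ = w01 * w02 * w12 * E - w12 * E := by rw [cm]; noncomm_ring
      _ = _ := by rw [p']; noncomm_ring
  obtain ⟨L, hL⟩ := h.exists_limit
    (fun n e => e.map π = H.k ∧ ∃ y : Matrix (Fin 2 → ι) (Fin 2 → ι) O,
      W * at1 0 e - at1 0 e = p ^ (n + 1) • y) e
    ⟨he, by
      have : (W * at1 0 e - at1 0 e : Matrix (Fin 2 → ι) (Fin 2 → ι) O).map π = 0 := by
        rw [Matrix.map_sub π (map_sub π), Matrix.map_mul, ← leg_map, he, hW, H.hWk, sub_self]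
      simpa using h.exists_smul_eq _ this⟩
    (by
      rintro n e ⟨he, y, hy⟩
      have hk := key e
      simp only [hy, leg_smul, smul_mul_assoc, mul_smul_comm, ← smul_add] at hk
      replace hk := congrArg (fun X => X.map π)
        (smul_right_injective _ (pow_ne_zero (n + 1) h.ne_zero) hk)
      simp only [Matrix.map_mul, Matrix.map_add π (map_add π), ← leg_map, hW] at hk
      obtain ⟨η, hη⟩ := H.exists_fixed_defect _ hk
      obtain ⟨η', rfl⟩ := h.exists_map_eq η
      refine ⟨η', (h.map_sub_pow_smul n e η').trans he, ?_⟩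
      have : (y - (W * at1 0 η' - at1 0 η')).map π = 0 := by
        simp only [Matrix.map_sub π (map_sub π), Matrix.map_mul, ← leg_map, hW, hη, sub_self]
      obtain ⟨y', hy'⟩ := h.exists_smul_eq _ this
      refine ⟨y', ?_⟩
      rw [pow_succ _ (n + 1), mul_smul (p ^ (n + 1)) p, ← hy', smul_sub, ← hy]
      simp only [at1, leg_sub, leg_smul, mul_sub, mul_smul_comm, smul_sub]
      abel)
  refine ⟨L, ?_, ?_⟩
  · obtain ⟨X, Z, ⟨hX, -⟩, rfl⟩ := hL 0
    exact (h.map_sub_pow_smul 0 X Z).trans hX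
  · rw [← sub_eq_zero]
    refine h.eq_zero_of_smul _ fun n => ?_
    obtain ⟨X, Z, ⟨-, y, hy⟩, rfl⟩ := hL n
    refine ⟨y - (W * at1 0 Z - at1 0 Z), ?_⟩
    rw [smul_sub, ← hy]
    simp only [at1, leg_sub, leg_smul, mul_sub, mul_smul_comm, smul_sub]
    abel

end IsLift

end Leg

namespace Leg

open Matrix Finset

set_option linter.unusedSectionVars false

section

variable {ι S : Type*} [Fintype ι] [DecidableEq ι] [CommRing S]

theorem leg_transpose {m n : ℕ} (f : Fin m → Fin n) (X : Matrix (Fin m → ι) (Fin m → ι) S) :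
    leg f Xᵀ = (leg f X)ᵀ := by
  ext s t
  simp only [leg_apply, transpose_apply, eq_comm (a := t _)]
  split_ifs <;> rfl

/-- The pentagon matrix acting on the dual space. -/
noncomputable def dualMat (W : Matrix (Fin 2 → ι) (Fin 2 → ι) S) :
    Matrix (Fin 2 → ι) (Fin 2 → ι) S :=
  (leg ![1, 0] W)ᵀ

theorem dualMat_vec (W : Matrix (Fin 2 → ι) (Fin 2 → ι) S) (i a j b : ι) :
    dualMat W ![i, a] ![j, b] = W ![b, j] ![a, i] := by
  rw [dualMat, transpose_apply, leg_apply, if_pos]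
  · congr 1 <;> ext q <;> fin_cases q <;> rfl
  · intro q hq
    exfalso
    apply hq
    fin_cases q
    · exact ⟨1, rfl⟩
    · exact ⟨0, rfl⟩

theorem dualMat_mul (W V : Matrix (Fin 2 → ι) (Fin 2 → ι) S) :
    dualMat W * dualMat V = dualMat (V * W) := by
  rw [dualMat, dualMat, dualMat, ← transpose_mul, leg_mul _ (by decide)]

theorem dualMat_one : dualMat (1 : Matrix (Fin 2 → ι) (Fin 2 → ι) S) = 1 := by
  rw [dualMat, leg_one, transpose_one]

theorem leg_dualMat (W : Matrix (Fin 2 → ι) (Fin 2 → ι) S) {n : ℕ} {i j : Fin n}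
    (h : Function.Injective ![i, j]) : leg ![i, j] (dualMat W) = (leg ![j, i] W)ᵀ := by
  rw [dualMat, leg_transpose, leg_leg _ h]
  congr 2
  ext q; fin_cases q <;> rfl

theorem defect_dualMat {W : Matrix (Fin 2 → ι) (Fin 2 → ι) S} (h : defect W = 0) :
    defect (dualMat W) = 0 := by
  have h1 := congrArg (leg (![2, 1, 0] : Fin 3 → Fin 3)) h
  have e1 : ![(2 : Fin 3), 1, 0] ∘ ![0, 1] = ![2, 1] := by ext q; fin_cases q <;> rfl
  have e2 : ![(2 : Fin 3), 1, 0] ∘ ![0, 2] = ![2, 0] := by ext q; fin_cases q <;> rfl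
  have e3 : ![(2 : Fin 3), 1, 0] ∘ ![1, 2] = ![1, 0] := by ext q; fin_cases q <;> rfl
  have hi : Function.Injective ![(2 : Fin 3), 1, 0] := by decide
  rw [defect, leg_sub, leg_mul _ hi, leg_mul _ hi, leg_mul _ hi, leg_leg _ hi, leg_leg _ hi,
    leg_leg _ hi, e1, e2, e3, leg_zero, sub_eq_zero] at h1
  rw [defect, leg_dualMat _ (by decide), leg_dualMat _ (by decide), leg_dualMat _ (by decide),
    ← transpose_mul, ← transpose_mul, ← transpose_mul, ← mul_assoc, h1, sub_self]

theorem defect_transpose_inv {W V : Matrix (Fin 2 → ι) (Fin 2 → ι) S} (hWV : W * V = 1)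
    (hVW : V * W = 1) (h : defect W = 0) : defect Vᵀ = 0 := by
  have l1 : ∀ f : Fin 2 → Fin 3, Function.Injective f → leg f W * leg f V = 1 := fun f hf => by
    rw [← leg_mul _ hf, hWV, leg_one]
  have l2 : ∀ f : Fin 2 → Fin 3, Function.Injective f → leg f V * leg f W = 1 := fun f hf => by
    rw [← leg_mul _ hf, hVW, leg_one]
  rw [defect, sub_eq_zero] at h
  rw [defect]
  simp only [leg_transpose, ← transpose_mul]
  rw [sub_eq_zero, ← mul_assoc]
  congr 1
  have a1 := l1 ![0, 1] (by decide)
  have a2 := l1 ![0, 2] (by decide)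
  have a3 := l1 ![1, 2] (by decide)
  have b1 := l2 ![0, 1] (by decide)
  have b3 := l2 ![1, 2] (by decide)
  generalize (leg ![0, 1] W : Matrix (Fin 3 → ι) (Fin 3 → ι) S) = w01 at *
  generalize (leg ![0, 2] W : Matrix (Fin 3 → ι) (Fin 3 → ι) S) = w02 at *
  generalize (leg ![1, 2] W : Matrix (Fin 3 → ι) (Fin 3 → ι) S) = w12 at *
  generalize (leg ![0, 1] V : Matrix (Fin 3 → ι) (Fin 3 → ι) S) = v01 at *
  generalize (leg ![0, 2] V : Matrix (Fin 3 → ι) (Fin 3 → ι) S) = v02 at *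
  generalize (leg ![1, 2] V : Matrix (Fin 3 → ι) (Fin 3 → ι) S) = v12 at *
  calc v12 * v02 * v01 = v01 * v12 * (w12 * w01) * (v12 * v02 * v01) := by
        rw [mul_assoc v01, ← mul_assoc v12, b3, one_mul, b1, one_mul]
    _ = v01 * v12 * (w01 * (w02 * (w12 * v12) * v02) * v01) := by rw [← h]; noncomm_ring
    _ = v01 * v12 := by rw [a3, mul_one, a2, mul_one, a1, mul_one]

theorem FixL.inv {W V : Matrix (Fin 2 → ι) (Fin 2 → ι) S} (hWV : W * V = 1) {φ : ι → S}
    (h : FixL W φ) : FixL V φ := by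
  intro j a b
  calc ∑ i, φ i * V ![i, a] ![j, b] = ∑ i, ∑ c, (∑ k, φ k * W ![k, a] ![i, c]) * V ![i, c] ![j, b] := by
        unfold FixL at h
        simp_rw [h]
        simp
    _ = ∑ k, φ k * (W * V) ![k, a] ![j, b] := by
        simp_rw [Matrix.mul_apply, sum_fin_two, sum_mul, mul_sum, mul_assoc]
        rw [← sum_rot]
    _ = _ := by
        rw [hWV]
        by_cases h : a = b <;> simp [Matrix.one_apply, h]

theorem fixL_transpose {W : Matrix (Fin 2 → ι) (Fin 2 → ι) S} {φ : ι → S} :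
    FixL Wᵀ φ ↔ FixR W φ := by
  unfold FixL FixR
  simp only [transpose_apply, mul_comm (φ _)]
  constructor
  · intro h i a b; rw [h i b a]; simp [eq_comm]
  · intro h i a b; rw [h i b a]; simp [eq_comm]

theorem fixR_transpose {W : Matrix (Fin 2 → ι) (Fin 2 → ι) S} {φ : ι → S} :
    FixR Wᵀ φ ↔ FixL W φ := by
  rw [← fixL_transpose, transpose_transpose]

end

namespace IsLift

variable {O K : Type*} [CommRing O] [IsDomain O] [Field K] {p : O} {π : O →+* K}
  {ι : Type*} [Fintype ι] [DecidableEq ι]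

theorem exists_fixR (h : IsLift p π) {W V : Matrix (Fin 2 → ι) (Fin 2 → ι) O} (hWV : W * V = 1)
    (hVW : V * W = 1) (pent : defect W = 0) {β φ : ι → K} (hβ : FixR (W.map π) β)
    (hφ : FixL (W.map π) φ) (hne : ∑ i, φ i * β i ≠ 0) :
    ∃ β' : ι → O, FixR W β' ∧ ∀ i, π (β' i) = β i := by
  obtain ⟨e, he, hWe⟩ := h.exists_fixed
    (fixData (W := W.map π) (V := V.map π)
      (by rw [← Matrix.map_mul, hWV, Matrix.map_one π (map_zero π) (map_one π)])
      (by rw [← Matrix.map_mul, hVW, Matrix.map_one π (map_zero π) (map_one π)])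
      (by rw [← defect_map, pent, Matrix.map_zero π (map_zero π)])
      hβ hφ _ (inv_mul_cancel₀ hne)) rfl pent
  choose g hg using h.surj
  refine ⟨fun i => ∑ k, e ![i] ![k] * g (β k), ?_, ?_⟩
  · intro i a b
    calc _ = ∑ x, (W * at1 0 e : Matrix (Fin 2 → ι) (Fin 2 → ι) O) ![i, a] ![x, b] * g (β x) := by
          simp_rw [mul_at1_zero, sum_mul, mul_sum]
          rw [sum_comm]
          simp_rw [mul_assoc]
      _ = _ := by
          rw [hWe]
          simp_rw [at1_zero_vec]
          split_ifs <;> simp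
  · intro i
    have he' : ∀ k, π (e ![i] ![k]) = (∑ i, φ i * β i)⁻¹ * (β i * φ k) := fun k =>
      congrFun (congrFun he ![i]) ![k]
    simp_rw [map_sum, map_mul, he', hg]
    calc _ = (∑ i, φ i * β i)⁻¹ * (∑ k, φ k * β k) * β i := by
          simp_rw [mul_sum, sum_mul]
          exact sum_congr rfl fun _ _ => by ring
      _ = _ := by rw [inv_mul_cancel₀ hne, one_mul]

theorem exists_fix (h : IsLift p π) {W V : Matrix (Fin 2 → ι) (Fin 2 → ι) O} (hWV : W * V = 1)
    (hVW : V * W = 1) (pent : defect W = 0) {β φ : ι → K} (hβ : FixR (W.map π) β)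
    (hφ : FixL (W.map π) φ) (hne : ∑ i, φ i * β i ≠ 0) :
    ∃ β' φ' : ι → O, FixR W β' ∧ FixL W φ' ∧ (∀ i, π (β' i) = β i) ∧ ∀ i, π (φ' i) = φ i := by
  obtain ⟨β', h1, h2⟩ := h.exists_fixR hWV hVW pent hβ hφ hne
  have hWV' : W.map π * V.map π = 1 := by
    rw [← Matrix.map_mul, hWV, Matrix.map_one π (map_zero π) (map_one π)]
  have hVW' : V.map π * W.map π = 1 := by
    rw [← Matrix.map_mul, hVW, Matrix.map_one π (map_zero π) (map_one π)]
  obtain ⟨φ', h3, h4⟩ := h.exists_fixR (W := Vᵀ) (V := Wᵀ)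
    (by rw [← transpose_mul, hWV, transpose_one]) (by rw [← transpose_mul, hVW, transpose_one])
    (defect_transpose_inv hWV hVW pent) (β := φ) (φ := β)
    (by rw [transpose_map, fixR_transpose]; exact hφ.inv hWV')
    (by
      rw [transpose_map]
      refine FixL.inv (W := (W.map π)ᵀ) ?_ (fixL_transpose.2 hβ)
      rw [← transpose_mul, hVW', transpose_one])
    (by simpa only [mul_comm] using hne)
  exact ⟨β', φ', h1, (fixR_transpose.1 h3).inv hVW, h2, h4⟩

end IsLift

end Leg

namespace Leg

open Matrix Finset

set_option linter.unusedSectionVars false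

section

variable {ι S : Type*} [Fintype ι] [DecidableEq ι] [CommRing S]

theorem fixR_iff {W : Matrix (Fin 2 → ι) (Fin 2 → ι) S} {β : ι → S} :
    FixR W β ↔ ∀ i, ∑ j, β j • blk W i j = β i • (1 : Matrix ι ι S) := by
  have : ∀ i a b, (∑ j, β j • blk W i j) a b = ∑ k, W ![i, a] ![k, b] * β k := by
    intro i a b
    simp [Matrix.sum_apply, blk, mul_comm]
  constructor
  · intro h i
    ext a b
    rw [this, h i a b]
    simp [Matrix.one_apply]
  · intro h i a b
    rw [← this, h]
    simp [Matrix.one_apply]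

theorem fixL_iff {W : Matrix (Fin 2 → ι) (Fin 2 → ι) S} {φ : ι → S} :
    FixL W φ ↔ ∀ j, ∑ i, φ i • blk W i j = φ j • (1 : Matrix ι ι S) := by
  have : ∀ j a b, (∑ i, φ i • blk W i j) a b = ∑ i, φ i * W ![i, a] ![j, b] := by
    intro i a b
    simp [Matrix.sum_apply, blk]
  constructor
  · intro h i
    ext a b
    rw [this, h i a b]
    simp [Matrix.one_apply]
  · intro h i a b
    rw [← this, h]
    simp [Matrix.one_apply]

theorem fixR_dualMat_iff {W : Matrix (Fin 2 → ι) (Fin 2 → ι) S} {ε : ι → S} :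
    FixR (dualMat W) ε ↔ ∀ i j b, ∑ a, ε a * blk W i j a b = if i = j then ε b else 0 := by
  simp only [FixR, dualMat_vec, blk, of_apply]
  constructor
  · intro h i j b
    rw [show (if i = j then ε b else 0) = if j = i then ε b else 0 by simp only [eq_comm],
      ← h b j i]
    exact sum_congr rfl fun _ _ => mul_comm _ _
  · intro h i a b
    rw [show (if a = b then ε i else 0) = if b = a then ε i else 0 by simp only [eq_comm],
      ← h b a i]
    exact sum_congr rfl fun _ _ => mul_comm _ _

theorem fixL_dualMat_iff {W : Matrix (Fin 2 → ι) (Fin 2 → ι) S} {α : ι → S} :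
    FixL (dualMat W) α ↔ ∀ i j a, ∑ b, blk W i j a b * α b = if i = j then α a else 0 := by
  simp only [FixL, dualMat_vec, blk, of_apply]
  constructor
  · intro h i j a
    rw [show (if i = j then α a else 0) = if j = i then α a else 0 by simp only [eq_comm],
      ← h a j i]
    exact sum_congr rfl fun _ _ => mul_comm _ _
  · intro h j a b
    rw [show (if a = b then α j else 0) = if b = a then α j else 0 by simp only [eq_comm],
      ← h b a j]
    exact sum_congr rfl fun _ _ => mul_comm _ _

namespace PreSys

/-- A system assembled from matrices on two legs. -/
def ofMat {W V : Matrix (Fin 2 → ι) (Fin 2 → ι) S} (hWV : W * V = 1) (hVW : V * W = 1)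
    (pent : defect W = 0) {β φ ε α : ι → S} (hβ : FixR W β) (hφ : FixL W φ)
    (hε : FixR (dualMat W) ε) (hα : FixL (dualMat W) α) (hεβ : ∑ i, ε i * β i = 1) :
    PreSys ι S where
  u := blk W
  U := blk V
  huU := (mul_eq_one_iff_blk W V).1 hWV
  hUu := (mul_eq_one_iff_blk V W).1 hVW
  pent := (defect_eq_zero_iff_blk W).1 pent
  β := β
  α := α
  φ := φ
  ε := ε
  hβ := fixR_iff.1 hβ
  hφ := fixL_iff.1 hφ
  hα := fixL_dualMat_iff.1 hα
  hε := fixR_dualMat_iff.1 hε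
  hεβ := hεβ

theorem fixR_ε (T : PreSys ι S) : FixR (dualMat T.W) T.ε := fixR_dualMat_iff.2 T.hε

theorem fixL_α (T : PreSys ι S) : FixL (dualMat T.W) T.α := fixL_dualMat_iff.2 T.hα

/-- The matrix of right multiplication by the unit. -/
def r (T : PreSys ι S) : Matrix ι ι S := of fun a j => ∑ b, T.l j a b * T.β b

theorem r_mul_r (T : PreSys ι S) : T.r * T.r = T.r := by
  ext a j
  have key : ∀ j c, T.r.mulVec (fun x => T.l j x c) a = ∑ b, T.l j a b * T.r b c := by
    intro j c
    have := congrFun (congrFun (T.l_mul_l j c) a)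
    calc _ = ∑ b, (∑ x, T.l j x c • T.l x) a b * T.β b := by
          simp only [mulVec, dotProduct, r, of_apply, Matrix.sum_apply, Matrix.smul_apply,
            smul_eq_mul, sum_mul]
          rw [sum_comm]
          exact sum_congr rfl fun _ _ => sum_congr rfl fun _ _ => by ring
      _ = ∑ b, (T.l j * T.l c) a b * T.β b := by simp_rw [this]
      _ = _ := by
          simp only [Matrix.mul_apply, r, of_apply, sum_mul, mul_sum]
          rw [sum_comm]
          exact sum_congr rfl fun _ _ => sum_congr rfl fun _ _ => by ring
  have hrβ : ∀ b, ∑ c, T.r b c * T.β c = T.β b := by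
    intro b
    have := congrArg (fun X : Matrix ι ι S => ∑ d, X b d * T.β d) T.l_β
    simp only [Matrix.sum_apply, Matrix.smul_apply, smul_eq_mul, sum_mul, Matrix.one_apply,
      ite_mul, one_mul, zero_mul, sum_ite_eq, mem_univ, if_true] at this
    rw [← this, sum_comm]
    simp only [r, of_apply, sum_mul]
    exact sum_congr rfl fun _ _ => sum_congr rfl fun _ _ => by ring
  calc (T.r * T.r) a j = ∑ c, (T.r.mulVec (fun x => T.l j x c) a) * T.β c := by
        simp only [Matrix.mul_apply, mulVec, dotProduct, sum_mul]
        rw [sum_comm]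
        refine sum_congr rfl fun x _ => ?_
        simp only [r, of_apply, mul_sum, mul_assoc]
    _ = ∑ b, T.l j a b * ∑ c, T.r b c * T.β c := by
        simp_rw [key, sum_mul, mul_sum, mul_assoc]
        rw [sum_comm]
    _ = _ := by simp_rw [hrβ]; rfl

theorem rightUnit_iff {T : PreSys ι S} : T.RightUnit ↔ T.r = 1 := by
  constructor
  · intro h
    ext a j
    rw [Matrix.one_apply, ← h j a]
    rfl
  · intro h j a
    have := congrFun (congrFun h a) j
    rwa [Matrix.one_apply] at this

/-- Extension of scalars. -/
def map {S' : Type*} [CommRing S'] (T : PreSys ι S) (f : S →+* S') : PreSys ι S' where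
  u i j := (T.u i j).map f
  U i j := (T.U i j).map f
  huU i j := by
    have := congrArg f.mapMatrix (T.huU i j)
    simp only [map_sum, map_mul, RingHom.mapMatrix_apply] at this
    rw [this]
    split_ifs <;> ext <;> simp [Matrix.one_apply, apply_ite f]
  hUu i j := by
    have := congrArg f.mapMatrix (T.hUu i j)
    simp only [map_sum, map_mul, RingHom.mapMatrix_apply] at this
    rw [this]
    split_ifs <;> ext <;> simp [Matrix.one_apply, apply_ite f]
  pent i j a c := by
    ext x y
    have := congrArg f (congrFun (congrFun (T.pent i j a c) x) y)
    simpa [Matrix.sum_apply, Matrix.mul_apply] using this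
  β i := f (T.β i)
  α i := f (T.α i)
  φ i := f (T.φ i)
  ε i := f (T.ε i)
  hβ i := by
    ext x y
    have := congrArg f (congrFun (congrFun (T.hβ i) x) y)
    simpa [Matrix.sum_apply, Matrix.one_apply, apply_ite f] using this
  hφ i := by
    ext x y
    have := congrArg f (congrFun (congrFun (T.hφ i) x) y)
    simpa [Matrix.sum_apply, Matrix.one_apply, apply_ite f] using this
  hα i j a := by simpa [apply_ite f] using congrArg f (T.hα i j a)
  hε i j a := by simpa [apply_ite f] using congrArg f (T.hε i j a)
  hεβ := by simpa using congrArg f T.hεβ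

variable {S' : Type*} [CommRing S'] (T : PreSys ι S) (f : S →+* S')

theorem map_r : (T.map f).r = T.r.map f := by
  ext a j
  simp [r, l, map, Matrix.sum_apply]

theorem RightUnit.map {T : PreSys ι S} (h : T.RightUnit) : (T.map f).RightUnit := by
  rw [rightUnit_iff, map_r, rightUnit_iff.1 h, Matrix.map_one f (map_zero f) (map_one f)]

theorem map_p : (T.map f).p = f T.p := by simp [p, map]

theorem map_εα : ∑ i, (T.map f).ε i * (T.map f).α i = f (∑ i, T.ε i * T.α i) := by
  simp [map]

theorem map_φβ : ∑ i, (T.map f).φ i * (T.map f).β i = f (∑ i, T.φ i * T.β i) := by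
  simp [map]

theorem Regular.map {K K' : Type*} [Field K] [Field K'] {T : PreSys ι K} (H : T.Regular)
    (f : K →+* K') : (T.map f).Regular where
  unit := H.unit.map f
  p_ne := by rw [map_p]; exact (map_ne_zero f).2 H.p_ne
  εα_ne := by rw [map_εα]; exact (map_ne_zero f).2 H.εα_ne
  φβ_ne := by rw [map_φβ]; exact (map_ne_zero f).2 H.φβ_ne

end PreSys

end

end Leg

namespace Leg

open Matrix Finset

set_option linter.unusedSectionVars false

theorem map_dualMat {ι S S' : Type*} [Fintype ι] [DecidableEq ι] [CommRing S] [CommRing S']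
    (W : Matrix (Fin 2 → ι) (Fin 2 → ι) S) (f : S →+* S') :
    (dualMat W).map f = dualMat (W.map f) :=
  ext_two fun _ _ _ _ => by simp [dualMat_vec]

section

variable {ι : Type} [Fintype ι] [DecidableEq ι] {O K : Type*} [CommRing O] [IsDomain O]
  [Field K] {p : O} {π : O →+* K}

theorem IsLift.exists_preSys (h : IsLift p π) {T : PreSys ι K} (H : T.Regular) :
    ∃ T' : PreSys ι O, T'.RightUnit ∧ π (∑ i, T'.ε i * T'.α i) = ∑ i, T.ε i * T.α i ∧
      π (∑ i, T'.φ i * T'.β i) = ∑ i, T.φ i * T.β i ∧ π T'.p = T.p := by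
  obtain ⟨W, hW, pent⟩ := h.exists_pentagon H.exactData
  obtain ⟨V, hWV, hVW, hV⟩ := h.exists_inverse W T.V (by rw [hW, T.W_mul_V])
  obtain ⟨β, φ, hβ, hφ, hβ', hφ'⟩ := h.exists_fix hWV hVW pent
    (by rw [hW]; exact T.fixR_β) (by rw [hW]; exact T.fixL_φ) H.φβ_ne
  obtain ⟨ε, α, hε, hα, hε', hα'⟩ := h.exists_fix (W := dualMat W) (V := dualMat V)
    (by rw [dualMat_mul, hVW, dualMat_one]) (by rw [dualMat_mul, hWV, dualMat_one])
    (defect_dualMat pent) (by rw [map_dualMat, hW]; exact T.fixR_ε)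
    (by rw [map_dualMat, hW]; exact T.fixL_α) (by simpa only [mul_comm] using H.εα_ne)
  have hunit : π (∑ i, ε i * β i) = 1 := by simp [hε', hβ', T.hεβ]
  obtain ⟨c, hc⟩ := (h.unit (∑ i, ε i * β i) (by rw [hunit]; exact one_ne_zero)).exists_left_inv
  have hπc : π c = 1 := by
    have := congrArg π hc
    rwa [map_mul, hunit, mul_one, map_one] at this
  have hcε : FixR (dualMat W) (fun i => c * ε i) := by
    intro i a b
    calc _ = c * ∑ k, dualMat W ![i, a] ![k, b] * ε k := by
          rw [mul_sum]; exact sum_congr rfl fun _ _ => by ring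
      _ = _ := by rw [hε i a b]; split_ifs <;> simp
  let T' := PreSys.ofMat hWV hVW pent hβ hφ hcε hα
    (by rw [← hc, mul_sum]; exact sum_congr rfl fun _ _ => by ring)
  have hl : ∀ j, (T'.l j).map π = T.l j := by
    intro j
    ext a b
    simp only [PreSys.l, Matrix.map_apply, Matrix.sum_apply, Matrix.smul_apply, smul_eq_mul,
      map_sum, map_mul]
    refine sum_congr rfl fun i _ => ?_
    change π (c * ε i) * π (W ![i, a] ![j, b]) = _
    rw [map_mul, hπc, one_mul, hε']
    exact congrArg (T.ε i * ·) (congrFun (congrFun hW ![i, a]) ![j, b])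
  have hr : T'.r.map π = 1 := by
    rw [← PreSys.rightUnit_iff.1 H.unit]
    ext a j
    simp only [PreSys.r, Matrix.map_apply, of_apply, map_sum, map_mul, ← hl j]
    exact sum_congr rfl fun i _ => by rw [← hβ' i]; rfl
  obtain ⟨Z, hZ, -, -⟩ := h.exists_inverse T'.r 1 (by rw [hr, one_mul])
  refine ⟨T', PreSys.rightUnit_iff.2 ?_, ?_, ?_, ?_⟩
  · calc T'.r = T'.r * (T'.r * Z) := by rw [hZ, mul_one]
      _ = 1 := by rw [← mul_assoc, T'.r_mul_r, hZ]
  · change π (∑ i, c * ε i * α i) = _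
    simp [hπc, hε', hα']
  · change π (∑ i, φ i * β i) = _
    simp [hφ', hβ']
  · change π (∑ i, φ i * α i) = _
    simp [hφ', hα', PreSys.p]

theorem PreSys.Regular.mul_eq_card_mul_of_isLift [CharZero O] (h : IsLift p π)
    {T : PreSys ι K} (H : T.Regular) :
    (∑ i, T.ε i * T.α i) * ∑ i, T.φ i * T.β i = Fintype.card ι * T.p := by
  obtain ⟨T', hT', h1, h2, h3⟩ := h.exists_preSys H
  have hinj := IsFractionRing.injective O (FractionRing O)
  have ne : ∀ x : O, π x ≠ 0 → algebraMap O (FractionRing O) x ≠ 0 := by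
    intro x hx h0
    rw [map_eq_zero_iff _ hinj] at h0
    exact hx (by rw [h0, map_zero])
  have : CharZero (FractionRing O) := charZero_of_injective_algebraMap hinj
  have H' : (T'.map (algebraMap O (FractionRing O))).Regular :=
    { unit := hT'.map _
      p_ne := by rw [T'.map_p]; exact ne _ (by rw [h3]; exact H.p_ne)
      εα_ne := by rw [T'.map_εα]; exact ne _ (by rw [h1]; exact H.εα_ne)
      φβ_ne := by rw [T'.map_φβ]; exact ne _ (by rw [h2]; exact H.φβ_ne) }
  have key := H'.mul_eq_card_mul_of_charZero
  rw [T'.map_εα, T'.map_φβ, T'.map_p, ← map_mul, ← map_natCast (algebraMap O (FractionRing O)),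
    ← map_mul] at key
  have := congrArg π (hinj key)
  rwa [map_mul, map_mul, h1, h2, h3, map_natCast] at this

end

section

variable (q : ℕ) [Fact q.Prime] (k : Type*) [Field k] [CharP k q] [IsAlgClosed k]

theorem isLift_wittVector :
    IsLift (q : WittVector q k) (WittVector.constantCoeff : WittVector q k →+* k) where
  ne_zero := WittVector.p_nonzero q k
  ker x hx := by
    rw [← Ideal.mem_span_singleton, ← WittVector.ker_constantCoeff]
    exact hx
  map_p := by rw [map_natCast, CharP.cast_eq_zero]
  surj := WittVector.constantCoeff_surjective q
  unit x hx := WittVector.isUnit_of_coeff_zero_ne_zero x hx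
  complete a ha := by
    have hc : IsAdicComplete (Ideal.span {(q : WittVector q k)}) (WittVector q k) :=
      WittVector.isAdicCompleteIdealSpanP
    have hmono : ∀ m d, (q : WittVector q k) ^ m ∣ a m - a (m + d) := by
      intro m d
      induction d with
      | zero => simp
      | succ d ih =>
        rw [show a m - a (m + (d + 1)) = a m - a (m + d) - (a (m + d + 1) - a (m + d)) by
          rw [← add_assoc]; ring]
        exact dvd_sub ih ((pow_dvd_pow _ (by omega)).trans (ha (m + d)))
    obtain ⟨L, hL⟩ := hc.toIsPrecomplete.prec' a (by
      intro m n hmn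
      obtain ⟨d, rfl⟩ := Nat.exists_eq_add_of_le hmn
      rw [SModEq.sub_mem, Ideal.span_singleton_pow, smul_eq_mul, Ideal.mul_top,
        Ideal.mem_span_singleton]
      exact hmono m d)
    refine ⟨L, fun n => ?_⟩
    have := hL (n + 1)
    rw [SModEq.sub_mem, Ideal.span_singleton_pow, smul_eq_mul, Ideal.mul_top,
      Ideal.mem_span_singleton] at this
    rw [show L - a n = (a (n + 1) - a n) - (a (n + 1) - L) by ring]
    exact dvd_sub (ha n) this
  sep x hx := by
    have hc : IsAdicComplete (Ideal.span {(q : WittVector q k)}) (WittVector q k) :=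
      WittVector.isAdicCompleteIdealSpanP
    refine hc.toIsHausdorff.haus' x fun n => ?_
    rw [SModEq.sub_mem, Ideal.span_singleton_pow, smul_eq_mul, Ideal.mul_top,
      Ideal.mem_span_singleton, sub_zero]
    exact (pow_dvd_pow _ n.le_succ).trans (hx n)

theorem charZero_wittVector : CharZero (WittVector q k) := by
  refine charZero_of_inj_zero fun n hn => ?_
  by_contra h0
  obtain ⟨a, b, hb, rfl⟩ := Nat.exists_eq_pow_mul_and_not_dvd h0 q (Fact.out : q.Prime).ne_one
  rw [Nat.cast_mul, Nat.cast_pow] at hn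
  rcases mul_eq_zero.1 hn with h | h
  · exact WittVector.p_nonzero q k (eq_zero_of_pow_eq_zero h)
  · apply hb
    rw [← CharP.cast_eq_zero_iff k q, ← map_natCast (WittVector.constantCoeff (p := q) (R := k)),
      h, map_zero]

end

theorem PreSys.Regular.mul_eq_card_mul {ι : Type} [Fintype ι] [DecidableEq ι] {K : Type*}
    [Field K] {T : PreSys ι K} (H : T.Regular) :
    (∑ i, T.ε i * T.α i) * ∑ i, T.φ i * T.β i = Fintype.card ι * T.p := by
  obtain ⟨q, hq⟩ := CharP.exists K
  rcases CharP.char_is_prime_or_zero K q with hp | rfl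
  · have : Fact q.Prime := ⟨hp⟩
    have : CharP (AlgebraicClosure K) q := charP_of_injective_algebraMap
      (algebraMap K (AlgebraicClosure K)).injective q
    have := charZero_wittVector q (AlgebraicClosure K)
    have key := (H.map (algebraMap K (AlgebraicClosure K))).mul_eq_card_mul_of_isLift
      (isLift_wittVector q (AlgebraicClosure K))
    rw [T.map_εα, T.map_φβ, T.map_p, ← map_mul,
      ← map_natCast (algebraMap K (AlgebraicClosure K)), ← map_mul] at key
    exact (algebraMap K (AlgebraicClosure K)).injective key
  · have := CharP.charP_to_charZero K
    exact H.mul_eq_card_mul_of_charZero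

end Leg

namespace JonesTower

open Finset

set_option linter.unusedSectionVars false

variable (T : JonesTower k R)

theorem mem_A {a : R} : a ∈ T.A ↔ a ∈ T.M₁ ∧ ∀ n ∈ T.N, n * a = a * n := by
  rw [A, Algebra.mem_inf, Subalgebra.mem_centralizer_iff]; rfl

theorem mem_C {c : R} : c ∈ T.C ↔ ∀ n ∈ T.N, n * c = c * n := by
  rw [C, Subalgebra.mem_centralizer_iff]; rfl

variable {T}

theorem A_le_M₁ {a : R} (ha : a ∈ T.A) : a ∈ T.M₁ := (T.mem_A.1 ha).1

theorem A_comm {a n : R} (ha : a ∈ T.A) (hn : n ∈ T.N) : n * a = a * n :=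
  (T.mem_A.1 ha).2 n hn

theorem EM_left {m x : R} (hm : m ∈ T.M) (hx : x ∈ T.M₁) : T.EM (m * x) = m * T.EM x := by
  simpa using T.hEM_bimod m hm 1 T.M.one_mem x hx

theorem EM_right {m x : R} (hm : m ∈ T.M) (hx : x ∈ T.M₁) : T.EM (x * m) = T.EM x * m := by
  simpa using T.hEM_bimod 1 T.M.one_mem m hm x hx

theorem EM1_left {m x : R} (hm : m ∈ T.M₁) : T.EM1 (m * x) = m * T.EM1 x := by
  simpa using T.hEM1_bimod m hm 1 T.M₁.one_mem x

theorem EM1_right {m x : R} (hm : m ∈ T.M₁) : T.EM1 (x * m) = T.EM1 x * m := by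
  simpa using T.hEM1_bimod 1 T.M₁.one_mem m hm x

theorem EM1_self {m : R} (hm : m ∈ T.M₁) : T.EM1 m = m := by
  simpa [T.hEM1_one] using T.EM1_left (x := 1) hm

theorem EM_A {a : R} (ha : a ∈ T.A) : T.EM a = T.F a • (1 : R) := by
  rw [← Algebra.algebraMap_eq_smul_one, T.hF a fun n hn => (T.A_comm ha hn).symm,
    T.EM1_self (T.A_le_M₁ ha)]

theorem zb_mem (i : Fin T.r) : T.zb i ∈ T.A :=
  T.mem_A.2 ⟨T.hzbM₁ i, fun n hn => (T.hzbN i n hn).symm⟩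

theorem wb_mem (i : Fin T.r) : T.wb i ∈ T.A :=
  T.mem_A.2 ⟨T.hwbM₁ i, fun n hn => (T.hwbN i n hn).symm⟩

theorem e₁_mem : T.e₁ ∈ T.A := T.mem_A.2 ⟨T.he₁, fun n hn => (T.he₁N n hn).symm⟩

theorem e₁_mul_e₁ : T.e₁ * T.e₁ = T.e₁ := by
  simpa [T.hE_one] using T.he₁me₁ 1 T.M.one_mem

theorem smul_one_inj [Nontrivial R] {a b : k} (h : a • (1 : R) = b • 1) : a = b :=
  smul_left_injective k (one_ne_zero (α := R)) h

theorem F_wb_zb [Nontrivial R] (i j : Fin T.r) :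
    T.F (T.wb i * T.zb j) = if i = j then 1 else 0 := by
  apply smul_one_inj (R := R)
  rw [← T.EM_A (mul_mem (T.wb_mem i) (T.zb_mem j)), T.hzw_orth]
  split_ifs <;> simp

theorem sum_F_zb {a : R} (ha : a ∈ T.A) : ∑ i, T.F (T.wb i * a) • T.zb i = a := by
  conv_rhs => rw [← T.hzw_dual₂ a (T.A_le_M₁ ha)]
  refine sum_congr rfl fun i _ => ?_
  rw [T.EM_A (mul_mem (T.wb_mem i) ha), mul_smul_comm, mul_one]

theorem sum_F_wb {a : R} (ha : a ∈ T.A) : ∑ i, T.F (a * T.zb i) • T.wb i = a := by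
  conv_rhs => rw [← T.hzw_dual₁ a (T.A_le_M₁ ha)]
  refine sum_congr rfl fun i _ => ?_
  rw [T.EM_A (mul_mem ha (T.zb_mem i)), smul_mul_assoc, one_mul]

theorem F_e₁ [Nontrivial R] : T.F T.e₁ = T.lam := by
  apply smul_one_inj (R := R)
  rw [← T.EM_A T.e₁_mem, T.hEMe₁]

theorem F_one [Nontrivial R] : T.F 1 = 1 := by
  apply smul_one_inj (R := R)
  rw [← T.EM_A T.A.one_mem, T.hEM_one, one_smul]

theorem M₁_induction {P : R → Prop} (h : ∀ m ∈ T.M, ∀ m' ∈ T.M, P (m * T.e₁ * m'))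
    (zero : P 0) (add : ∀ x y, P x → P y → P (x + y)) (smul : ∀ (c : k) x, P x → P (c • x))
    {x : R} (hx : x ∈ T.M₁) : P x := by
  rw [← Subalgebra.mem_toSubmodule, T.hspanM₁] at hx
  refine Submodule.span_induction ?_ zero (fun x y _ _ => add x y) (fun c x _ => smul c x) hx
  rintro _ ⟨m, hm, m', hm', rfl⟩
  exact h m hm m' hm'

theorem ext_M₁ {y y' : R} (h : ∀ m ∈ T.M, y * m * T.e₁ = y' * m * T.e₁) : y = y' := by
  have : ∀ x ∈ T.M₁, y * x = y' * x := fun x hx => T.M₁_induction (P := fun x => y * x = y' * x)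
    (fun m hm m' _ => by rw [← mul_assoc, ← mul_assoc, h m hm, mul_assoc, mul_assoc, mul_assoc])
    (by rw [mul_zero, mul_zero]) (fun x y hx hy => by rw [mul_add, mul_add, hx, hy])
    (fun c x hx => by rw [mul_smul_comm, mul_smul_comm, hx]) hx
  simpa using this 1 T.M₁.one_mem

theorem EM_mul_e₁ {x : R} (hx : x ∈ T.M₁) : T.EM (x * T.e₁) * T.e₁ = T.lam • (x * T.e₁) := by
  refine T.M₁_induction (P := fun x => T.EM (x * T.e₁) * T.e₁ = T.lam • (x * T.e₁))
    ?_ (by simp) ?_ ?_ hx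
  · intro m hm m' hm'
    have hE : T.E m' ∈ T.M := T.hNM (T.hE_mem m' hm')
    rw [mul_assoc m, mul_assoc m, T.he₁me₁ m' hm', ← mul_assoc,
      T.EM_left (mul_mem hm hE) T.he₁, T.hEMe₁]
    simp
  · intro x y hx hy
    rw [add_mul, map_add, add_mul, hx, hy, smul_add]
  · intro c x hx
    rw [smul_mul_assoc, map_smul, smul_mul_assoc, hx, smul_comm]

variable (T)

/-- The action of the second centralizer on `M`. -/
noncomputable def act : R →ₗ[k] R →ₗ[k] R :=
  LinearMap.mk₂ k (fun a m => T.lam⁻¹ • T.EM (a * m * T.e₁))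
    (fun a b m => by rw [add_mul, add_mul, map_add, smul_add])
    (fun c a m => by rw [smul_mul_assoc, smul_mul_assoc, map_smul, smul_comm])
    (fun a m n => by rw [mul_add, add_mul, map_add, smul_add])
    (fun c a m => by rw [mul_smul_comm, smul_mul_assoc, map_smul, smul_comm])

theorem act_apply (a m : R) : T.act a m = T.lam⁻¹ • T.EM (a * m * T.e₁) := rfl

variable {T}

theorem act_mem {a m : R} (ha : a ∈ T.M₁) (hm : m ∈ T.M) : T.act a m ∈ T.M :=
  T.M.smul_mem (T.hEM_mem _ (mul_mem (mul_mem ha (T.hMM₁ hm)) T.he₁)) _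

theorem act_mul_e₁ {a m : R} (ha : a ∈ T.M₁) (hm : m ∈ T.M) :
    T.act a m * T.e₁ = a * m * T.e₁ := by
  rw [act_apply, smul_mul_assoc, T.EM_mul_e₁ (mul_mem ha (T.hMM₁ hm)), smul_smul,
    inv_mul_cancel₀ T.hlam, one_smul]

theorem eq_of_mul_e₁ {m m' : R} (hm : m ∈ T.M) (hm' : m' ∈ T.M) (h : m * T.e₁ = m' * T.e₁) :
    m = m' := by
  have := congrArg T.EM h
  rw [T.EM_left hm T.he₁, T.EM_left hm' T.he₁, T.hEMe₁, mul_smul_comm, mul_smul_comm, mul_one,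
    mul_one] at this
  exact smul_right_injective R T.hlam this

theorem act_one {m : R} (hm : m ∈ T.M) : T.act 1 m = m :=
  eq_of_mul_e₁ (T.act_mem T.M₁.one_mem hm) hm (by rw [T.act_mul_e₁ T.M₁.one_mem hm, one_mul])

theorem act_act {a m x m' : R} (ha : a ∈ T.M₁) (hm : m ∈ T.M) (hx : x ∈ T.M₁) (hm' : m' ∈ T.M) :
    T.act a (m * T.act x m') = T.act (a * m * x) m' := by
  have h1 := mul_mem hm (T.act_mem hx hm')
  refine eq_of_mul_e₁ (T.act_mem ha h1)
    (T.act_mem (mul_mem (mul_mem ha (T.hMM₁ hm)) hx) hm') ?_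
  rw [T.act_mul_e₁ ha h1, T.act_mul_e₁ (mul_mem (mul_mem ha (T.hMM₁ hm)) hx) hm', mul_assoc,
    mul_assoc m, T.act_mul_e₁ hx hm']
  simp only [mul_assoc]

theorem mul_act {m x m' : R} (hm : m ∈ T.M) (hx : x ∈ T.M₁) (hm' : m' ∈ T.M) :
    m * T.act x m' = T.act (m * x) m' := by
  have := T.act_act T.M₁.one_mem hm hx hm'
  rwa [one_mul, T.act_one (mul_mem hm (T.act_mem hx hm'))] at this

theorem eq_of_act {a b : R} (ha : a ∈ T.M₁) (hb : b ∈ T.M₁)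
    (h : ∀ m ∈ T.M, T.act a m = T.act b m) : a = b :=
  T.ext_M₁ fun m hm => by rw [← T.act_mul_e₁ ha hm, h m hm, T.act_mul_e₁ hb hm]

theorem exists_act_eq (f : R →ₗ[k] R) (hf : ∀ m ∈ T.M, f m ∈ T.M)
    (hl : ∀ n ∈ T.N, ∀ m ∈ T.M, f (n * m) = n * f m)
    (hr : ∀ n ∈ T.N, ∀ m ∈ T.M, f (m * n) = f m * n) :
    ∃ a ∈ T.A, ∀ m ∈ T.M, T.act a m = f m := by
  have hM₁ : ∑ j, f (T.xb j) * T.e₁ * T.yb j ∈ T.M₁ := sum_mem fun j _ =>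
    mul_mem (mul_mem (T.hMM₁ (hf _ (T.hxb j))) T.he₁) (T.hMM₁ (T.hyb j))
  have key : ∀ m ∈ T.M, (∑ j, f (T.xb j) * T.e₁ * T.yb j) * m * T.e₁ = f m * T.e₁ := by
    intro m hm
    conv_rhs => rw [← T.hE_dual₂ m hm, map_sum, sum_mul]
    rw [sum_mul, sum_mul]
    refine sum_congr rfl fun i _ => ?_
    rw [hr _ (T.hE_mem _ (mul_mem (T.hyb i) hm)) _ (T.hxb i),
      mul_assoc, mul_assoc, mul_assoc, ← mul_assoc (T.yb i), ← mul_assoc T.e₁,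
      T.he₁me₁ _ (mul_mem (T.hyb i) hm), mul_assoc]
  refine ⟨_, T.mem_A.2 ⟨hM₁, fun n hn => T.ext_M₁ fun m hm => ?_⟩, fun m hm =>
    eq_of_mul_e₁ (T.act_mem hM₁ hm) (hf m hm) (by rw [T.act_mul_e₁ hM₁ hm, key m hm])⟩
  rw [mul_assoc, mul_assoc, ← mul_assoc _ m, key m hm, mul_assoc _ n,
    key _ (mul_mem (T.hNM hn) hm), hl n hn m hm, mul_assoc]

theorem casimir {a : R} (ha : a ∈ T.A) :
    ∑ i, T.xb i * a * T.yb i = (T.lam⁻¹ * T.F a) • (1 : R) := by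
  have hM₁ : ∑ i, T.xb i * a * T.yb i ∈ T.M₁ := sum_mem fun i _ =>
    mul_mem (mul_mem (T.hMM₁ (T.hxb i)) (T.A_le_M₁ ha)) (T.hMM₁ (T.hyb i))
  obtain ⟨μ, hμ⟩ := T.hCM₁M _ hM₁ fun m hm => by
    calc _ = ∑ l, ∑ j, T.xb l * a * (T.E (T.yb l * m * T.xb j) * T.yb j) := by
          rw [sum_mul]
          refine sum_congr rfl fun l _ => ?_
          rw [← mul_sum, T.hE_dual₁ _ (mul_mem (T.hyb l) hm), mul_assoc, mul_assoc]
      _ = ∑ j, (∑ l, T.xb l * T.E (T.yb l * (m * T.xb j))) * a * T.yb j := by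
          rw [sum_comm]
          simp_rw [sum_mul]
          refine sum_congr rfl fun j _ => sum_congr rfl fun l _ => ?_
          have : T.E (T.yb l * (m * T.xb j)) ∈ T.N :=
            T.hE_mem _ (mul_mem (T.hyb l) (mul_mem hm (T.hxb j)))
          rw [mul_assoc (T.xb l) (T.E _) a, T.A_comm ha this]
          simp only [mul_assoc]
      _ = _ := by
          rw [mul_sum]
          refine sum_congr rfl fun j _ => ?_
          rw [T.hE_dual₂ _ (mul_mem hm (T.hxb j)), mul_assoc, mul_assoc, mul_assoc]
  have h := congrArg T.EM hμ
  rw [map_sum, map_smul, T.hEM_one, ← hμ] at h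
  rw [← h]
  have : ∀ i, T.EM (T.xb i * a * T.yb i) = T.F a • (T.xb i * T.yb i) := fun i => by
    rw [T.hEM_bimod _ (T.hxb i) _ (T.hyb i) _ (T.A_le_M₁ ha), T.EM_A ha]
    simp
  simp_rw [this, ← smul_sum, T.hE_index, smul_smul, mul_comm]

theorem sum_x_act_y {a : R} (ha : a ∈ T.A) :
    ∑ i, T.xb i * T.act a (T.yb i) = (T.lam⁻¹ * T.F a) • (1 : R) := by
  refine eq_of_mul_e₁ (sum_mem fun i _ => mul_mem (T.hxb i) (T.act_mem (T.A_le_M₁ ha) (T.hyb i)))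
    (T.M.smul_mem T.M.one_mem _) ?_
  rw [← T.casimir ha, sum_mul, sum_mul]
  refine sum_congr rfl fun i _ => ?_
  rw [mul_assoc, T.act_mul_e₁ (T.A_le_M₁ ha) (T.hyb i)]
  simp only [mul_assoc]

theorem act_one_right {a : R} (ha : a ∈ T.A) :
    T.act a 1 = (T.lam⁻¹ * T.F (a * T.e₁)) • (1 : R) := by
  rw [act_apply, mul_one, T.EM_A (mul_mem ha T.e₁_mem), smul_smul]

end JonesTower

namespace JonesTower

open Finset

set_option linter.unusedSectionVars false

variable {T : JonesTower k R}

theorem eq_zero_of_sum_mul_zb [Nontrivial R] {m : Fin T.r → R} (hm : ∀ a, m a ∈ T.M)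
    (h : ∑ a, m a * T.zb a = 0) : m = 0 := by
  have h1 : ∀ i, ∑ a, T.F (T.zb a * T.zb i) • m a = 0 := by
    intro i
    have := congrArg (fun x => T.EM (x * T.zb i)) h
    simp only [sum_mul, map_sum, zero_mul, map_zero] at this
    rw [← this]
    refine sum_congr rfl fun a _ => ?_
    rw [mul_assoc, T.EM_left (hm a) (mul_mem (T.hzbM₁ a) (T.hzbM₁ i)),
      T.EM_A (mul_mem (T.zb_mem a) (T.zb_mem i)), mul_smul_comm, mul_one]
  have h2 : ∀ a b, ∑ i, T.F (T.zb a * T.zb i) * T.F (T.wb b * T.wb i) = if b = a then 1 else 0 := by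
    intro a b
    rw [← T.F_wb_zb]
    conv_rhs => rw [← T.sum_F_wb (T.zb_mem a), mul_sum, map_sum]
    simp
  funext b
  have := congrArg (fun f : Fin T.r → R => ∑ i, T.F (T.wb b * T.wb i) • f i) (funext h1)
  simp only [smul_sum, smul_smul, smul_zero, sum_const_zero] at this
  rw [sum_comm] at this
  simp_rw [← sum_smul, mul_comm (T.F (T.wb b * _)), h2, ite_smul, one_smul, zero_smul] at this
  simpa using this

theorem eq_zero_of_sum_zb [Nontrivial R] {c : Fin T.r → k} (h : ∑ a, c a • T.zb a = 0) :
    c = 0 := by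
  funext i
  have := congrArg (fun x => T.F (T.wb i * x)) h
  simpa [mul_sum, T.F_wb_zb] using this

theorem eq_zero_of_sum_act [Nontrivial R] {c : Fin T.r → k}
    (h : ∀ m ∈ T.M, ∑ i, c i • T.act (T.zb i) m = 0) : c = 0 := by
  refine T.eq_zero_of_sum_zb (T.eq_of_act ?_ T.M₁.zero_mem fun m hm => ?_)
  · exact sum_mem fun i _ => T.M₁.smul_mem (T.hzbM₁ i) _
  · simpa using h m hm

theorem ext_act [Nontrivial R] {c d : Fin T.r → k}
    (h : ∀ m ∈ T.M, ∑ i, c i • T.act (T.zb i) m = ∑ i, d i • T.act (T.zb i) m) (i : Fin T.r) :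
    c i = d i := by
  have := T.eq_zero_of_sum_act (c := c - d) fun m hm => by
    simp only [Pi.sub_apply, sub_smul, sum_sub_distrib, h m hm, sub_self]
  exact sub_eq_zero.1 (congrFun this i)

theorem ext_act_mul [Nontrivial R] {c d : Fin T.r → Fin T.r → k}
    (h : ∀ m ∈ T.M, ∑ i, ∑ a, c i a • (T.act (T.zb i) m * T.zb a)
      = ∑ i, ∑ a, d i a • (T.act (T.zb i) m * T.zb a)) (i a : Fin T.r) :
    c i a = d i a := by
  refine T.ext_act (c := fun i => c i a) (d := fun i => d i a) (fun m hm => ?_) i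
  have hM : ∀ i, T.act (T.zb i) m ∈ T.M := fun i => T.act_mem (T.hzbM₁ i) hm
  have := T.eq_zero_of_sum_mul_zb
    (m := fun a => ∑ i, c i a • T.act (T.zb i) m - ∑ i, d i a • T.act (T.zb i) m)
    (fun a => sub_mem (sum_mem fun i _ => T.M.smul_mem (hM i) _)
      (sum_mem fun i _ => T.M.smul_mem (hM i) _)) (by
    simp only [sub_mul, sum_mul, smul_mul_assoc, sum_sub_distrib]
    rw [sum_comm, h m hm, sum_comm, sub_self])
  exact sub_eq_zero.1 (congrFun this a)

theorem ext_act_act_mul [Nontrivial R] {c d : Fin T.r → Fin T.r → Fin T.r → k}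
    (h : ∀ m ∈ T.M, ∀ m' ∈ T.M,
      ∑ i, ∑ a, ∑ b, c i a b • (T.act (T.zb i) m * T.act (T.zb a) m' * T.zb b)
      = ∑ i, ∑ a, ∑ b, d i a b • (T.act (T.zb i) m * T.act (T.zb a) m' * T.zb b))
    (i a b : Fin T.r) : c i a b = d i a b := by
  refine T.ext_act_mul (c := fun i a => c i a b) (d := fun i a => d i a b) (fun m hm => ?_) i a
  have hM : ∀ i, T.act (T.zb i) m ∈ T.M := fun i => T.act_mem (T.hzbM₁ i) hm
  have hM₁ : ∀ c : Fin T.r → Fin T.r → k, ∑ i, ∑ a, c i a • (T.act (T.zb i) m * T.zb a) ∈ T.M₁ :=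
    fun c => sum_mem fun i _ => sum_mem fun a _ =>
      T.M₁.smul_mem (mul_mem (T.hMM₁ (hM i)) (T.hzbM₁ a)) _
  refine T.eq_of_act (hM₁ _) (hM₁ _) fun m' hm' => ?_
  simp only [map_sum, LinearMap.sum_apply, map_smul, LinearMap.smul_apply]
  have e : ∀ i a, T.act (T.act (T.zb i) m * T.zb a) m'
      = T.act (T.zb i) m * T.act (T.zb a) m' := fun i a =>
    (T.mul_act (hM i) (T.hzbM₁ a) hm').symm
  simp_rw [e]
  have hMM : ∀ i a, T.act (T.zb i) m * T.act (T.zb a) m' ∈ T.M := fun i a =>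
    mul_mem (hM i) (T.act_mem (T.hzbM₁ a) hm')
  have := T.eq_zero_of_sum_mul_zb
    (m := fun b => ∑ i, ∑ a, c i a b • (T.act (T.zb i) m * T.act (T.zb a) m')
      - ∑ i, ∑ a, d i a b • (T.act (T.zb i) m * T.act (T.zb a) m'))
    (fun b => sub_mem (sum_mem fun i _ => sum_mem fun a _ => T.M.smul_mem (hMM i a) _)
      (sum_mem fun i _ => sum_mem fun a _ => T.M.smul_mem (hMM i a) _)) (by
    simp only [sub_mul, sum_mul, smul_mul_assoc, sum_sub_distrib]
    rw [Leg.sum_rot (ι := Fin T.r) (fun b i a => c i a b • _),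
      Leg.sum_rot (ι := Fin T.r) (fun b i a => d i a b • _), h m hm m' hm', sub_self])
  exact sub_eq_zero.1 (congrFun this b)

theorem exists_coeff [Nontrivial R] (j b : Fin T.r) : ∃ c : Fin T.r → Fin T.r → k, ∀ m ∈ T.M,
    ∑ i, ∑ a, c i a • (T.act (T.zb i) m * T.zb a) = T.zb j * m * T.zb b := by
  have hP : ∀ q, ∃ p ∈ T.A, ∀ m ∈ T.M, T.act p m = T.EM (T.zb j * m * T.zb q) := by
    intro q
    refine T.exists_act_eq (T.EM ∘ₗ LinearMap.mulRight k (T.zb q) ∘ₗ LinearMap.mulLeft k (T.zb j))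
      ?_ ?_ ?_
    · intro m hm
      exact T.hEM_mem _ (mul_mem (mul_mem (T.hzbM₁ j) (T.hMM₁ hm)) (T.hzbM₁ q))
    · intro n hn m hm
      have := T.EM_left (T.hNM hn) (mul_mem (mul_mem (T.hzbM₁ j) (T.hMM₁ hm)) (T.hzbM₁ q))
      simp only [LinearMap.comp_apply, LinearMap.mulLeft_apply, LinearMap.mulRight_apply]
      rw [← this, ← mul_assoc, T.hzbN j n hn]
      simp only [mul_assoc]
    · intro n hn m hm
      have := T.EM_right (T.hNM hn) (mul_mem (mul_mem (T.hzbM₁ j) (T.hMM₁ hm)) (T.hzbM₁ q))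
      simp only [LinearMap.comp_apply, LinearMap.mulLeft_apply, LinearMap.mulRight_apply]
      rw [← this, mul_assoc _ (T.zb q), T.hzbN q n hn]
      simp only [mul_assoc]
  choose p hpA hp using hP
  refine ⟨fun i a => ∑ q, T.F (T.wb i * p q) * T.F (T.wb a * (T.wb q * T.zb b)), fun m hm => ?_⟩
  calc _ = ∑ q, T.act (∑ i, T.F (T.wb i * p q) • T.zb i) m
        * ∑ a, T.F (T.wb a * (T.wb q * T.zb b)) • T.zb a := by
        simp only [sum_smul, map_sum, LinearMap.sum_apply, map_smul, LinearMap.smul_apply,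
          sum_mul_sum, smul_mul_smul_comm]
        rw [← Leg.sum_rot]
    _ = ∑ q, T.EM (T.zb j * m * T.zb q) * T.wb q * T.zb b := by
        refine sum_congr rfl fun q _ => ?_
        rw [T.sum_F_zb (hpA q), T.sum_F_zb (mul_mem (T.wb_mem q) (T.zb_mem b)), hp q m hm,
          mul_assoc (T.EM _)]
    _ = _ := by rw [← sum_mul, T.hzw_dual₁ _ (mul_mem (T.hzbM₁ j) (T.hMM₁ hm))]

end JonesTower

namespace JonesTower

open Finset Matrix

set_option linter.unusedSectionVars false

theorem sum_comm_pair {ι κ μ ν X : Type*} [Fintype ι] [Fintype κ] [Fintype μ] [Fintype ν]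
    [AddCommMonoid X] (f : ι → κ → μ → ν → X) :
    ∑ a, ∑ b, ∑ c, ∑ d, f a b c d = ∑ c, ∑ d, ∑ a, ∑ b, f a b c d := by
  calc _ = ∑ x : ι × κ, ∑ y : μ × ν, f x.1 x.2 y.1 y.2 := by simp [Fintype.sum_prod_type]
    _ = _ := by rw [sum_comm]; simp [Fintype.sum_prod_type]

variable (T : JonesTower k R)
  [Nontrivial R]

/-- The blocks of the pentagon matrix of the tower. -/
noncomputable def blocks (i j : Fin T.r) : Matrix (Fin T.r) (Fin T.r) k :=
  of fun a b => (T.exists_coeff j b).choose i a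

variable {T}

theorem sum_blocks {m : R} (hm : m ∈ T.M) (j b : Fin T.r) :
    ∑ i, ∑ a, T.blocks i j a b • (T.act (T.zb i) m * T.zb a) = T.zb j * m * T.zb b :=
  (T.exists_coeff j b).choose_spec m hm

theorem sum_blocks_act {m m' : R} (hm : m ∈ T.M) (hm' : m' ∈ T.M) (j b : Fin T.r) :
    ∑ i, ∑ a, T.blocks i j a b • (T.act (T.zb i) m * T.act (T.zb a) m')
      = T.act (T.zb j) (m * T.act (T.zb b) m') := by
  rw [T.act_act (T.hzbM₁ j) hm (T.hzbM₁ b) hm', ← T.sum_blocks hm]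
  simp only [map_sum, LinearMap.sum_apply, map_smul, LinearMap.smul_apply]
  refine sum_congr rfl fun i _ => sum_congr rfl fun a _ => ?_
  rw [T.mul_act (T.act_mem (T.hzbM₁ i) hm) (T.hzbM₁ a) hm']

theorem blocks_pent (i j a c : Fin T.r) :
    ∑ q, ∑ x, T.blocks i q a x • (T.blocks q j * T.blocks x c)
      = ∑ x, T.blocks i j x c • T.blocks a x := by
  ext b d
  refine T.ext_act_act_mul
    (c := fun i a b => (∑ q, ∑ x, T.blocks i q a x • (T.blocks q j * T.blocks x c)) b d)
    (d := fun i a b => (∑ x, T.blocks i j x c • T.blocks a x) b d) (fun m hm m' hm' => ?_) i a b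
  have hM : ∀ x, m * T.act (T.zb x) m' ∈ T.M := fun x =>
    mul_mem hm (T.act_mem (T.hzbM₁ x) hm')
  have lhs : ∑ i, ∑ a, ∑ b, (∑ q, ∑ x, T.blocks i q a x • (T.blocks q j * T.blocks x c)) b d •
      (T.act (T.zb i) m * T.act (T.zb a) m' * T.zb b) = T.zb j * m * T.zb c * m' * T.zb d := by
    calc _ = ∑ x, ∑ y, T.blocks x c y d • ∑ q, ∑ b, T.blocks q j b y •
          ((∑ i, ∑ a, T.blocks i q a x • (T.act (T.zb i) m * T.act (T.zb a) m')) * T.zb b) := by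
          simp only [Matrix.sum_apply, Matrix.smul_apply, Matrix.mul_apply, smul_eq_mul, mul_sum,
            sum_smul, sum_mul, smul_sum, smul_mul_assoc, smul_smul]
          refine (sum_congr rfl fun i _ => sum_congr rfl fun a _ => sum_comm_pair _).trans ?_
          rw [sum_comm_pair]
          refine sum_congr rfl fun x _ => sum_congr rfl fun y _ => ?_
          rw [sum_comm_pair, sum_comm]
          refine sum_congr rfl fun q _ => sum_congr rfl fun b _ => sum_congr rfl fun i _ =>
            sum_congr rfl fun a _ => ?_
          congr 1
          ring
      _ = ∑ x, ∑ y, T.blocks x c y d • (T.zb j * (m * T.act (T.zb x) m') * T.zb y) := by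
          refine sum_congr rfl fun x _ => sum_congr rfl fun y _ => ?_
          rw [← T.sum_blocks (hM x)]
          simp_rw [T.sum_blocks_act hm hm']
      _ = T.zb j * m * ∑ x, ∑ y, T.blocks x c y d • (T.act (T.zb x) m' * T.zb y) := by
          simp only [mul_sum, mul_smul_comm, mul_assoc]
      _ = _ := by rw [T.sum_blocks hm']; simp only [mul_assoc]
  have rhs : ∑ i, ∑ a, ∑ b, (∑ x, T.blocks i j x c • T.blocks a x) b d •
      (T.act (T.zb i) m * T.act (T.zb a) m' * T.zb b) = T.zb j * m * T.zb c * m' * T.zb d := by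
    calc _ = ∑ i, ∑ x, T.blocks i j x c • (T.act (T.zb i) m *
          ∑ a, ∑ b, T.blocks a x b d • (T.act (T.zb a) m' * T.zb b)) := by
          simp only [Matrix.sum_apply, Matrix.smul_apply, smul_eq_mul, mul_sum,
            sum_smul, smul_sum, mul_smul_comm, smul_smul, mul_assoc]
          refine sum_congr rfl fun i _ => ?_
          rw [← Leg.sum_rot]
      _ = (∑ i, ∑ x, T.blocks i j x c • (T.act (T.zb i) m * T.zb x)) * m' * T.zb d := by
          simp_rw [T.sum_blocks hm', sum_mul, smul_mul_assoc, mul_assoc]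
      _ = _ := by rw [T.sum_blocks hm]
  rw [lhs, rhs]

theorem blocks_β (i : Fin T.r) : ∑ j, T.F (T.wb j * 1) • T.blocks i j
    = T.F (T.wb i * 1) • (1 : Matrix (Fin T.r) (Fin T.r) k) := by
  ext a b
  refine T.ext_act_mul (c := fun i a => (∑ j, T.F (T.wb j * 1) • T.blocks i j) a b)
    (d := fun i a => (T.F (T.wb i * 1) • (1 : Matrix (Fin T.r) (Fin T.r) k)) a b)
    (fun m hm => ?_) i a
  calc _ = ∑ j, T.F (T.wb j * 1) •
        ∑ i, ∑ a, T.blocks i j a b • (T.act (T.zb i) m * T.zb a) := by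
        simp only [Matrix.sum_apply, Matrix.smul_apply, smul_eq_mul, sum_smul, smul_sum, smul_smul]
        rw [← Leg.sum_rot]
    _ = (∑ j, T.F (T.wb j * 1) • T.zb j) * m * T.zb b := by
        simp_rw [T.sum_blocks hm, sum_mul, smul_mul_assoc]
    _ = T.act (∑ i, T.F (T.wb i * 1) • T.zb i) m * T.zb b := by
        rw [T.sum_F_zb T.A.one_mem, T.act_one hm, one_mul]
    _ = _ := by
        simp [Matrix.one_apply, sum_mul, ite_smul]

theorem blocks_φ (j : Fin T.r) : ∑ i, T.F (T.zb i) • T.blocks i j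
    = T.F (T.zb j) • (1 : Matrix (Fin T.r) (Fin T.r) k) := by
  ext a b
  rw [← sub_eq_zero]
  refine congrFun (T.eq_zero_of_sum_zb (c := fun a => (∑ i, T.F (T.zb i) • T.blocks i j) a b
    - (T.F (T.zb j) • (1 : Matrix (Fin T.r) (Fin T.r) k)) a b) ?_) a
  simp_rw [sub_smul, sum_sub_distrib]
  rw [sub_eq_zero]
  calc _ = ∑ i, ∑ a, T.blocks i j a b • ((T.F (T.zb i) • (1 : R)) * T.zb a) := by
        simp only [Matrix.sum_apply, Matrix.smul_apply, smul_eq_mul, sum_smul, smul_mul_assoc,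
          one_mul, smul_smul]
        rw [sum_comm]
        simp only [mul_comm]
    _ = ∑ i, ∑ a, T.blocks i j a b •
          ((T.lam • ∑ q, T.xb q * T.act (T.zb i) (T.yb q)) * T.zb a) := by
        refine sum_congr rfl fun i _ => ?_
        rw [T.sum_x_act_y (T.zb_mem i), smul_smul, mul_inv_cancel_left₀ T.hlam]
    _ = T.lam • ∑ q, T.xb q *
          ∑ i, ∑ a, T.blocks i j a b • (T.act (T.zb i) (T.yb q) * T.zb a) := by
        simp only [mul_sum, sum_mul, smul_sum, mul_smul_comm, smul_mul_assoc, mul_assoc]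
        rw [← Leg.sum_rot]
        simp only [smul_comm T.lam]
    _ = T.lam • (∑ q, T.xb q * T.zb j * T.yb q) * T.zb b := by
        simp_rw [T.sum_blocks (T.hyb _), smul_mul_assoc, sum_mul, mul_assoc]
    _ = _ := by
        rw [T.casimir (T.zb_mem j), smul_smul, mul_inv_cancel_left₀ T.hlam]
        simp [Matrix.one_apply]

theorem blocks_α (i j a : Fin T.r) :
    ∑ b, T.blocks i j a b * T.F (T.wb b * T.e₁) = if i = j then T.F (T.wb a * T.e₁) else 0 := by
  refine T.ext_act_mul (c := fun i a => ∑ b, T.blocks i j a b * T.F (T.wb b * T.e₁))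
    (d := fun i a => if i = j then T.F (T.wb a * T.e₁) else 0) (fun m hm => ?_) i a
  calc _ = ∑ b, T.F (T.wb b * T.e₁) •
        ∑ i, ∑ a, T.blocks i j a b • (T.act (T.zb i) m * T.zb a) := by
        simp only [sum_smul, smul_sum, smul_smul]
        rw [← Leg.sum_rot]
        simp only [mul_comm]
    _ = T.zb j * m * (∑ b, T.F (T.wb b * T.e₁) • T.zb b) := by
        simp_rw [T.sum_blocks hm, mul_sum, mul_smul_comm]
    _ = T.act (T.zb j) m * (∑ b, T.F (T.wb b * T.e₁) • T.zb b) := by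
        rw [T.sum_F_zb T.e₁_mem, T.act_mul_e₁ (T.hzbM₁ j) hm]
    _ = _ := by
        simp [mul_sum, ite_smul]

theorem blocks_ε (i j b : Fin T.r) :
    ∑ a, T.lam⁻¹ * T.F (T.zb a * T.e₁) * T.blocks i j a b
      = if i = j then T.lam⁻¹ * T.F (T.zb b * T.e₁) else 0 := by
  refine T.ext_act (c := fun i => ∑ a, T.lam⁻¹ * T.F (T.zb a * T.e₁) * T.blocks i j a b)
    (d := fun i => if i = j then T.lam⁻¹ * T.F (T.zb b * T.e₁) else 0) (fun m hm => ?_) i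
  have h := T.sum_blocks_act hm T.M.one_mem j b
  simp only [T.act_one_right (T.zb_mem _), mul_smul_comm, mul_one, map_smul, smul_smul] at h
  simp only [sum_smul, ite_smul, zero_smul, sum_ite_eq', mem_univ, if_true]
  rw [← h]
  simp only [mul_comm (T.blocks _ _ _ _)]

theorem blocks_unit (j a : Fin T.r) :
    ∑ b, (∑ i, (T.lam⁻¹ * T.F (T.zb i * T.e₁)) • T.blocks i j) a b * T.F (T.wb b * 1)
      = if a = j then 1 else 0 := by
  rw [← sub_eq_zero]
  refine congrFun (T.eq_zero_of_sum_zb (c := fun a =>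
    ∑ b, (∑ i, (T.lam⁻¹ * T.F (T.zb i * T.e₁)) • T.blocks i j) a b * T.F (T.wb b * 1)
      - if a = j then 1 else 0) ?_) a
  simp_rw [sub_smul, sum_sub_distrib]
  rw [sub_eq_zero]
  calc _ = ∑ b, T.F (T.wb b * 1) •
        ∑ i, ∑ a, T.blocks i j a b • (T.act (T.zb i) 1 * T.zb a) := by
        simp only [Matrix.sum_apply, Matrix.smul_apply, smul_eq_mul, sum_smul, smul_sum, smul_smul,
          T.act_one_right (T.zb_mem _), smul_mul_assoc, one_mul, sum_mul]
        rw [Leg.sum_rot]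
        refine sum_congr rfl fun b _ => sum_congr rfl fun i _ => sum_congr rfl fun a _ => ?_
        congr 1
        ring
    _ = T.zb j * ∑ b, T.F (T.wb b * 1) • T.zb b := by
        simp_rw [T.sum_blocks T.M.one_mem, mul_one, mul_sum, mul_smul_comm]
    _ = _ := by
        rw [T.sum_F_zb T.A.one_mem]
        simp

theorem blocks_injective {v : Fin T.r → Fin T.r → k}
    (h : ∀ i a, ∑ j, ∑ b, T.blocks i j a b * v j b = 0) (j b : Fin T.r) : v j b = 0 := by
  have h1 : ∀ m ∈ T.M, ∑ j, ∑ b, v j b • (T.zb j * m * T.zb b) = 0 := by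
    intro m hm
    simp_rw [← T.sum_blocks hm]
    calc _ = ∑ i, ∑ a, (∑ j, ∑ b, T.blocks i j a b * v j b) • (T.act (T.zb i) m * T.zb a) := by
          simp only [sum_smul, smul_sum, smul_smul]
          rw [sum_comm_pair]
          simp only [mul_comm]
      _ = 0 := by simp [h]
  have h2 : ∑ b, v j b • T.zb b = 0 := by
    have : ∑ q, T.xb q * T.wb j * ∑ i, ∑ b, v i b • (T.zb i * T.yb q * T.zb b) = 0 := by
      simp [h1 _ (T.hyb _)]
    have e : ∑ q, T.xb q * T.wb j * ∑ i, ∑ b, v i b • (T.zb i * T.yb q * T.zb b)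
        = ∑ i, ∑ b, v i b • ((∑ q, T.xb q * (T.wb j * T.zb i) * T.yb q) * T.zb b) := by
      simp only [mul_sum, sum_mul, smul_sum, mul_smul_comm, mul_assoc]
      rw [Leg.sum_rot]
    rw [e] at this
    simp_rw [T.casimir (mul_mem (T.wb_mem j) (T.zb_mem _)), T.F_wb_zb] at this
    have h3 : T.lam⁻¹ • ∑ b, v j b • T.zb b = 0 := by
      rw [← this, smul_sum]
      rw [sum_comm]
      refine sum_congr rfl fun b _ => ?_
      simp [smul_smul, mul_comm]
    exact (smul_eq_zero.1 h3).resolve_left (inv_ne_zero T.hlam)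
  exact congrFun (T.eq_zero_of_sum_zb h2) b

end JonesTower

namespace JonesTower

open Finset Matrix

set_option linter.unusedSectionVars false

variable (T : JonesTower k R)
  [Nontrivial R]

theorem exists_blocks_inv : ∃ V : Matrix (Fin 2 → Fin T.r) (Fin 2 → Fin T.r) k,
    Leg.ofBlk T.blocks * V = 1 ∧ V * Leg.ofBlk T.blocks = 1 := by
  have hu : IsUnit (Leg.ofBlk T.blocks) := by
    rw [← Matrix.mulVec_injective_iff_isUnit]
    refine (injective_iff_map_eq_zero (Leg.ofBlk T.blocks).mulVecLin).2 fun v hv => ?_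
    have h : ∀ j b, v ![j, b] = 0 := fun j b => by
      refine T.blocks_injective (v := fun j b => v ![j, b]) (fun i a => ?_) j b
      have := congrFun hv ![i, a]
      rw [mulVecLin_apply, mulVec, dotProduct, Leg.sum_fin_two] at this
      exact this
    funext x
    exact (congrArg v (Leg.vec_eta_two x)).trans (h _ _)
  obtain ⟨⟨X, V, h1, h2⟩, rfl⟩ := hu
  exact ⟨V, h1, h2⟩

/-- The invertible solution of the pentagon equation on the second centralizer. -/
noncomputable def preSys : Leg.PreSys (Fin T.r) k where
  u := T.blocks
  U := Leg.blk T.exists_blocks_inv.choose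
  huU := (Leg.mul_eq_one_iff_blk _ _).1 T.exists_blocks_inv.choose_spec.1
  hUu := (Leg.mul_eq_one_iff_blk _ _).1 T.exists_blocks_inv.choose_spec.2
  pent := T.blocks_pent
  β i := T.F (T.wb i * 1)
  α i := T.F (T.wb i * T.e₁)
  φ i := T.F (T.zb i)
  ε i := T.lam⁻¹ * T.F (T.zb i * T.e₁)
  hβ := T.blocks_β
  hφ := T.blocks_φ
  hα := T.blocks_α
  hε := T.blocks_ε
  hεβ := by
    have := congrArg (fun x => T.F (x * T.e₁)) (T.sum_F_zb T.A.one_mem)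
    simp only [sum_mul, map_sum, smul_mul_assoc, map_smul, smul_eq_mul, one_mul, F_e₁] at this
    simp_rw [mul_assoc, ← mul_sum, mul_comm (T.F (T.zb _ * _)), this]
    exact inv_mul_cancel₀ T.hlam

theorem preSys_p : T.preSys.p = T.lam := by
  have := congrArg T.F (T.sum_F_zb T.e₁_mem)
  simp only [map_sum, map_smul, smul_eq_mul, F_e₁] at this
  rw [← this]
  exact sum_congr rfl fun _ _ => mul_comm _ _

theorem preSys_εα : ∑ i, T.preSys.ε i * T.preSys.α i = 1 := by
  have := congrArg (fun x => T.F (x * T.e₁)) (T.sum_F_zb T.e₁_mem)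
  simp only [sum_mul, map_sum, smul_mul_assoc, map_smul, smul_eq_mul, e₁_mul_e₁, F_e₁] at this
  change ∑ i, T.lam⁻¹ * T.F (T.zb i * T.e₁) * T.F (T.wb i * T.e₁) = 1
  simp_rw [mul_assoc, ← mul_sum, mul_comm (T.F (T.zb _ * _)), this]
  exact inv_mul_cancel₀ T.hlam

theorem preSys_φβ : ∑ i, T.preSys.φ i * T.preSys.β i = 1 := by
  have := congrArg T.F (T.sum_F_zb T.A.one_mem)
  simp only [map_sum, map_smul, smul_eq_mul, F_one] at this
  rw [← this]
  exact sum_congr rfl fun _ _ => mul_comm _ _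

theorem preSys_regular : T.preSys.Regular where
  unit := T.blocks_unit
  p_ne := by rw [preSys_p]; exact T.hlam
  εα_ne := by rw [preSys_εα]; exact one_ne_zero
  φβ_ne := by rw [preSys_φβ]; exact one_ne_zero

theorem lam_inv_eq : T.lam⁻¹ = (T.r : k) := by
  have := T.preSys_regular.mul_eq_card_mul
  rw [preSys_p, preSys_εα, preSys_φβ, one_mul, Fintype.card_fin] at this
  exact (eq_inv_of_mul_eq_one_left this.symm).symm

end JonesTower

namespace JonesTower

open Finset

set_option linter.unusedSectionVars false

variable {T : JonesTower k R}

theorem A_le_C {a : R} (ha : a ∈ T.A) : a ∈ T.C := T.mem_C.2 fun _ hn => T.A_comm ha hn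

theorem e₂_mem_C : T.e₂ ∈ T.C := T.mem_C.2 fun n hn => (T.he₂M n (T.hNM hn)).symm

theorem ub_mem_C (j : Fin T.s) : T.ub j ∈ T.C :=
  T.mem_C.2 fun n hn => (T.hubM j n (T.hNM hn)).symm

theorem vb_mem_C (j : Fin T.s) : T.vb j ∈ T.C :=
  T.mem_C.2 fun n hn => (T.hvbM j n (T.hNM hn)).symm

theorem EM1_mem_A {c : R} (hc : c ∈ T.C) : T.EM1 c ∈ T.A :=
  T.mem_A.2 ⟨T.hEM1_mem c, fun n hn => by
    rw [← T.EM1_left (T.hMM₁ (T.hNM hn)), T.mem_C.1 hc n hn, T.EM1_right (T.hMM₁ (T.hNM hn))]⟩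

theorem M₂_induction {P : R → Prop} (h : ∀ w ∈ T.M₁, ∀ w' ∈ T.M₁, P (w * T.e₂ * w'))
    (zero : P 0) (add : ∀ x y, P x → P y → P (x + y)) (smul : ∀ (c : k) x, P x → P (c • x))
    (x : R) : P x := by
  have hx : x ∈ (⊤ : Submodule k R) := Submodule.mem_top
  rw [T.hspanM₂] at hx
  refine Submodule.span_induction ?_ zero (fun x y _ _ => add x y) (fun c x _ => smul c x) hx
  rintro _ ⟨w, hw, w', hw', rfl⟩
  exact h w hw w' hw'

theorem EM1_mul_e₂ (x : R) : T.EM1 (x * T.e₂) * T.e₂ = T.lam • (x * T.e₂) := by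
  refine T.M₂_induction (P := fun x => T.EM1 (x * T.e₂) * T.e₂ = T.lam • (x * T.e₂))
    ?_ (by simp) ?_ ?_ x
  · intro w hw w' hw'
    have hE : T.EM w' ∈ T.M₁ := T.hMM₁ (T.hEM_mem w' hw')
    rw [mul_assoc w, mul_assoc w, T.he₂we₂ w' hw', ← mul_assoc,
      T.EM1_left (mul_mem hw hE), T.hEM1e₂]
    simp
  · intro x y hx hy
    rw [add_mul, map_add, add_mul, hx, hy, smul_add]
  · intro c x hx
    rw [smul_mul_assoc, map_smul, smul_mul_assoc, hx, smul_comm]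

theorem sum_z_e₂_w : ∑ i, T.zb i * T.e₂ * T.wb i = 1 := by
  suffices h : ∀ x, (∑ i, T.zb i * T.e₂ * T.wb i) * x = x by simpa using h 1
  refine T.M₂_induction ?_ (by simp) (fun x y hx hy => by rw [mul_add, hx, hy])
    (fun c x hx => by rw [mul_smul_comm, hx])
  intro w hw w' _
  conv_rhs => rw [← T.hzw_dual₂ w hw, sum_mul, sum_mul]
  rw [sum_mul]
  refine sum_congr rfl fun i _ => ?_
  have hi := mul_mem (T.hwbM₁ i) hw
  rw [mul_assoc (T.zb i) (T.EM _), ← T.he₂M _ (T.hEM_mem _ hi), T.he₂M _ (T.hEM_mem _ hi),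
    ← T.he₂we₂ _ hi]
  simp only [mul_assoc]

theorem e₂_mul_mul_e₂ {a : R} (ha : a ∈ T.A) : T.e₂ * a * T.e₂ = T.F a • T.e₂ := by
  rw [T.he₂we₂ a (T.A_le_M₁ ha), T.EM_A ha, smul_mul_assoc, one_mul]

theorem e₂_mul_mul_e₂_of_mem_C {c : R} (hc : c ∈ T.C) :
    T.e₂ * c * T.e₂ = (T.lam⁻¹ * T.F (T.EM1 (c * T.e₂))) • T.e₂ := by
  have h : c * T.e₂ = T.lam⁻¹ • (T.EM1 (c * T.e₂) * T.e₂) := by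
    rw [T.EM1_mul_e₂, smul_smul, inv_mul_cancel₀ T.hlam, one_smul]
  conv_lhs => rw [mul_assoc, h]
  rw [mul_smul_comm, ← mul_assoc, T.e₂_mul_mul_e₂ (T.EM1_mem_A (mul_mem hc T.e₂_mem_C)), smul_smul]

variable [Nontrivial R]

theorem e₂_ne_zero : T.e₂ ≠ 0 := fun h => by
  have := T.hEM1e₂
  rw [h, map_zero] at this
  exact smul_ne_zero T.hlam one_ne_zero this.symm

theorem unit_mul_unit (i j l m : Fin T.r) :
    T.zb i * T.e₂ * T.wb j * (T.zb l * T.e₂ * T.wb m) =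
      (if j = l then (1 : k) else 0) • (T.zb i * T.e₂ * T.wb m) := by
  have := T.e₂_mul_mul_e₂ (mul_mem (T.wb_mem j) (T.zb_mem l))
  rw [F_wb_zb] at this
  calc _ = T.zb i * (T.e₂ * (T.wb j * T.zb l) * T.e₂) * T.wb m := by simp only [mul_assoc]
    _ = _ := by rw [this, mul_smul_comm, smul_mul_assoc]

variable (T)

/-- The matrix units of the big centralizer. -/
noncomputable def unitC (i j : Fin T.r) : T.C :=
  ⟨T.zb i * T.e₂ * T.wb j,
    mul_mem (mul_mem (T.A_le_C (T.zb_mem i)) T.e₂_mem_C) (T.A_le_C (T.wb_mem j))⟩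

theorem unitC_mul_unitC (i j l m : Fin T.r) :
    T.unitC i j * T.unitC l m = (if j = l then (1 : k) else 0) • T.unitC i m :=
  Subtype.ext (T.unit_mul_unit i j l m)

theorem sum_unitC : ∑ i, T.unitC i i = 1 := Subtype.ext <| by
  rw [AddSubmonoidClass.coe_finsetSum]
  exact T.sum_z_e₂_w

/-- The matrix algebra inside the big centralizer. -/
noncomputable def matrixHom : Matrix (Fin T.r) (Fin T.r) k →ₐ[k] T.C :=
  AlgHom.ofLinearMap
    { toFun := fun X => ∑ i, ∑ j, X i j • T.unitC i j
      map_add' := fun X Y => by simp only [Matrix.add_apply, add_smul, sum_add_distrib]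
      map_smul' := fun c X => by
        simp only [Matrix.smul_apply, smul_eq_mul, mul_smul, smul_sum, RingHom.id_apply] }
    (by simp [Matrix.one_apply, ite_smul, T.sum_unitC])
    (fun X Y => by
      simp only [LinearMap.coe_mk, AddHom.coe_mk, Matrix.mul_apply, sum_smul, sum_mul, mul_sum,
        smul_mul_smul_comm, unitC_mul_unitC, ite_smul, one_smul, zero_smul, smul_ite, smul_zero,
        sum_ite_eq', mem_univ, if_true]
      exact (sum_congr rfl fun _ _ => sum_comm).trans
        (sum_comm.trans (sum_congr rfl fun _ _ => sum_comm)))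

theorem matrixHom_apply (X : Matrix (Fin T.r) (Fin T.r) k) :
    (T.matrixHom X : R) = ∑ i, ∑ j, X i j • (T.zb i * T.e₂ * T.wb j) := by
  simp [matrixHom, unitC]

theorem matrixHom_injective : Function.Injective T.matrixHom := by
  refine (injective_iff_map_eq_zero _).2 fun X hX => ?_
  ext a b
  have h : T.unitC a a * T.matrixHom X * T.unitC b b = X a b • T.unitC a b := by
    simp [matrixHom, mul_sum, sum_mul, unitC_mul_unitC]
  rw [hX, mul_zero, zero_mul] at h
  by_contra hab
  have h0 : T.unitC a b = 0 := (smul_eq_zero.1 h.symm).resolve_left hab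
  have h1 : T.wb a * (T.zb a * T.e₂ * T.wb b) * T.zb b = 0 := by
    rw [show T.zb a * T.e₂ * T.wb b = 0 from congrArg Subtype.val h0, mul_zero, zero_mul]
  have h2 := congrArg (fun x => T.e₂ * x * T.e₂) h1
  have ha := T.e₂_mul_mul_e₂ (mul_mem (T.wb_mem a) (T.zb_mem a))
  have hb := T.e₂_mul_mul_e₂ (mul_mem (T.wb_mem b) (T.zb_mem b))
  rw [F_wb_zb, if_pos rfl, one_smul] at ha hb
  refine T.e₂_ne_zero ?_
  calc T.e₂ = T.e₂ * (T.wb a * T.zb a) * T.e₂ * (T.wb b * T.zb b) * T.e₂ := by rw [ha, hb]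
    _ = T.e₂ * (T.wb a * (T.zb a * T.e₂ * T.wb b) * T.zb b) * T.e₂ := by simp only [mul_assoc]
    _ = 0 := by rw [h1, mul_zero, zero_mul]

theorem matrixHom_surjective : Function.Surjective T.matrixHom := by
  intro c
  have hc (i j : Fin T.r) : T.wb i * c * T.zb j ∈ T.C :=
    mul_mem (mul_mem (T.A_le_C (T.wb_mem i)) c.2) (T.A_le_C (T.zb_mem j))
  refine ⟨Matrix.of fun i j => T.lam⁻¹ * T.F (T.EM1 (T.wb i * c * T.zb j * T.e₂)),
    Subtype.ext ?_⟩
  rw [matrixHom_apply]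
  calc _ = ∑ i, ∑ j, T.zb i * T.e₂ * T.wb i * c * (T.zb j * T.e₂ * T.wb j) := by
        refine sum_congr rfl fun i _ => sum_congr rfl fun j _ => ?_
        rw [Matrix.of_apply, ← smul_mul_assoc, ← mul_smul_comm,
          ← T.e₂_mul_mul_e₂_of_mem_C (hc i j)]
        simp only [mul_assoc]
    _ = (∑ i, T.zb i * T.e₂ * T.wb i) * c * ∑ j, T.zb j * T.e₂ * T.wb j := by
        simp only [sum_mul, mul_sum]
        exact sum_comm
    _ = c := by rw [T.sum_z_e₂_w, one_mul, mul_one]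

/-- The big centralizer is a full matrix algebra. -/
noncomputable def equivMatrix : T.C ≃ₐ[k] Matrix (Fin T.r) (Fin T.r) k :=
  (AlgEquiv.ofBijective T.matrixHom ⟨T.matrixHom_injective, T.matrixHom_surjective⟩).symm

/-- The coordinates of the big centralizer in the products of the dual bases. -/
noncomputable def equivFun : T.C ≃ₗ[k] (Fin T.s × Fin T.r → k) where
  toFun c p := T.F (T.wb p.2 * T.EM1 (T.vb p.1 * c))
  map_add' c d := by
    funext p
    simp [mul_add]
  map_smul' a c := by
    funext p
    simp
  invFun f := ∑ j, ∑ i, f (j, i) • ⟨T.ub j * T.zb i, mul_mem (T.ub_mem_C j) (T.A_le_C (T.zb_mem i))⟩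
  left_inv c := Subtype.ext <| by
    simp only [AddSubmonoidClass.coe_finsetSum, SetLike.val_smul]
    conv_rhs => rw [← T.huv_dual₂ c]
    refine sum_congr rfl fun j _ => ?_
    rw [← T.sum_F_zb (T.EM1_mem_A (mul_mem (T.vb_mem_C j) c.2)), mul_sum]
    simp_rw [mul_smul_comm, T.sum_F_zb (T.EM1_mem_A (mul_mem (T.vb_mem_C j) c.2))]
  right_inv f := by
    funext ⟨j, i⟩
    have h (l m) : T.EM1 (T.vb j * (T.ub l * T.zb m)) = if j = l then T.zb m else 0 := by
      rw [← mul_assoc, T.EM1_right (T.hzbM₁ m), T.huv_orth]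
      split_ifs <;> simp
    simp [mul_sum, h, F_wb_zb, mul_ite]

theorem r_eq_s : T.r = T.s := by
  have h := (T.equivMatrix.toLinearEquiv.symm.trans T.equivFun).finrank_eq
  rw [Module.finrank_matrix, Module.finrank_fintype_fun_eq_card] at h
  simp only [Fintype.card_fin, Fintype.card_prod, Module.finrank_self, mul_one] at h
  refine mul_right_cancel₀ (fun h0 => T.hlam ?_) h
  rw [← inv_eq_zero, T.lam_inv_eq, h0, Nat.cast_zero]

end JonesTower

/-- `C ≅ Mₛ(k)` as `k`-algebras, where `s` is the common cardinality of the
orthogonal dual bases `{uⱼ}, {vⱼ} ⊆ B` for `E_{M₁}`; moreover `char k ∤ s`,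
indeed `λ⁻¹ = s·1ₖ ≠ 0`. -/
theorem C_is_full_matrix_algebra (T : JonesTower k R) [Nontrivial R] :
    Nonempty (↥T.C ≃ₐ[k] Matrix (Fin T.s) (Fin T.s) k) ∧
    (T.s : k) ≠ 0 ∧ T.lam⁻¹ = (T.s : k) := by
  rw [← T.r_eq_s, ← T.lam_inv_eq]
  exact ⟨⟨T.equivMatrix⟩, inv_ne_zero T.hlam, rfl⟩
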